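/- (Unique continuation for the wave equation, Tataru–John form) Assume u ∈ H¹_loc solves (∂_t² − c²Δ)u = 0 on ℝ×ℝⁿ with c smooth, c ≥ c₀ > 0, and u = 0 in a neighborhood of [−T,T]×{x₀} for some T > 0 and x₀ ∈ ℝⁿ. Then u(t,x) = 0 for all (t,x) with |t| + dist(x₀,x) ≤ T, where dist is the distance of the metric c⁻²dx². -/

import Mathlib

/-- Euclidean Laplacian: sum of second partial derivatives. -/
noncomputable def euclLap (n : ℕ) (f : EuclideanSpace ℝ (Fin n) → ℝ)
    (x : EuclideanSpace ℝ (Fin n)) : ℝ :=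
  ∑ i : Fin n, fderiv ℝ (fun y => fderiv ℝ f y (EuclideanSpace.single i 1)) x
    (EuclideanSpace.single i 1)

/-- Distance induced by the sound speed metric `c⁻²dx²`: infimum of lengths
`∫₀¹ ‖γ'(t)‖ / c(γ(t)) dt` over `C¹` curves joining the two points. -/
noncomputable def soundDist (n : ℕ) (c : EuclideanSpace ℝ (Fin n) → ℝ)
    (x y : EuclideanSpace ℝ (Fin n)) : ℝ :=
  sInf {L : ℝ | ∃ γ : ℝ → EuclideanSpace ℝ (Fin n), ContDiff ℝ 1 γ ∧
    γ 0 = x ∧ γ 1 = y ∧ L = ∫ t in (0:ℝ)..1, ‖deriv γ t‖ / c (γ t)}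


open MeasureTheory

section Carl
variable {Z : Type*} [NormedAddCommGroup Z] [NormedSpace ℝ Z]

/-- directional derivative -/
noncomputable def dd (e : Z) (f : Z → ℝ) (z : Z) : ℝ := fderiv ℝ f z e

lemma dd_mul {e : Z} {f g : Z → ℝ} (hf : Differentiable ℝ f) (hg : Differentiable ℝ g) (z : Z) :
    dd e (fun z => f z * g z) z = dd e f z * g z + f z * dd e g z := by
  unfold dd
  rw [fderiv_fun_mul (hf z) (hg z)]
  simp
  ring

lemma dd_add {e : Z} {f g : Z → ℝ} (hf : Differentiable ℝ f) (hg : Differentiable ℝ g) (z : Z) :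
    dd e (fun z => f z + g z) z = dd e f z + dd e g z := by
  unfold dd
  rw [fderiv_fun_add (hf z) (hg z)]
  simp

lemma dd_const {e : Z} (a : ℝ) (z : Z) : dd e (fun _ => a) z = 0 := by
  simp [dd]

lemma contDiff_dd {e : Z} {f : Z → ℝ} {n m : WithTop ℕ∞} (hf : ContDiff ℝ n f) (h : m + 1 ≤ n) :
    ContDiff ℝ m (dd e f) := by
  unfold dd
  exact (hf.fderiv_right h).clm_apply contDiff_const

lemma continuous_dd {e : Z} {f : Z → ℝ} (hf : ContDiff ℝ 1 f) : Continuous (dd e f) :=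
  (contDiff_dd (m := 0) hf (by norm_num)).continuous

lemma contDiff1_dd {e : Z} {f : Z → ℝ} (hf : ContDiff ℝ 2 f) : ContDiff ℝ 1 (dd e f) :=
  contDiff_dd hf (by norm_num)

lemma dd_comm {a b : Z} {f : Z → ℝ} (hf : ContDiff ℝ 2 f) (z : Z) :
    dd a (dd b f) z = dd b (dd a f) z := by
  have h : IsSymmSndFDerivAt ℝ f z := by
    apply (hf.contDiffAt).isSymmSndFDerivAt
    simp
  have hd : Differentiable ℝ (fderiv ℝ f) :=
    (hf.fderiv_right (m := 1) (by norm_num)).differentiable (by norm_num)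
  have key : ∀ a b : Z, dd a (dd b f) z = fderiv ℝ (fderiv ℝ f) z a b := by
    intro a b
    unfold dd
    rw [fderiv_clm_apply (hd z) (differentiableAt_const b)]
    simp
  rw [key, key]
  exact h a b

lemma dd_zero_of_notMem {e : Z} {f : Z → ℝ} {z : Z} (h : z ∉ tsupport f) : dd e f z = 0 := by
  unfold dd
  rw [fderiv_of_notMem_tsupport ℝ h]; simp

lemma tsupport_dd_subset {e : Z} {f : Z → ℝ} : tsupport (dd e f) ⊆ tsupport f := by
  apply closure_minimal _ (isClosed_tsupport f)
  intro z hz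
  by_contra h
  exact hz (dd_zero_of_notMem h)

lemma dd2_zero_of_notMem {e e' : Z} {f : Z → ℝ} {z : Z} (h : z ∉ tsupport f) :
    dd e (dd e' f) z = 0 :=
  dd_zero_of_notMem (fun h' => h (tsupport_dd_subset h'))

variable [FiniteDimensional ℝ Z] [MeasurableSpace Z] [BorelSpace Z] (μ : Measure Z)
  [μ.IsAddHaarMeasure]

lemma integral_dd_zero {e : Z} {h : Z → ℝ} (hh : ContDiff ℝ 1 h) (hs : HasCompactSupport h) :
    ∫ z, dd e h z ∂μ = 0 := by
  have hc : Continuous (dd e h) := continuous_dd hh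
  have hcs : HasCompactSupport (dd e h) :=
    HasCompactSupport.intro hs (fun z hz => dd_zero_of_notMem hz)
  have := integral_mul_fderiv_eq_neg_fderiv_mul_of_integrable (μ := μ) (f := fun _ : Z => (1:ℝ))
    (g := h) (v := e) (by simp) (by simpa using! hc.integrable_of_hasCompactSupport hcs)
    (by simpa using hh.continuous.integrable_of_hasCompactSupport hs)
    (fun x _ => by fun_prop) (fun x _ => hh.differentiable (by norm_num) x)
  simpa [dd] using this

lemma pair_identity {ej ek : Z} {w εj εk gk : Z → ℝ} {Hjk Hkk : ℝ}
    (hw : ContDiff ℝ 2 w) (hws : HasCompactSupport w)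
    (hεj : ContDiff ℝ 1 εj) (hεk : ContDiff ℝ 1 εk) (hgk : ContDiff ℝ 1 gk)
    (hj : ∀ z, dd ej εj z = 0) (hk : ∀ z, dd ek εk z = 0)
    (hHjk : ∀ z, dd ej gk z = Hjk) (hHkk : ∀ z, dd ek gk z = Hkk) :
    ∫ z, εj z * dd ej (dd ej w) z * (2 * εk z * gk z * dd ek w z + εk z * Hkk * w z) ∂μ
      = ∫ z, (- 2 * εj z * dd ej w z * dd ek w z * (dd ej εk z * gk z + εk z * Hjk)
        + dd ek εj z * εk z * gk z * (dd ej w z)^2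
        - εj z * dd ej w z * w z * dd ej εk z * Hkk) ∂μ := by
  have hwj : ContDiff ℝ 1 (dd ej w) := contDiff1_dd hw
  have hwk : ContDiff ℝ 1 (dd ek w) := contDiff1_dd hw
  have hw1 : ContDiff ℝ 1 w := hw.of_le (by norm_num)
  have c1 := hw.continuous
  have c2 := hwj.continuous
  have c3 := hwk.continuous
  have c4 : Continuous (dd ej (dd ej w)) := continuous_dd hwj
  have c5 := hεj.continuous
  have c6 := hεk.continuous
  have c7 := hgk.continuous
  have c8 : Continuous (dd ej εk) := continuous_dd hεk
  have c9 : Continuous (dd ek εj) := continuous_dd hεj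
  have z0 : ∀ z, z ∉ tsupport w → w z = 0 := fun z hz => image_eq_zero_of_notMem_tsupport hz
  have z1 : ∀ z, z ∉ tsupport w → dd ej w z = 0 := fun z hz => dd_zero_of_notMem hz
  have i1 : ∫ z, dd ej (fun z => 2 * (εj z * (εk z * (gk z * (dd ej w z * dd ek w z))))) z ∂μ = 0 := by
    apply integral_dd_zero
    · fun_prop
    · exact HasCompactSupport.intro hws (fun z hz => by simp [z1 z hz])
  have i2 : ∫ z, dd ek (fun z => εj z * (εk z * (gk z * (dd ej w z * dd ej w z)))) z ∂μ = 0 := by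
    apply integral_dd_zero
    · fun_prop
    · exact HasCompactSupport.intro hws (fun z hz => by simp [z1 z hz])
  have i3 : ∫ z, dd ej (fun z => Hkk * (εj z * (εk z * (dd ej w z * w z)))) z ∂μ = 0 := by
    apply integral_dd_zero
    · fun_prop
    · exact HasCompactSupport.intro hws (fun z hz => by simp [z1 z hz])
  have int : ∀ h : Z → ℝ, Continuous h → (∀ z, z ∉ tsupport w → h z = 0) → Integrable h μ :=
    fun h hc hz => hc.integrable_of_hasCompactSupport (HasCompactSupport.intro hws hz)
  have d1 := hεj.differentiable (by norm_num)
  have d2 := hεk.differentiable (by norm_num)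
  have d3 := hgk.differentiable (by norm_num)
  have d4 := hwj.differentiable (by norm_num)
  have d5 := hwk.differentiable (by norm_num)
  have d6 := hw1.differentiable (by norm_num)
  have e1 : ∀ z, dd ej (fun z => 2 * (εj z * (εk z * (gk z * (dd ej w z * dd ek w z))))) z
     = 2 * (εj z * (dd ej εk z * (gk z * (dd ej w z * dd ek w z)) + εk z * (Hjk * (dd ej w z * dd ek w z)
       + gk z * (dd ej (dd ej w) z * dd ek w z + dd ej w z * dd ej (dd ek w) z)))) := by
    intro z
    rw [dd_mul (by fun_prop) (by fun_prop), dd_mul (by fun_prop) (by fun_prop),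
      dd_mul (by fun_prop) (by fun_prop), dd_mul (by fun_prop) (by fun_prop),
      dd_mul (by fun_prop) (by fun_prop), dd_const, hj, hHjk]
    ring
  have e2 : ∀ z, dd ek (fun z => εj z * (εk z * (gk z * (dd ej w z * dd ej w z)))) z
     = dd ek εj z * (εk z * (gk z * (dd ej w z * dd ej w z))) + εj z * (εk z * (Hkk * (dd ej w z * dd ej w z)
       + gk z * (2 * dd ej w z * dd ej (dd ek w) z))) := by
    intro z
    rw [dd_mul (by fun_prop) (by fun_prop), dd_mul (by fun_prop) (by fun_prop),
      dd_mul (by fun_prop) (by fun_prop), dd_mul (by fun_prop) (by fun_prop), hk, hHkk, dd_comm hw]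
    ring
  have e3 : ∀ z, dd ej (fun z => Hkk * (εj z * (εk z * (dd ej w z * w z)))) z
     = Hkk * (εj z * (dd ej εk z * (dd ej w z * w z) + εk z * (dd ej (dd ej w) z * w z + dd ej w z * dd ej w z))) := by
    intro z
    rw [dd_mul (by fun_prop) (by fun_prop), dd_mul (by fun_prop) (by fun_prop),
      dd_mul (by fun_prop) (by fun_prop), dd_mul (by fun_prop) (by fun_prop), dd_const, hj]
    ring
  have q1 : Integrable (dd ej (fun z => 2 * (εj z * (εk z * (gk z * (dd ej w z * dd ek w z)))))) μ := by
    apply int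
    · apply continuous_dd; fun_prop
    · intro z hz; rw [e1]; simp [z1 z hz, dd2_zero_of_notMem hz]
  have q2 : Integrable (dd ek (fun z => εj z * (εk z * (gk z * (dd ej w z * dd ej w z))))) μ := by
    apply int
    · apply continuous_dd; fun_prop
    · intro z hz; rw [e2]; simp [z1 z hz]
  have q3 : Integrable (dd ej (fun z => Hkk * (εj z * (εk z * (dd ej w z * w z))))) μ := by
    apply int
    · apply continuous_dd; fun_prop
    · intro z hz; rw [e3]; simp [z1 z hz, z0 z hz]
  have r1 : Integrable (fun z => εj z * dd ej (dd ej w) z * (2 * εk z * gk z * dd ek w z + εk z * Hkk * w z)) μ := by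
    apply int
    · fun_prop
    · intro z hz; simp [dd2_zero_of_notMem hz]
  have r2 : Integrable (fun z => (- 2 * εj z * dd ej w z * dd ek w z * (dd ej εk z * gk z + εk z * Hjk)
        + dd ek εj z * εk z * gk z * (dd ej w z)^2
        - εj z * dd ej w z * w z * dd ej εk z * Hkk)) μ := by
    apply int
    · fun_prop
    · intro z hz; simp [z1 z hz]
  rw [← sub_eq_zero, ← integral_sub r1 r2]
  have : ∀ z, εj z * dd ej (dd ej w) z * (2 * εk z * gk z * dd ek w z + εk z * Hkk * w z)
    - (- 2 * εj z * dd ej w z * dd ek w z * (dd ej εk z * gk z + εk z * Hjk)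
        + dd ek εj z * εk z * gk z * (dd ej w z)^2
        - εj z * dd ej w z * w z * dd ej εk z * Hkk)
    = dd ej (fun z => 2 * (εj z * (εk z * (gk z * (dd ej w z * dd ek w z))))) z
     - dd ek (fun z => εj z * (εk z * (gk z * (dd ej w z * dd ej w z)))) z
     + dd ej (fun z => Hkk * (εj z * (εk z * (dd ej w z * w z)))) z := by
    intro z
    rw [e1, e2, e3]; ring
  simp_rw [this]
  have q12 : Integrable (fun z => dd ej (fun z => 2 * (εj z * (εk z * (gk z * (dd ej w z * dd ek w z))))) z
     - dd ek (fun z => εj z * (εk z * (gk z * (dd ej w z * dd ej w z)))) z) μ := q1.sub q2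
  rw [integral_add q12 q3, integral_sub q1 q2, i1, i2, i3]; simp

lemma pair_identity2 {ej ek : Z} {w εj εk gj gk : Z → ℝ} {Hjk Hkk : ℝ}
    (hw : ContDiff ℝ 2 w) (hws : HasCompactSupport w)
    (hεj : ContDiff ℝ 1 εj) (hεk : ContDiff ℝ 1 εk) (hgj : ContDiff ℝ 1 gj) (hgk : ContDiff ℝ 1 gk)
    (hk : ∀ z, dd ek εk z = 0)
    (hHjk : ∀ z, dd ek gj z = Hjk) (hHkk : ∀ z, dd ek gk z = Hkk) :
    ∫ z, εj z * (gj z)^2 * w z * (2 * εk z * gk z * dd ek w z + εk z * Hkk * w z) ∂μ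
      = ∫ z, - (w z)^2 * (dd ek εj z * εk z * (gj z)^2 * gk z + 2 * εj z * εk z * gj z * gk z * Hjk) ∂μ := by
  have hwk : ContDiff ℝ 1 (dd ek w) := contDiff1_dd hw
  have hw1 : ContDiff ℝ 1 w := hw.of_le (by norm_num)
  have c1 := hw.continuous
  have c3 := hwk.continuous
  have c5 := hεj.continuous
  have c6 := hεk.continuous
  have c7 := hgk.continuous
  have c7' := hgj.continuous
  have c9 : Continuous (dd ek εj) := continuous_dd hεj
  have z0 : ∀ z, z ∉ tsupport w → w z = 0 := fun z hz => image_eq_zero_of_notMem_tsupport hz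
  have i1 : ∫ z, dd ek (fun z => εj z * (εk z * (gk z * ((gj z * gj z) * (w z * w z))))) z ∂μ = 0 := by
    apply integral_dd_zero
    · fun_prop
    · exact HasCompactSupport.intro hws (fun z hz => by simp [z0 z hz])
  have int : ∀ h : Z → ℝ, Continuous h → (∀ z, z ∉ tsupport w → h z = 0) → Integrable h μ :=
    fun h hc hz => hc.integrable_of_hasCompactSupport (HasCompactSupport.intro hws hz)
  have d1 := hεj.differentiable (by norm_num)
  have d2 := hεk.differentiable (by norm_num)
  have d3 := hgk.differentiable (by norm_num)
  have d4 := hgj.differentiable (by norm_num)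
  have d6 := hw1.differentiable (by norm_num)
  have e1 : ∀ z, dd ek (fun z => εj z * (εk z * (gk z * ((gj z * gj z) * (w z * w z))))) z
     = dd ek εj z * (εk z * (gk z * ((gj z * gj z) * (w z * w z)))) +
      εj z * (εk z * (Hkk * ((gj z * gj z) * (w z * w z)) + gk z *
        (2 * Hjk * gj z * (w z * w z) + gj z * gj z * (2 * w z * dd ek w z)))) := by
    intro z
    rw [dd_mul (by fun_prop) (by fun_prop), dd_mul (by fun_prop) (by fun_prop),
      dd_mul (by fun_prop) (by fun_prop), dd_mul (by fun_prop) (by fun_prop),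
      dd_mul (by fun_prop) (by fun_prop), dd_mul (by fun_prop) (by fun_prop), hk, hHkk, hHjk]
    ring
  have r1 : Integrable (fun z => εj z * (gj z)^2 * w z * (2 * εk z * gk z * dd ek w z + εk z * Hkk * w z)) μ := by
    apply int
    · fun_prop
    · intro z hz; simp [z0 z hz]
  have r2 : Integrable (fun z => - (w z)^2 * (dd ek εj z * εk z * (gj z)^2 * gk z + 2 * εj z * εk z * gj z * gk z * Hjk)) μ := by
    apply int
    · fun_prop
    · intro z hz; simp [z0 z hz]
  rw [← sub_eq_zero, ← integral_sub r1 r2, ← i1]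
  congr 1
  ext z
  rw [e1]; ring

lemma single_identity {ej : Z} {w εj : Z → ℝ}
    (hw : ContDiff ℝ 2 w) (hws : HasCompactSupport w)
    (hεj : ContDiff ℝ 1 εj) (hj : ∀ z, dd ej εj z = 0) :
    ∫ z, εj z * dd ej (dd ej w) z * w z ∂μ = ∫ z, - (εj z * (dd ej w z)^2) ∂μ := by
  have hwj : ContDiff ℝ 1 (dd ej w) := contDiff1_dd hw
  have hw1 : ContDiff ℝ 1 w := hw.of_le (by norm_num)
  have c1 := hw.continuous
  have c2 := hwj.continuous
  have c4 : Continuous (dd ej (dd ej w)) := continuous_dd hwj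
  have c5 := hεj.continuous
  have z0 : ∀ z, z ∉ tsupport w → w z = 0 := fun z hz => image_eq_zero_of_notMem_tsupport hz
  have z1 : ∀ z, z ∉ tsupport w → dd ej w z = 0 := fun z hz => dd_zero_of_notMem hz
  have i1 : ∫ z, dd ej (fun z => εj z * (dd ej w z * w z)) z ∂μ = 0 := by
    apply integral_dd_zero
    · fun_prop
    · exact HasCompactSupport.intro hws (fun z hz => by simp [z0 z hz])
  have int : ∀ h : Z → ℝ, Continuous h → (∀ z, z ∉ tsupport w → h z = 0) → Integrable h μ :=
    fun h hc hz => hc.integrable_of_hasCompactSupport (HasCompactSupport.intro hws hz)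
  have d1 := hεj.differentiable (by norm_num)
  have d4 := hwj.differentiable (by norm_num)
  have d6 := hw1.differentiable (by norm_num)
  rw [← sub_eq_zero, ← integral_sub, ← i1]
  · congr 1
    ext z
    rw [dd_mul (by fun_prop) (by fun_prop), dd_mul (by fun_prop) (by fun_prop), hj]
    ring
  · apply int
    · fun_prop
    · intro z hz; simp [z0 z hz]
  · apply int
    · fun_prop
    · intro z hz; simp [z1 z hz]

lemma single_identity2 {ej : Z} {w εj gj : Z → ℝ} {H : ℝ}
    (hw : ContDiff ℝ 2 w) (hws : HasCompactSupport w)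
    (hεj : ContDiff ℝ 1 εj) (hj : ∀ z, dd ej εj z = 0) (hgj : ContDiff ℝ 1 gj)
    (hH : ∀ z, dd ej gj z = H) :
    ∫ z, (2 * εj z * gj z * dd ej w z + εj z * H * w z) * w z ∂μ = 0 := by
  have hw1 : ContDiff ℝ 1 w := hw.of_le (by norm_num)
  have z0 : ∀ z, z ∉ tsupport w → w z = 0 := fun z hz => image_eq_zero_of_notMem_tsupport hz
  have i1 : ∫ z, dd ej (fun z => εj z * (gj z * (w z * w z))) z ∂μ = 0 := by
    apply integral_dd_zero
    · fun_prop
    · exact HasCompactSupport.intro hws (fun z hz => by simp [z0 z hz])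
  have d1 := hεj.differentiable (by norm_num)
  have d4 := hgj.differentiable (by norm_num)
  have d6 := hw1.differentiable (by norm_num)
  rw [← i1]
  congr 1
  ext z
  rw [dd_mul (by fun_prop) (by fun_prop), dd_mul (by fun_prop) (by fun_prop),
    dd_mul (by fun_prop) (by fun_prop), hj, hH]
  ring
end Carl

open MeasureTheory

section Carl2
variable {Z : Type*} [NormedAddCommGroup Z] [NormedSpace ℝ Z]
variable [FiniteDimensional ℝ Z] [MeasurableSpace Z] [BorelSpace Z] (μ : Measure Z)
  [μ.IsAddHaarMeasure]
variable {ι : Type*} [Fintype ι]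

/-- the conjugated operator -/
noncomputable def conjOp (e : ι → Z) (ε g : ι → Z → ℝ) (H : ι → ι → ℝ) (τ : ℝ) (w : Z → ℝ) (z : Z) : ℝ :=
  (∑ j, (ε j z * dd (e j) (dd (e j) w) z + τ^2 * (ε j z * (g j z)^2 * w z)))
    + ∑ k, (-τ) * (2 * ε k z * g k z * dd (e k) w z + ε k z * H k k * w z)

lemma cross_identity (e : ι → Z) (ε g : ι → Z → ℝ) (H : ι → ι → ℝ) (hHs : ∀ j k, H j k = H k j)
    (hε : ∀ j, ContDiff ℝ 1 (ε j)) (hg : ∀ j, ContDiff ℝ 1 (g j))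
    (hεj : ∀ j z, dd (e j) (ε j) z = 0) (hH : ∀ j k z, dd (e j) (g k) z = H j k)
    (τ : ℝ) {w : Z → ℝ} (hw : ContDiff ℝ 2 w) (hws : HasCompactSupport w) :
    ∫ z, (∑ j, (ε j z * dd (e j) (dd (e j) w) z + τ^2 * (ε j z * (g j z)^2 * w z)))
        * (∑ k, (-τ) * (2 * ε k z * g k z * dd (e k) w z + ε k z * H k k * w z)) ∂μ
    = ∫ z, ∑ j, ∑ k, ((-τ) * (- 2 * ε j z * dd (e j) w z * dd (e k) w z * (dd (e j) (ε k) z * g k z + ε k z * H j k)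
        + dd (e k) (ε j) z * ε k z * g k z * (dd (e j) w z)^2
        - ε j z * dd (e j) w z * w z * dd (e j) (ε k) z * H k k)
        + (-τ^3) * (- (w z)^2 * (dd (e k) (ε j) z * ε k z * (g j z)^2 * g k z
          + 2 * ε j z * ε k z * g j z * g k z * H j k))) ∂μ := by
  have hw1 : ContDiff ℝ 1 w := hw.of_le (by norm_num)
  have c1 := hw.continuous
  have c2 : ∀ j, Continuous (dd (e j) w) := fun j => continuous_dd hw1
  have c4 : ∀ j, Continuous (dd (e j) (dd (e j) w)) := fun j => continuous_dd (contDiff1_dd hw)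
  have c5 := fun j => (hε j).continuous
  have c6 := fun j => (hg j).continuous
  have c8 : ∀ j k, Continuous (dd (e j) (ε k)) := fun j k => continuous_dd (hε k)
  have z0 : ∀ z, z ∉ tsupport w → w z = 0 := fun z hz => image_eq_zero_of_notMem_tsupport hz
  have z1 : ∀ j z, z ∉ tsupport w → dd (e j) w z = 0 := fun j z hz => dd_zero_of_notMem hz
  have z2 : ∀ j z, z ∉ tsupport w → dd (e j) (dd (e j) w) z = 0 := fun j z hz => dd2_zero_of_notMem hz
  have int : ∀ h : Z → ℝ, Continuous h → (∀ z, z ∉ tsupport w → h z = 0) → Integrable h μ :=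
    fun h hc hz => hc.integrable_of_hasCompactSupport (HasCompactSupport.intro hws hz)
  have e1 : ∀ z, (∑ j, (ε j z * dd (e j) (dd (e j) w) z + τ^2 * (ε j z * (g j z)^2 * w z)))
        * (∑ k, (-τ) * (2 * ε k z * g k z * dd (e k) w z + ε k z * H k k * w z))
      = ∑ j, ∑ k, ((-τ) * (ε j z * dd (e j) (dd (e j) w) z * (2 * ε k z * g k z * dd (e k) w z + ε k z * H k k * w z))
        + (-τ^3) * (ε j z * (g j z)^2 * w z * (2 * ε k z * g k z * dd (e k) w z + ε k z * H k k * w z))) := by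
    intro z
    rw [Finset.sum_mul_sum]
    refine Finset.sum_congr rfl fun j _ => Finset.sum_congr rfl fun k _ => ?_
    ring
  simp_rw [e1]
  have I1 : ∀ j k, Integrable (fun z => ε j z * dd (e j) (dd (e j) w) z * (2 * ε k z * g k z * dd (e k) w z + ε k z * H k k * w z)) μ := by
    intro j k
    apply int
    · fun_prop
    · intro z hz; simp [z2 j z hz]
  have I2 : ∀ j k, Integrable (fun z => ε j z * (g j z)^2 * w z * (2 * ε k z * g k z * dd (e k) w z + ε k z * H k k * w z)) μ := by
    intro j k
    apply int
    · fun_prop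
    · intro z hz; simp [z0 z hz]
  have J1 : ∀ j k, Integrable (fun z => - 2 * ε j z * dd (e j) w z * dd (e k) w z * (dd (e j) (ε k) z * g k z + ε k z * H j k)
        + dd (e k) (ε j) z * ε k z * g k z * (dd (e j) w z)^2
        - ε j z * dd (e j) w z * w z * dd (e j) (ε k) z * H k k) μ := by
    intro j k
    apply int
    · fun_prop
    · intro z hz; simp [z1 j z hz]
  have J2 : ∀ j k, Integrable (fun z => - (w z)^2 * (dd (e k) (ε j) z * ε k z * (g j z)^2 * g k z
          + 2 * ε j z * ε k z * g j z * g k z * H j k)) μ := by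
    intro j k
    apply int
    · fun_prop
    · intro z hz; simp [z0 z hz]
  have A1 : ∀ j k, Integrable (fun z => (-τ) * (ε j z * dd (e j) (dd (e j) w) z * (2 * ε k z * g k z * dd (e k) w z + ε k z * H k k * w z))
        + (-τ^3) * (ε j z * (g j z)^2 * w z * (2 * ε k z * g k z * dd (e k) w z + ε k z * H k k * w z))) μ :=
    fun j k => ((I1 j k).const_mul _).add ((I2 j k).const_mul _)
  have A2 : ∀ j k, Integrable (fun z => (-τ) * (- 2 * ε j z * dd (e j) w z * dd (e k) w z * (dd (e j) (ε k) z * g k z + ε k z * H j k)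
        + dd (e k) (ε j) z * ε k z * g k z * (dd (e j) w z)^2
        - ε j z * dd (e j) w z * w z * dd (e j) (ε k) z * H k k)
        + (-τ^3) * (- (w z)^2 * (dd (e k) (ε j) z * ε k z * (g j z)^2 * g k z
          + 2 * ε j z * ε k z * g j z * g k z * H j k))) μ :=
    fun j k => ((J1 j k).const_mul _).add ((J2 j k).const_mul _)
  rw [integral_finsetSum _ (fun j _ => integrable_finsetSum _ (fun k _ => A1 j k)),
    integral_finsetSum _ (fun j _ => integrable_finsetSum _ (fun k _ => A2 j k))]
  refine Finset.sum_congr rfl fun j _ => ?_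
  rw [integral_finsetSum _ (fun k _ => A1 j k), integral_finsetSum _ (fun k _ => A2 j k)]
  refine Finset.sum_congr rfl fun k _ => ?_
  rw [integral_add ((I1 j k).const_mul _) ((I2 j k).const_mul _),
    integral_add ((J1 j k).const_mul _) ((J2 j k).const_mul _), integral_const_mul, integral_const_mul,
    integral_const_mul, integral_const_mul,
    pair_identity μ hw hws (hε j) (hε k) (hg k) (hεj j) (hεj k) (hH j k) (hH k k),
    pair_identity2 (ej := e j) μ hw hws (hε j) (hε k) (hg j) (hg k) (hεj k) (Hjk := H j k)
      (fun z => by rw [hH, hHs]) (hH k k)]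

lemma energy_identity (e : ι → Z) (ε g : ι → Z → ℝ) (H : ι → ι → ℝ)
    (hε : ∀ j, ContDiff ℝ 1 (ε j)) (hg : ∀ j, ContDiff ℝ 1 (g j))
    (hεj : ∀ j z, dd (e j) (ε j) z = 0) (hH : ∀ j k z, dd (e j) (g k) z = H j k)
    (τ : ℝ) {w : Z → ℝ} (hw : ContDiff ℝ 2 w) (hws : HasCompactSupport w) :
    ∫ z, conjOp e ε g H τ w z * w z ∂μ
    = ∫ z, ∑ j, (- (ε j z * (dd (e j) w z)^2) + τ^2 * (ε j z * (g j z)^2 * (w z)^2)) ∂μ := by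
  have hw1 : ContDiff ℝ 1 w := hw.of_le (by norm_num)
  have c1 := hw.continuous
  have c2 : ∀ j, Continuous (dd (e j) w) := fun j => continuous_dd hw1
  have c4 : ∀ j, Continuous (dd (e j) (dd (e j) w)) := fun j => continuous_dd (contDiff1_dd hw)
  have c5 := fun j => (hε j).continuous
  have c6 := fun j => (hg j).continuous
  have z0 : ∀ z, z ∉ tsupport w → w z = 0 := fun z hz => image_eq_zero_of_notMem_tsupport hz
  have z1 : ∀ j z, z ∉ tsupport w → dd (e j) w z = 0 := fun j z hz => dd_zero_of_notMem hz
  have int : ∀ h : Z → ℝ, Continuous h → (∀ z, z ∉ tsupport w → h z = 0) → Integrable h μ :=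
    fun h hc hz => hc.integrable_of_hasCompactSupport (HasCompactSupport.intro hws hz)
  have e1 : ∀ z, conjOp e ε g H τ w z * w z = ∑ j, ((ε j z * dd (e j) (dd (e j) w) z * w z
      + (-τ) * ((2 * ε j z * g j z * dd (e j) w z + ε j z * H j j * w z) * w z))
      + τ^2 * (ε j z * (g j z)^2 * (w z)^2)) := by
    intro z
    unfold conjOp
    rw [← Finset.sum_add_distrib, Finset.sum_mul]
    refine Finset.sum_congr rfl fun j _ => ?_
    ring
  simp_rw [e1]
  have I1 : ∀ j, Integrable (fun z => ε j z * dd (e j) (dd (e j) w) z * w z) μ := by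
    intro j
    apply int
    · fun_prop
    · intro z hz; simp [z0 z hz]
  have I2 : ∀ j, Integrable (fun z => (2 * ε j z * g j z * dd (e j) w z + ε j z * H j j * w z) * w z) μ := by
    intro j
    apply int
    · fun_prop
    · intro z hz; simp [z0 z hz]
  have I3 : ∀ j, Integrable (fun z => ε j z * (g j z)^2 * (w z)^2) μ := by
    intro j
    apply int
    · fun_prop
    · intro z hz; simp [z0 z hz]
  have I4 : ∀ j, Integrable (fun z => - (ε j z * (dd (e j) w z)^2)) μ := by
    intro j
    apply int
    · fun_prop
    · intro z hz; simp [z1 j z hz]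
  have I12 : ∀ j, Integrable (fun z => ε j z * dd (e j) (dd (e j) w) z * w z
      + (-τ) * ((2 * ε j z * g j z * dd (e j) w z + ε j z * H j j * w z) * w z)) μ :=
    fun j => (I1 j).add ((I2 j).const_mul _)
  have J1 : ∀ j, Integrable (fun z => (ε j z * dd (e j) (dd (e j) w) z * w z
      + (-τ) * ((2 * ε j z * g j z * dd (e j) w z + ε j z * H j j * w z) * w z))
      + τ^2 * (ε j z * (g j z)^2 * (w z)^2)) μ := fun j => (I12 j).add ((I3 j).const_mul _)
  have J2 : ∀ j, Integrable (fun z => - (ε j z * (dd (e j) w z)^2)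
      + τ^2 * (ε j z * (g j z)^2 * (w z)^2)) μ := fun j => (I4 j).add ((I3 j).const_mul _)
  rw [integral_finsetSum _ (fun j _ => J1 j), integral_finsetSum _ (fun j _ => J2 j)]
  refine Finset.sum_congr rfl fun j _ => ?_
  rw [integral_add (I12 j) ((I3 j).const_mul _), integral_add (I1 j) ((I2 j).const_mul _),
    integral_add (I4 j) ((I3 j).const_mul _), single_identity μ hw hws (hε j) (hεj j),
    integral_const_mul, integral_const_mul, single_identity2 μ hw hws (hε j) (hεj j) (hg j) (hH j j)]
  ring
end Carl2

open MeasureTheory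

section Carl3
variable {ι : Type*} [Fintype ι] [DecidableEq ι]

lemma sum_abs_sq_le (a : ι → ℝ) : (∑ j, |a j|)^2 ≤ Fintype.card ι * ∑ j, (a j)^2 := by
  have := sq_sum_le_card_mul_sum_sq (s := Finset.univ) (f := fun j => |a j|)
  simpa [sq_abs] using this

lemma quadform_eq (ℓ b : ι → ℝ) (K N : ℝ) :
    ∑ j, ∑ k, b j * b k * (K * ℓ j * ℓ k - 4 * N * (if j = k then 1 else 0))
      = K * (∑ j, ℓ j * b j)^2 - 4 * N * ∑ j, (b j)^2 := by
  rw [sq, Finset.sum_mul_sum, Finset.mul_sum, Finset.mul_sum, ← Finset.sum_sub_distrib]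
  refine Finset.sum_congr rfl fun j _ => ?_
  simp_rw [mul_sub]
  rw [Finset.sum_sub_distrib, Finset.mul_sum]
  congr 1
  · exact Finset.sum_congr rfl fun k _ => by ring
  · rw [Finset.sum_eq_single j]
    · simp; ring
    · intro k _ hk; simp [hk.symm]
    · simp

lemma pw1 (ε g a ℓ : ι → ℝ) (D : ι → ι → ℝ) (K N C0 HB w : ℝ) (hK : 0 ≤ K) (hN : 0 ≤ N) (hC0 : 0 ≤ C0)
    (hHB : 0 ≤ HB)
    (hε : ∀ j, |ε j| ≤ C0) (hg : ∀ j, |g j| ≤ C0) (hD : ∀ j k, |D j k| ≤ C0)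
    (hH : ∀ k, |K * ℓ k * ℓ k - 4 * N| ≤ HB) :
    - (8 * N * C0^2 + 3 * Fintype.card ι * C0^3 + 1) * ∑ j, (a j)^2
       - (Fintype.card ι)^3 * C0^4 * HB^2 * w^2
    ≤ ∑ j, ∑ k, - (-2 * ε j * a j * a k * (D j k * g k + ε k * (K * ℓ j * ℓ k - 4 * N * (if j = k then 1 else 0)))
        + D k j * ε k * g k * (a j)^2
        - ε j * a j * w * D j k * (K * ℓ k * ℓ k - 4 * N)) := by
  set d : ℝ := (Fintype.card ι : ℝ) with hd
  have hd0 : 0 ≤ d := by positivity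
  have hq := quadform_eq ℓ (fun j => ε j * a j) K N
  have s1 : ∑ j, (ε j * a j)^2 ≤ C0^2 * ∑ j, (a j)^2 := by
    rw [Finset.mul_sum]
    refine Finset.sum_le_sum fun j _ => ?_
    rw [mul_pow]
    have : (ε j)^2 ≤ C0^2 := by rw [← sq_abs]; gcongr; exact hε j
    gcongr
  have s2 : -8 * N * C0^2 * ∑ j, (a j)^2 ≤ ∑ j, ∑ k, 2 * (ε j * a j * (ε k * a k) * (K * ℓ j * ℓ k - 4 * N * (if j = k then 1 else 0))) := by
    simp_rw [← Finset.mul_sum]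
    rw [hq]
    nlinarith [mul_nonneg hK (sq_nonneg (∑ j, ℓ j * (ε j * a j))), mul_le_mul_of_nonneg_left s1 hN]
  have s3 : ∑ j, ∑ k, |a j| * |a k| ≤ d * ∑ j, (a j)^2 := by
    rw [← Finset.sum_mul_sum, ← sq]; exact sum_abs_sq_le a
  have s4 : ∑ j, ∑ _k : ι, (a j)^2 = d * ∑ j, (a j)^2 := by
    simp [Finset.sum_const, ← Finset.mul_sum, hd]
  have s5 : ∑ j, ∑ _k : ι, C0^2 * HB * |a j| * |w| ≤ ∑ j, (a j)^2 + d^3 * C0^4 * HB^2 * w^2 := by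
    have : ∀ j, ∑ _k : ι, C0^2 * HB * |a j| * |w| ≤ (a j)^2 + d^2 * C0^4 * HB^2 * w^2 := by
      intro j
      simp only [Finset.sum_const, Finset.card_univ, nsmul_eq_mul, ← hd]
      have h1 : (a j)^2 = |a j|^2 := (sq_abs _).symm
      have h2 : w^2 = |w|^2 := (sq_abs _).symm
      rw [h1, h2]
      nlinarith [sq_nonneg (|a j| - d * C0^2 * HB * |w|), sq_nonneg (|a j|), sq_nonneg (d * C0^2 * HB * |w|)]
    calc _ ≤ ∑ j, ((a j)^2 + d^2 * C0^4 * HB^2 * w^2) := Finset.sum_le_sum fun j _ => this j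
      _ = _ := by
        rw [Finset.sum_add_distrib]; simp [← hd]; ring
  have pw : ∀ j k, 2 * (ε j * a j * (ε k * a k) * (K * ℓ j * ℓ k - 4 * N * (if j = k then 1 else 0)))
      - 2 * C0^3 * (|a j| * |a k|) - C0^3 * (a j)^2 - C0^2 * HB * |a j| * |w| ≤ 
      - (-2 * ε j * a j * a k * (D j k * g k + ε k * (K * ℓ j * ℓ k - 4 * N * (if j = k then 1 else 0)))
        + D k j * ε k * g k * (a j)^2
        - ε j * a j * w * D j k * (K * ℓ k * ℓ k - 4 * N)) := by
    intro j k
    set Hkk := K * ℓ k * ℓ k - 4 * N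
    set Hjk := K * ℓ j * ℓ k - 4 * N * (if j = k then 1 else 0)
    have b1 : |ε j * D j k * g k * (a j * a k)| ≤ C0 * C0 * C0 * (|a j| * |a k|) := by
      rw [abs_mul, abs_mul, abs_mul, abs_mul (a j)]
      gcongr <;> [exact hε j; exact hD j k; exact hg k]
    have b2 : |D k j * ε k * g k * (a j)^2| ≤ C0 * C0 * C0 * (a j)^2 := by
      rw [abs_mul, abs_mul, abs_mul, abs_of_nonneg (sq_nonneg (a j))]
      gcongr <;> [exact hD k j; exact hε k; exact hg k]
    have b3 : |ε j * D j k * Hkk * a j * w| ≤ C0 * C0 * HB * |a j| * |w| := by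
      rw [abs_mul, abs_mul, abs_mul, abs_mul]
      gcongr <;> [exact hε j; exact hD j k; exact hH k]
    have := (abs_le.mp b1).1
    have := (abs_le.mp b2).2
    have := (abs_le.mp b3).1
    nlinarith
  refine le_trans ?_ (Finset.sum_le_sum fun j _ => Finset.sum_le_sum fun k _ => pw j k)
  simp_rw [Finset.sum_sub_distrib]
  have s3' : ∑ j, ∑ k, 2 * C0^3 * (|a j| * |a k|) ≤ 2 * C0^3 * (d * ∑ j, (a j)^2) := by
    simp_rw [← Finset.mul_sum] at s3 ⊢
    gcongr
  have s4' : ∑ j, ∑ _k : ι, C0^3 * (a j)^2 = C0^3 * (d * ∑ j, (a j)^2) := by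
    rw [← s4]; simp_rw [Finset.mul_sum]
  linarith

lemma pw2 (ε g ℓ : ι → ℝ) (D : ι → ι → ℝ) (K N C0 m1 : ℝ) (hK : 0 ≤ K) (hN : 0 ≤ N) (hC0 : 0 ≤ C0)
    (hm1 : 0 ≤ m1) (hm : m1 ≤ ∑ j, ℓ j * (ε j * g j))
    (hε : ∀ j, |ε j| ≤ C0) (hg : ∀ j, |g j| ≤ C0) (hD : ∀ j k, |D j k| ≤ C0) :
    2 * K * m1^2 - (8 * N * Fintype.card ι * C0^4 + (Fintype.card ι)^2 * C0^5)
    ≤ ∑ j, ∑ k, (D k j * ε k * (g j)^2 * g k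
          + 2 * ε j * ε k * g j * g k * (K * ℓ j * ℓ k - 4 * N * (if j = k then 1 else 0))) := by
  set d : ℝ := (Fintype.card ι : ℝ) with hd
  have hd0 : 0 ≤ d := by positivity
  have hq := quadform_eq ℓ (fun j => ε j * g j) K N
  have s1 : ∑ j, (ε j * g j)^2 ≤ d * C0^4 := by
    have : ∀ j, (ε j * g j)^2 ≤ C0^4 := by
      intro j
      have : |ε j * g j| ≤ C0 * C0 := by rw [abs_mul]; gcongr <;> [exact hε j; exact hg j]
      calc (ε j * g j)^2 = |ε j * g j|^2 := (sq_abs _).symm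
        _ ≤ (C0 * C0)^2 := by gcongr
        _ = _ := by ring
    calc _ ≤ ∑ _j : ι, C0^4 := Finset.sum_le_sum fun j _ => this j
      _ = _ := by simp [hd]
  have pw : ∀ j k, - C0^5 + 2 * (ε j * g j * (ε k * g k) * (K * ℓ j * ℓ k - 4 * N * (if j = k then 1 else 0)))
      ≤ D k j * ε k * (g j)^2 * g k
          + 2 * ε j * ε k * g j * g k * (K * ℓ j * ℓ k - 4 * N * (if j = k then 1 else 0)) := by
    intro j k
    have b1 : |D k j * ε k * (g j)^2 * g k| ≤ C0 * C0 * C0^2 * C0 := by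
      rw [abs_mul, abs_mul, abs_mul, abs_pow]
      gcongr <;> [exact hD k j; exact hε k; exact hg j; exact hg k]
    have := (abs_le.mp b1).1
    nlinarith
  refine le_trans ?_ (Finset.sum_le_sum fun j _ => Finset.sum_le_sum fun k _ => pw j k)
  simp_rw [Finset.sum_add_distrib, ← Finset.mul_sum]
  rw [hq]
  simp only [Finset.sum_const, Finset.card_univ, nsmul_eq_mul, ← hd]
  have : m1^2 ≤ (∑ j, ℓ j * (ε j * g j))^2 := by gcongr
  nlinarith [mul_le_mul_of_nonneg_left this hK, mul_le_mul_of_nonneg_left s1 hN]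

lemma carl_arith {τ d C0 C1 C2 M2 W P O Q X Y K m1 : ℝ} (hτ1 : 1 ≤ τ) (hτM : M2 ≤ τ) (hd0 : 0 ≤ d) (hC0 : 0 ≤ C0)
    (hC1p : 0 < C1) (hC2p : 0 ≤ C2) (hM2p : 0 ≤ M2) (nW : 0 ≤ W) (nP : 0 ≤ P) (nO : 0 ≤ O)
    (st1 : 2 * Y ≤ P) (st2 : τ * (-C1 * Q - M2 * W) + τ^3 * ((2 * K * m1^2 - C2) * W) ≤ Y)
    (st3 : Q ≤ (1 + C0) * O + τ^2 * (d * C0^3 * W) - X)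
    (st4 : - X ≤ τ⁻¹ * P + τ * W) :
    τ^3 * (4 * K * m1^2 - (2 * C2 + 2 * C1 * d * C0^3 + 2 * C1 + 2 + (1 + 2 * C1) + 2 * C1 * (1 + C0))) * W ≤
      (2 * C2 + 2 * C1 * d * C0^3 + 2 * C1 + 2 + (1 + 2 * C1) + 2 * C1 * (1 + C0)) * (P + τ * O) := by
  have hτ0 : 0 < τ := by linarith
  have f1 : τ * Q ≤ τ * (1 + C0) * O + τ^3 * (d * C0^3) * W + P + τ^3 * W := by
    have h1 : τ * Q ≤ τ * ((1 + C0) * O + τ^2 * (d * C0^3 * W) + τ⁻¹ * P + τ * W) := by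
      gcongr; linarith
    have h2 : τ * (τ⁻¹ * P) = P := by field_simp
    have h3 : τ^2 * W ≤ τ^3 * W := by
      gcongr
      norm_num
    nlinarith
  have f2 : τ * M2 * W ≤ τ^3 * W := by
    have : M2 ≤ τ^2 := by nlinarith
    have : τ * M2 * W ≤ τ * τ^2 * W := by gcongr
    nlinarith
  have f3 := mul_le_mul_of_nonneg_left f1 hC1p.le
  have f4 : 2 * (τ * (-C1 * Q - M2 * W) + τ^3 * ((2 * K * m1^2 - C2) * W)) ≤ P := by linarith
  have f5 : τ^3 * (4 * K * m1^2 - (2 * C2 + 2 * C1 * d * C0^3 + 2 * C1 + 2)) * W ≤ (1 + 2 * C1) * P + 2 * C1 * (1 + C0) * (τ * O) := by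
    linarith
  have g1 : 0 ≤ ((1 + 2 * C1) + 2 * C1 * (1 + C0)) * (τ^3 * W) := by positivity
  have g2 : 0 ≤ (2 * C2 + 2 * C1 * d * C0^3 + 2 * C1 + 2 + 2 * C1 * (1 + C0)) * P := by positivity
  have g3 : 0 ≤ (2 * C2 + 2 * C1 * d * C0^3 + 2 * C1 + 2 + (1 + 2 * C1)) * (τ * O) := by positivity
  linarith

variable {Z : Type*} [NormedAddCommGroup Z] [NormedSpace ℝ Z]
variable [FiniteDimensional ℝ Z] [MeasurableSpace Z] [BorelSpace Z] (μ : Measure Z)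
  [μ.IsAddHaarMeasure]

set_option maxHeartbeats 1000000 in
theorem carleman_ineq (e : ι → Z) (ℓ : ι → ℝ) (o : ι) (N C0 m1 : ℝ) (hN : 0 ≤ N) (hC0 : 0 ≤ C0) (hm1 : 0 ≤ m1) :
    ∃ C > 0, ∀ K ≥ 0, ∃ τ0 ≥ (1:ℝ), ∀ (ε g : ι → Z → ℝ),
    (∀ j, ContDiff ℝ 1 (ε j)) → (∀ j, ContDiff ℝ 1 (g j)) →
    (∀ j z, dd (e j) (ε j) z = 0) → (∀ j ≠ o, ∀ z, ε j z = 1) →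
    (∀ j k z, dd (e j) (g k) z = K * ℓ j * ℓ k - 4 * N * (if j = k then 1 else 0)) →
    ∀ τ ≥ τ0, ∀ w : Z → ℝ, ContDiff ℝ 2 w → HasCompactSupport w →
    (∀ z ∈ tsupport w, (∀ j, |ε j z| ≤ C0) ∧ (∀ j, |g j z| ≤ C0) ∧ (∀ j k, |dd (e j) (ε k) z| ≤ C0)
      ∧ m1 ≤ ∑ j, ℓ j * (ε j z * g j z)) →
    τ^3 * (4 * K * m1^2 - C) * ∫ z, (w z)^2 ∂μ ≤
      C * (∫ z, (conjOp e ε g (fun j k => K * ℓ j * ℓ k - 4 * N * (if j = k then 1 else 0)) τ w z)^2 ∂μ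
        + τ * ∫ z, (dd (e o) w z)^2 ∂μ) := by
  set d : ℝ := (Fintype.card ι : ℝ) with hd
  have hd0 : 0 ≤ d := by positivity
  set C1 := 8 * N * C0^2 + 3 * d * C0^3 + 1 with hC1
  set C2 := 8 * N * d * C0^4 + d^2 * C0^5 with hC2
  have hC1p : 0 < C1 := by positivity
  have hC2p : 0 ≤ C2 := by positivity
  refine ⟨2 * C2 + 2 * C1 * d * C0^3 + 2 * C1 + 2 + (1 + 2 * C1) + 2 * C1 * (1 + C0), by positivity, ?_⟩
  intro K hK
  obtain ⟨HB, hHB0, hHB⟩ : ∃ HB : ℝ, 0 ≤ HB ∧ ∀ k, |K * ℓ k * ℓ k - 4 * N| ≤ HB := by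
    refine ⟨∑ k, |K * ℓ k * ℓ k - 4 * N|, Finset.sum_nonneg fun _ _ => abs_nonneg _, ?_⟩
    intro k
    exact Finset.single_le_sum (f := fun k => |K * ℓ k * ℓ k - 4 * N|)
      (fun i _ => abs_nonneg _) (Finset.mem_univ k)
  set M2 := d^3 * C0^4 * HB^2 with hM2
  have hM2p : 0 ≤ M2 := by positivity
  refine ⟨1 + M2, by linarith, ?_⟩
  intro ε g hε hg hεj hεo hH τ hτ w hw hws hb
  set H : ι → ι → ℝ := fun j k => K * ℓ j * ℓ k - 4 * N * (if j = k then 1 else 0) with hHdef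
  have hτ1 : 1 ≤ τ := by linarith
  have hHs : ∀ j k, H j k = H k j := by
    intro j k; simp only [hHdef]
    by_cases h : j = k
    · simp [h]
    · simp [h, Ne.symm h]; ring
  have hcross := cross_identity μ e ε g H hHs hε hg hεj hH τ hw hws
  have hen := energy_identity μ e ε g H hε hg hεj hH τ hw hws
  have hw1 : ContDiff ℝ 1 w := hw.of_le (by norm_num)
  have c1 := hw.continuous
  have c2 : ∀ j, Continuous (dd (e j) w) := fun j => continuous_dd hw1
  have c4 : ∀ j, Continuous (dd (e j) (dd (e j) w)) := fun j => continuous_dd (contDiff1_dd hw)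
  have c5 := fun j => (hε j).continuous
  have c6 := fun j => (hg j).continuous
  have c8 : ∀ j k, Continuous (dd (e j) (ε k)) := fun j k => continuous_dd (hε k)
  have z0 : ∀ z, z ∉ tsupport w → w z = 0 := fun z hz => image_eq_zero_of_notMem_tsupport hz
  have z1 : ∀ j z, z ∉ tsupport w → dd (e j) w z = 0 := fun j z hz => dd_zero_of_notMem hz
  have z2 : ∀ j z, z ∉ tsupport w → dd (e j) (dd (e j) w) z = 0 := fun j z hz => dd2_zero_of_notMem hz
  have int : ∀ h : Z → ℝ, Continuous h → (∀ z, z ∉ tsupport w → h z = 0) → Integrable h μ :=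
    fun h hc hz => hc.integrable_of_hasCompactSupport (HasCompactSupport.intro hws hz)
  have cP : Continuous (conjOp e ε g H τ w) := by unfold conjOp; fun_prop
  have zP : ∀ z, z ∉ tsupport w → conjOp e ε g H τ w z = 0 := by
    intro z hz
    simp [conjOp, z0 z hz, z1 _ z hz, z2 _ z hz]
  have iw : Integrable (fun z => (w z)^2) μ := int _ (by fun_prop) (fun z hz => by simp [z0 z hz])
  have iP : Integrable (fun z => (conjOp e ε g H τ w z)^2) μ := int _ (by fun_prop) (fun z hz => by simp [zP z hz])
  have iPw : Integrable (fun z => conjOp e ε g H τ w z * w z) μ := int _ (by fun_prop) (fun z hz => by simp [zP z hz])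
  have io : Integrable (fun z => (dd (e o) w z)^2) μ := int _ (by fun_prop) (fun z hz => by simp [z1 o z hz])
  have iQ : Integrable (fun z => ∑ j, (dd (e j) w z)^2) μ := int _ (by fun_prop) (fun z hz => by simp [z1 _ z hz])
  -- step 1
  have st1 : 2 * ∫ z, (∑ j, (ε j z * dd (e j) (dd (e j) w) z + τ^2 * (ε j z * (g j z)^2 * w z)))
        * (∑ k, (-τ) * (2 * ε k z * g k z * dd (e k) w z + ε k z * H k k * w z)) ∂μ
        ≤ ∫ z, (conjOp e ε g H τ w z)^2 ∂μ := by
    rw [← integral_const_mul]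
    apply integral_mono _ iP
    · intro z
      simp only [conjOp]
      nlinarith [sq_nonneg (∑ j, (ε j z * dd (e j) (dd (e j) w) z + τ^2 * (ε j z * (g j z)^2 * w z))),
        sq_nonneg (∑ k, (-τ) * (2 * ε k z * g k z * dd (e k) w z + ε k z * H k k * w z))]
    · apply int _ (by fun_prop)
      intro z hz
      simp [z0 z hz, z1 _ z hz]
  -- step 2
  have st2 : ∫ z, (τ * (- C1 * ∑ j, (dd (e j) w z)^2 - M2 * (w z)^2) + τ^3 * ((2 * K * m1^2 - C2) * (w z)^2)) ∂μ
     ≤ ∫ z, ∑ j, ∑ k, ((-τ) * (- 2 * ε j z * dd (e j) w z * dd (e k) w z * (dd (e j) (ε k) z * g k z + ε k z * H j k)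
        + dd (e k) (ε j) z * ε k z * g k z * (dd (e j) w z)^2
        - ε j z * dd (e j) w z * w z * dd (e j) (ε k) z * H k k)
        + (-τ^3) * (- (w z)^2 * (dd (e k) (ε j) z * ε k z * (g j z)^2 * g k z
          + 2 * ε j z * ε k z * g j z * g k z * H j k))) ∂μ := by
    apply integral_mono
    · apply int _ (by fun_prop)
      intro z hz
      simp [z0 z hz, z1 _ z hz]
    · apply int _ (by fun_prop)
      intro z hz
      simp [z0 z hz, z1 _ z hz]
    intro z
    by_cases hz : z ∈ tsupport w
    swap
    · simp [z0 z hz, z1 _ z hz]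
    obtain ⟨b1, b2, b3, b4⟩ := hb z hz
    have p1 := pw1 (fun j => ε j z) (fun j => g j z) (fun j => dd (e j) w z) ℓ (fun j k => dd (e j) (ε k) z)
      K N C0 HB (w z) hK hN hC0 hHB0 b1 b2 b3 hHB
    have p2 := pw2 (fun j => ε j z) (fun j => g j z) ℓ (fun j k => dd (e j) (ε k) z)
      K N C0 m1 hK hN hC0 hm1 b4 b1 b2 b3
    have p1' := mul_le_mul_of_nonneg_left p1 (by linarith : 0 ≤ τ)
    have p2' := mul_le_mul_of_nonneg_left p2 (by positivity : 0 ≤ τ^3 * (w z)^2)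
    simp only [Finset.mul_sum] at p1' p2'
    simp only [Finset.sum_add_distrib, Finset.mul_sum]
    have E1 : ∑ j, ∑ k, (-τ) * (- 2 * ε j z * dd (e j) w z * dd (e k) w z * (dd (e j) (ε k) z * g k z + ε k z * H j k)
        + dd (e k) (ε j) z * ε k z * g k z * (dd (e j) w z)^2
        - ε j z * dd (e j) w z * w z * dd (e j) (ε k) z * H k k) =
       ∑ j, ∑ k, τ * -(-2 * ε j z * dd (e j) w z * dd (e k) w z * (dd (e j) (ε k) z * g k z + ε k z * (K * ℓ j * ℓ k - 4 * N * (if j = k then 1 else 0)))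
        + dd (e k) (ε j) z * ε k z * g k z * (dd (e j) w z)^2
        - ε j z * dd (e j) w z * w z * dd (e j) (ε k) z * (K * ℓ k * ℓ k - 4 * N)) := by
      refine Finset.sum_congr rfl fun j _ => Finset.sum_congr rfl fun k _ => ?_
      simp only [hHdef, if_true]; ring
    have E2 : ∑ j, ∑ k, (-τ^3) * (- (w z)^2 * (dd (e k) (ε j) z * ε k z * (g j z)^2 * g k z
          + 2 * ε j z * ε k z * g j z * g k z * H j k)) =
        ∑ j, ∑ k, τ^3 * (w z)^2 * (dd (e k) (ε j) z * ε k z * (g j z)^2 * g k z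
          + 2 * ε j z * ε k z * g j z * g k z * (K * ℓ j * ℓ k - 4 * N * (if j = k then 1 else 0))) := by
      refine Finset.sum_congr rfl fun j _ => Finset.sum_congr rfl fun k _ => ?_
      simp only [hHdef]; ring
    rw [E1, E2]
    refine le_trans (le_of_eq ?_) (add_le_add p1' p2')
    rw [← Finset.mul_sum]; ring
  -- step 3
  have st3 : ∫ z, ∑ j, (dd (e j) w z)^2 ∂μ ≤ ∫ z, ((1 + C0) * (dd (e o) w z)^2 + τ^2 * (d * C0^3 * (w z)^2)
      - (∑ j, (- (ε j z * (dd (e j) w z)^2) + τ^2 * (ε j z * (g j z)^2 * (w z)^2)))) ∂μ := by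
    apply integral_mono iQ
    · apply int _ (by fun_prop)
      intro z hz
      simp [z0 z hz, z1 _ z hz]
    intro z
    by_cases hz : z ∈ tsupport w
    swap
    · simp [z0 z hz, z1 _ z hz]
    obtain ⟨b1, b2, b3, b4⟩ := hb z hz
    simp only [Finset.sum_add_distrib]
    have t1 : ∑ j, (dd (e j) w z)^2 ≤ ∑ j, ε j z * (dd (e j) w z)^2 + (1 + C0) * (dd (e o) w z)^2 := by
      have : ∑ j, (1 - ε j z) * (dd (e j) w z)^2 = (1 - ε o z) * (dd (e o) w z)^2 := by
        apply Finset.sum_eq_single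
        · intro j _ hj; rw [hεo j hj]; simp
        · simp
      have h3 : (1 - ε o z) * (dd (e o) w z)^2 ≤ (1 + C0) * (dd (e o) w z)^2 := by
        gcongr
        linarith [(abs_le.mp (b1 o)).1]
      simp only [sub_mul, Finset.sum_sub_distrib, one_mul] at this
      linarith
    have t2 : ∑ j, τ^2 * (ε j z * (g j z)^2 * (w z)^2) ≤ τ^2 * (d * C0^3 * (w z)^2) := by
      have : ∀ j, τ^2 * (ε j z * (g j z)^2 * (w z)^2) ≤ τ^2 * (C0^3 * (w z)^2) := by
        intro j
        have : ε j z * (g j z)^2 ≤ C0^3 := by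
          calc _ ≤ |ε j z| * |g j z|^2 := by rw [sq_abs]; gcongr; exact le_abs_self _
            _ ≤ C0 * C0^2 := by gcongr <;> [exact b1 j; exact b2 j]
            _ = _ := by ring
        gcongr
      calc _ ≤ ∑ _j : ι, τ^2 * (C0^3 * (w z)^2) := Finset.sum_le_sum fun j _ => this j
        _ = _ := by simp [hd]; ring
    simp only [Finset.sum_neg_distrib]
    linarith
  have iS : Integrable (fun z => ∑ j, (- (ε j z * (dd (e j) w z)^2) + τ^2 * (ε j z * (g j z)^2 * (w z)^2))) μ := by
    apply int _ (by fun_prop)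
    intro z hz
    simp [z0 z hz, z1 _ z hz]
  have i12 : Integrable (fun z => (1 + C0) * (dd (e o) w z)^2 + τ^2 * (d * C0^3 * (w z)^2)) μ :=
    (io.const_mul _).add ((iw.const_mul _).const_mul _)
  rw [integral_sub i12 iS, integral_add (io.const_mul _) ((iw.const_mul _).const_mul _),
    ← hen, integral_const_mul, integral_const_mul, integral_const_mul] at st3
  have st4 : - ∫ z, conjOp e ε g H τ w z * w z ∂μ ≤ τ⁻¹ * ∫ z, (conjOp e ε g H τ w z)^2 ∂μ + τ * ∫ z, (w z)^2 ∂μ := by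
    rw [← integral_neg, ← integral_const_mul, ← integral_const_mul, ← integral_add (iP.const_mul _) (iw.const_mul _)]
    apply integral_mono iPw.neg ((iP.const_mul _).add (iw.const_mul _))
    intro z
    have hτ0 : 0 < τ := by linarith
    simp only [Pi.neg_apply, Pi.add_apply]
    set p := conjOp e ε g H τ w z
    have : 0 ≤ τ⁻¹ * (p + τ * w z)^2 := by positivity
    have e2 : τ⁻¹ * (p + τ * w z)^2 = τ⁻¹ * p^2 + 2 * (p * w z) + τ * (w z)^2 := by
      field_simp; ring
    have : 0 ≤ τ⁻¹ * (p)^2 := by positivity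
    have : 0 ≤ τ * (w z)^2 := by positivity
    linarith
  have i3 : Integrable (fun z => - C1 * ∑ j, (dd (e j) w z)^2 - M2 * (w z)^2) μ :=
    (iQ.const_mul _).sub (iw.const_mul _)
  rw [integral_add (i3.const_mul _) ((iw.const_mul _).const_mul _), integral_const_mul, integral_const_mul,
    integral_const_mul, integral_sub (iQ.const_mul _) (iw.const_mul _), integral_const_mul, integral_const_mul,
    ← hcross] at st2
  have nW : 0 ≤ ∫ z, (w z)^2 ∂μ := integral_nonneg fun z => sq_nonneg _
  have nP : 0 ≤ ∫ z, (conjOp e ε g H τ w z)^2 ∂μ := integral_nonneg fun z => sq_nonneg _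
  have nO : 0 ≤ ∫ z, (dd (e o) w z)^2 ∂μ := integral_nonneg fun z => sq_nonneg _
  generalize (∫ z, (w z)^2 ∂μ) = W at *
  generalize (∫ z, (conjOp e ε g H τ w z)^2 ∂μ) = P at *
  generalize (∫ z, (dd (e o) w z)^2 ∂μ) = O at *
  generalize (∫ z, ∑ j, (dd (e j) w z)^2 ∂μ) = Q at *
  generalize (∫ z, conjOp e ε g H τ w z * w z ∂μ) = X at *
  exact carl_arith hτ1 (by linarith) hd0 hC0 hC1p hC2p hM2p nW nP nO st1 st2 st3 st4
end Carl3

open MeasureTheory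

section LowFreq
open scoped FourierTransform
open Complex (I)

lemma plancherel_cont {f : ℝ → ℂ} (hc : Continuous f) (hf : Integrable f) (hF : Integrable (𝓕 f)) :
    ∫ ξ, ‖𝓕 f ξ‖^2 = ∫ x, ‖f x‖^2 := by
  have h := VectorFourier.integral_sesq_fourierIntegral_eq_neg_flip (innerSL ℂ) (e := Real.fourierChar)
    (μ := volume) (ν := volume) (L := innerₗ ℝ) (f := f) (g := 𝓕 f) Real.continuous_fourierChar continuous_inner hf hF
  have h2 : ∫ ξ, inner ℂ (𝓕 f ξ) (𝓕 f ξ) = ∫ x, inner ℂ (f x) (𝓕⁻ (𝓕 f) x) := by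
    simpa [Real.fourierInv_eq, Real.fourier_eq, VectorFourier.fourierIntegral] using! h
  rw [hc.fourierInv_fourier_eq hf hF] at h2
  simp only [inner_self_eq_norm_sq_to_K] at h2
  have h3 : ((∫ ξ, ‖𝓕 f ξ‖^2 : ℝ) : ℂ) = ((∫ x, ‖f x‖^2 : ℝ) : ℂ) := by
    rw [← integral_complex_ofReal, ← integral_complex_ofReal]
    simpa using h2
  exact_mod_cast h3

/-- superposition integrals -/
noncomputable def superp (ρ c : ℝ → ℝ) (G : ℝ → ℝ) (t : ℝ) : ℝ := ∫ s, ρ s * G (t - c s)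

variable {ρ c G : ℝ → ℝ}

lemma superp_int_prod (hρ : Continuous ρ) (hρs : HasCompactSupport ρ) (hc : Continuous c)
    (hG : Continuous G) (hGi : Integrable G) :
    Integrable (fun p : ℝ × ℝ => ρ p.1 * G (p.2 - c p.1)) (volume.prod volume) := by
  rw [integrable_prod_iff (by apply Continuous.aestronglyMeasurable; fun_prop)]
  constructor
  · refine Filter.Eventually.of_forall fun s => ?_
    exact (hGi.comp_sub_right (c s)).const_mul (ρ s)
  · have : (fun s => ∫ t, ‖ρ s * G (t - c s)‖) = fun s => |ρ s| * ∫ t, ‖G t‖ := by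
      ext s
      simp_rw [norm_mul]
      rw [integral_const_mul, integral_sub_right_eq_self (fun t => ‖G t‖)]; rfl
    show Integrable (fun s => ∫ t, ‖ρ s * G (t - c s)‖)
    rw [this]
    exact ((hρ.integrable_of_hasCompactSupport hρs).norm).mul_const _

lemma superp_integrable (hρ : Continuous ρ) (hρs : HasCompactSupport ρ) (hc : Continuous c)
    (hG : Continuous G) (hGi : Integrable G) : Integrable (superp ρ c G) :=
  (superp_int_prod hρ hρs hc hG hGi).integral_prod_right

lemma superp_continuous {B : ℝ} (hρ : Continuous ρ) (hρs : HasCompactSupport ρ) (hc : Continuous c)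
    (hG : Continuous G) (hB : ∀ y, |G y| ≤ B) : Continuous (superp ρ c G) := by
  unfold superp
  refine continuous_of_dominated (bound := fun s => |ρ s| * B) ?_ ?_ ?_ ?_
  · intro t; apply Continuous.aestronglyMeasurable; fun_prop
  · intro t; refine Filter.Eventually.of_forall fun s => ?_
    rw [norm_mul, Real.norm_eq_abs, Real.norm_eq_abs]; gcongr; exact hB _
  · exact ((hρ.integrable_of_hasCompactSupport hρs).norm).mul_const _
  · refine Filter.Eventually.of_forall fun s => ?_
    fun_prop

lemma superp_bound {B : ℝ} (hρ : Continuous ρ) (hρs : HasCompactSupport ρ)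
    (hB : ∀ y, |G y| ≤ B) (t : ℝ) : |superp ρ c G t| ≤ (∫ s, |ρ s|) * B := by
  unfold superp
  rw [← integral_mul_const]
  refine norm_integral_le_of_norm_le (μ := volume) (f := fun s => ρ s * G (t - c s)) (((hρ.integrable_of_hasCompactSupport hρs).norm).mul_const _) ?_
  refine Filter.Eventually.of_forall fun s => ?_
  rw [norm_mul, Real.norm_eq_abs, Real.norm_eq_abs]; gcongr; exact hB _

lemma superp_hasDerivAt {G' : ℝ → ℝ} {B B' : ℝ} (hρ : Continuous ρ) (hρs : HasCompactSupport ρ) (hc : Continuous c)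
    (hG : Continuous G) (hG' : Continuous G') (hGd : ∀ y, HasDerivAt G (G' y) y)
    (hB : ∀ y, |G y| ≤ B) (hB' : ∀ y, |G' y| ≤ B') (t : ℝ) :
    HasDerivAt (superp ρ c G) (superp ρ c G' t) t := by
  unfold superp
  refine (hasDerivAt_integral_of_dominated_loc_of_deriv_le (bound := fun s => |ρ s| * B')
    (F' := fun t s => ρ s * G' (t - c s)) (s := Set.univ)
    Filter.univ_mem ?_ ?_ ?_ ?_ ?_ ?_).2
  · refine Filter.Eventually.of_forall fun t => ?_
    apply Continuous.aestronglyMeasurable; fun_prop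
  · refine Integrable.mono' (((hρ.integrable_of_hasCompactSupport hρs).norm).mul_const B)
      (by apply Continuous.aestronglyMeasurable; fun_prop) ?_
    refine Filter.Eventually.of_forall fun s => ?_
    rw [norm_mul, Real.norm_eq_abs (G _)]; gcongr; exact hB _
  · apply Continuous.aestronglyMeasurable; fun_prop
  · refine Filter.Eventually.of_forall fun s t _ => ?_
    rw [norm_mul, Real.norm_eq_abs, Real.norm_eq_abs]; gcongr; exact hB' _
  · exact ((hρ.integrable_of_hasCompactSupport hρs).norm).mul_const _
  · refine Filter.Eventually.of_forall fun s t _ => ?_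
    have := ((hGd (t - c s)).comp t ((hasDerivAt_id t).sub_const (c s))).const_mul (ρ s)
    simpa using this

lemma superp_fourier (hρ : Continuous ρ) (hρs : HasCompactSupport ρ) (hc : Continuous c)
    (hG : Continuous G) (hGi : Integrable G) (ξ : ℝ) :
    ‖𝓕 (fun t => (superp ρ c G t : ℂ)) ξ‖ ≤ (∫ s, |ρ s|) * ‖𝓕 (fun t => (G t : ℂ)) ξ‖ := by
  have e1 : 𝓕 (fun t => (superp ρ c G t : ℂ)) ξ
      = ∫ t : ℝ, ∫ s : ℝ, Complex.exp (↑(-2 * Real.pi * t * ξ) * I) * ((ρ s * G (t - c s) : ℝ) : ℂ) := by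
    rw [Real.fourier_real_eq_integral_exp_smul]
    congr 1; ext t
    rw [superp, ← integral_complex_ofReal, smul_eq_mul, ← integral_const_mul]
  have e2 : ∀ s, ∫ t : ℝ, Complex.exp (↑(-2 * Real.pi * t * ξ) * I) * ((ρ s * G (t - c s) : ℝ) : ℂ)
      = (ρ s) * Complex.exp (↑(-2 * Real.pi * c s * ξ) * I) * 𝓕 (fun t => (G t : ℂ)) ξ := by
    intro s
    rw [Real.fourier_real_eq_integral_exp_smul, ← integral_const_mul,
      ← integral_sub_right_eq_self (fun t : ℝ => (ρ s) * Complex.exp (↑(-2 * Real.pi * c s * ξ) * I) *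
        Complex.exp (↑(-2 * Real.pi * t * ξ) * I) • (G t : ℂ)) (c s)]
    congr 1; ext t
    have : Complex.exp (↑(-2 * Real.pi * t * ξ) * I) = Complex.exp (↑(-2 * Real.pi * c s * ξ) * I)
      * Complex.exp (↑(-2 * Real.pi * (t - c s) * ξ) * I) := by
      rw [← Complex.exp_add]; congr 1; push_cast; ring
    rw [this, smul_eq_mul, Complex.ofReal_mul (ρ s)]; ring
  rw [e1, integral_integral_swap]
  · simp_rw [e2]
    rw [integral_mul_const, norm_mul]
    gcongr
    refine norm_integral_le_of_norm_le ((hρ.integrable_of_hasCompactSupport hρs).norm) ?_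
    refine Filter.Eventually.of_forall fun s => ?_
    rw [norm_mul, Complex.norm_exp_ofReal_mul_I]; simp
  · have hp := (superp_int_prod hρ hρs hc hG hGi).swap
    refine Integrable.mono' hp.norm (by apply Continuous.aestronglyMeasurable; unfold Function.uncurry; fun_prop) ?_
    refine Filter.Eventually.of_forall fun p => ?_
    dsimp [Function.uncurry]
    have := Complex.norm_exp_ofReal_mul_I (-2 * Real.pi * p.1 * ξ)
    rw [norm_mul, this]; simp

lemma gauss_fourier {β : ℝ} (hβ : 0 < β) (ξ : ℝ) :
    ‖𝓕 (fun t : ℝ => ((Real.exp (-(β/2) * t^2) : ℝ) : ℂ)) ξ‖^2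
      = (2 * Real.pi / β) * Real.exp (- (4 * Real.pi^2 * ξ^2 / β)) := by
  have hb : 0 < ((β / (2 * Real.pi) : ℝ) : ℂ).re := by
    rw [Complex.ofReal_re]; positivity
  have h := congrFun (fourier_gaussian_pi hb) ξ
  have e : (fun t : ℝ => ((Real.exp (-(β/2) * t^2) : ℝ) : ℂ)) =
      fun x : ℝ => Complex.exp (-Real.pi * ((β / (2 * Real.pi) : ℝ) : ℂ) * x^2) := by
    ext t
    push_cast
    congr 1
    have : (Real.pi : ℂ) ≠ 0 := by exact_mod_cast Real.pi_ne_zero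
    field_simp
  rw [e, h, norm_mul, mul_pow]
  congr 1
  · rw [norm_div, Complex.norm_cpow_eq_rpow_re_of_pos (by positivity)]
    norm_num
    rw [← Real.rpow_natCast, ← Real.rpow_mul (by positivity)]
    norm_num
  · rw [Complex.norm_exp, ← Real.exp_nat_mul]
    congr 1
    have : (-(Real.pi:ℂ) / ((β / (2 * Real.pi) : ℝ) : ℂ) * (ξ:ℂ)^2) = ((-Real.pi / (β / (2 * Real.pi)) * ξ^2 : ℝ) : ℂ) := by
      push_cast; ring
    rw [this, Complex.ofReal_re]
    field_simp
    push_cast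
    ring

lemma gauss_ineq1 {y : ℝ} : y * Real.exp (-(2 * y)) ≤ Real.exp (-y) := by
  have h := Real.add_one_le_exp y
  have : y * Real.exp (-y) ≤ 1 := by
    calc y * Real.exp (-y) ≤ Real.exp y * Real.exp (-y) := by gcongr; linarith
      _ = 1 := by rw [← Real.exp_add]; simp
  have e : Real.exp (-(2*y)) = Real.exp (-y) * Real.exp (-y) := by rw [← Real.exp_add]; congr 1; ring
  rw [e, ← mul_assoc]
  calc _ ≤ 1 * Real.exp (-y) := by gcongr
    _ = _ := one_mul _

lemma lowfreq_tail {β D : ℝ} (hβ : 0 < β) (hD : 0 ≤ D) (ξ : ℝ) :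
    (2 * Real.pi * ξ)^2 * ((2 * Real.pi / β) * Real.exp (- (4 * Real.pi^2 * ξ^2 / β)))
     ≤ D^2 * ((2 * Real.pi / β) * Real.exp (- (4 * Real.pi^2 * ξ^2 / β))) +
       Real.exp (- D^2 / (2 * β)) * (8 * Real.pi * Real.exp (- (Real.pi^2 / β) * ξ^2)) := by
  by_cases h : (2 * Real.pi * ξ)^2 ≤ D^2
  · have : 0 ≤ Real.exp (- D^2 / (2 * β)) * (8 * Real.pi * Real.exp (- (Real.pi^2 / β) * ξ^2)) := by positivity
    have : (2 * Real.pi * ξ)^2 * ((2 * Real.pi / β) * Real.exp (- (4 * Real.pi^2 * ξ^2 / β)))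
      ≤ D^2 * ((2 * Real.pi / β) * Real.exp (- (4 * Real.pi^2 * ξ^2 / β))) := by gcongr
    linarith
  · push Not at h
    have h0 : 0 ≤ D^2 * ((2 * Real.pi / β) * Real.exp (- (4 * Real.pi^2 * ξ^2 / β))) := by positivity
    set y := Real.pi^2 * ξ^2 / β with hy
    have hy0 : 0 ≤ y := by positivity
    have e1 : Real.exp (- (4 * Real.pi^2 * ξ^2 / β)) = Real.exp (-(2*y)) * Real.exp (-(2*y)) := by
      rw [← Real.exp_add]; congr 1; rw [hy]; ring
    have e2 : Real.exp (-(2*y)) ≤ Real.exp (- D^2 / (2 * β)) := by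
      apply Real.exp_le_exp.mpr
      rw [hy, neg_div, neg_le_neg_iff, div_le_iff₀ (by positivity)]
      field_simp
      nlinarith
    have e3 : (2 * Real.pi * ξ)^2 * (2 * Real.pi / β) = 8 * Real.pi * y := by
      rw [hy]; field_simp; ring
    have e4 : Real.exp (- (Real.pi^2 / β) * ξ^2) = Real.exp (-y) := by
      congr 1; rw [hy]; ring
    have : (2 * Real.pi * ξ)^2 * ((2 * Real.pi / β) * Real.exp (- (4 * Real.pi^2 * ξ^2 / β)))
      ≤ Real.exp (- D^2 / (2 * β)) * (8 * Real.pi * Real.exp (- (Real.pi^2 / β) * ξ^2)) := by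
      rw [← mul_assoc, e3, e1, e4]
      calc 8 * Real.pi * y * (Real.exp (-(2*y)) * Real.exp (-(2*y)))
          = Real.exp (-(2*y)) * (8 * Real.pi * (y * Real.exp (-(2*y)))) := by ring
        _ ≤ Real.exp (- D^2 / (2 * β)) * (8 * Real.pi * Real.exp (-y)) := by
          gcongr; exact gauss_ineq1
    linarith

lemma lowfreq (hρ : Continuous ρ) (hρs : HasCompactSupport ρ) (hc : Continuous c)
    {β D : ℝ} (hβ : 0 < β) (hD : 0 ≤ D) {W : ℝ → ℝ}
    (hW : ∀ t, W t = ∫ s, ρ s * Real.exp (-(β/2) * (t - c s)^2)) :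
    Integrable (fun t => (W t)^2) ∧ Integrable (fun t => (deriv W t)^2) ∧
    ∫ t, (deriv W t)^2 ≤ D^2 * (∫ t, (W t)^2)
      + 8 * Real.sqrt (Real.pi * β) * Real.exp (- D^2 / (2 * β)) * (∫ s, |ρ s|)^2 := by
  set M := ∫ s, |ρ s| with hM
  have hM0 : 0 ≤ M := integral_nonneg fun s => abs_nonneg _
  set G : ℝ → ℝ := fun y => Real.exp (-(β/2) * y^2) with hG
  set G' : ℝ → ℝ := fun y => -β * (y * Real.exp (-(β/2) * y^2)) with hG'
  have hWs : W = superp ρ c G := by ext t; rw [hW]; rfl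
  have cG : Continuous G := by fun_prop
  have cG' : Continuous G' := by fun_prop
  have dG : ∀ y, HasDerivAt G (G' y) y := by
    intro y
    have h := (((hasDerivAt_pow 2 y)).const_mul (-(β/2))).exp
    convert h using 1
    simp only [hG']; push_cast; ring
  have bG : ∀ y, |G y| ≤ 1 := by
    intro y
    simp only [hG, abs_of_pos (Real.exp_pos _)]
    apply Real.exp_le_one_iff.mpr
    nlinarith [sq_nonneg y]
  have bG' : ∀ y, |G' y| ≤ β + 2 := by
    intro y
    simp only [hG', abs_mul, abs_neg, abs_of_pos hβ, abs_of_pos (Real.exp_pos _)]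
    have h1 := Real.add_one_le_exp (β/2 * y^2)
    have h2 : Real.exp (-(β/2) * y^2) * Real.exp (β/2 * y^2) = 1 := by
      rw [← Real.exp_add]; simp
    have h3 : β * |y| ≤ (β + 2) * Real.exp (β/2 * y^2) := by
      have : |y|^2 = y^2 := sq_abs y
      nlinarith [sq_nonneg (|y| - 1), mul_nonneg hβ.le (sq_nonneg y), mul_nonneg hβ.le hβ.le, mul_nonneg (mul_nonneg hβ.le hβ.le) (sq_nonneg y)]
    calc β * (|y| * Real.exp (-(β/2) * y^2)) = (β * |y|) * Real.exp (-(β/2) * y^2) := by ring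
      _ ≤ ((β + 2) * Real.exp (β/2 * y^2)) * Real.exp (-(β/2) * y^2) := by gcongr
      _ = β + 2 := by rw [mul_assoc, mul_comm (Real.exp _), h2, mul_one]
  have iG : Integrable G := integrable_exp_neg_mul_sq (by positivity)
  have iG' : Integrable G' := (integrable_mul_exp_neg_mul_sq (by positivity)).const_mul _
  have dW : ∀ t, HasDerivAt W (superp ρ c G' t) t := by
    rw [hWs]; exact fun t => superp_hasDerivAt hρ hρs hc cG cG' dG bG bG' t
  have hdW : deriv W = superp ρ c G' := funext fun t => (dW t).deriv
  have cW : Continuous W := by rw [hWs]; exact superp_continuous hρ hρs hc cG bG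
  have cW' : Continuous (deriv W) := by rw [hdW]; exact superp_continuous hρ hρs hc cG' bG'
  have iW : Integrable W := by rw [hWs]; exact superp_integrable hρ hρs hc cG iG
  have iW' : Integrable (deriv W) := by rw [hdW]; exact superp_integrable hρ hρs hc cG' iG'
  have bW : ∀ t, |W t| ≤ M * 1 := by rw [hWs]; exact fun t => superp_bound hρ hρs bG t
  have bW' : ∀ t, |deriv W t| ≤ M * (β + 2) := by rw [hdW]; exact fun t => superp_bound hρ hρs bG' t
  have sq_int : ∀ (h : ℝ → ℝ) (B : ℝ), Continuous h → Integrable h → (∀ t, |h t| ≤ B) → Integrable (fun t => (h t)^2) := by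
    intro h B hc hi hb
    refine Integrable.mono' (hi.norm.const_mul B) (by apply Continuous.aestronglyMeasurable; fun_prop) ?_
    refine Filter.Eventually.of_forall fun t => ?_
    rw [norm_pow, sq]
    gcongr
    exact hb t
  refine ⟨sq_int _ _ cW iW bW, sq_int _ _ cW' iW' bW', ?_⟩
  -- Fourier side
  set Wc : ℝ → ℂ := fun t => (W t : ℂ) with hWc
  have cWc : Continuous Wc := by fun_prop
  have iWc : Integrable Wc := iW.ofReal
  have dWc : deriv Wc = fun t => ((deriv W t : ℝ) : ℂ) := by
    ext t
    rw [(dW t).deriv]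
    exact (dW t).ofReal_comp.deriv
  have diffWc : Differentiable ℝ Wc := fun t => (dW t).ofReal_comp.differentiableAt
  have iWc' : Integrable (deriv Wc) := by rw [dWc]; exact iW'.ofReal
  have cWc' : Continuous (deriv Wc) := by rw [dWc]; fun_prop
  have hF := Real.fourier_deriv iWc diffWc iWc'
  have cF : Continuous (𝓕 Wc) := by
    exact VectorFourier.fourierIntegral_continuous Real.continuous_fourierChar
      (by exact continuous_inner (𝕜 := ℝ) (E := ℝ)) iWc
  have bF : ∀ ξ, ‖𝓕 Wc ξ‖^2 ≤ M^2 * ((2 * Real.pi / β) * Real.exp (- (4 * Real.pi^2 * ξ^2 / β))) := by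
    intro ξ
    have h := superp_fourier hρ hρs hc cG iG ξ
    rw [← gauss_fourier hβ, ← mul_pow]
    have e : Wc = fun t => (superp ρ c G t : ℂ) := by rw [hWc, hWs]
    rw [e]
    gcongr
  have gI : ∀ b : ℝ, 0 < b → Integrable (fun ξ : ℝ => Real.exp (- b * ξ^2)) := fun b hb => integrable_exp_neg_mul_sq hb
  -- bound on norm
  have bF1 : ∀ ξ, ‖𝓕 Wc ξ‖ ≤ M * Real.sqrt (2 * Real.pi / β) * Real.exp (-(2 * Real.pi^2 / β) * ξ^2) := by
    intro ξ
    apply le_of_sq_le_sq _ (by positivity)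
    refine (bF ξ).trans (le_of_eq ?_)
    rw [mul_pow, mul_pow, Real.sq_sqrt (by positivity), ← Real.exp_nat_mul, mul_assoc (M^2)]
    congr 3
    push_cast; ring
  have iF : Integrable (𝓕 Wc) := by
    refine Integrable.mono' ((gI (2 * Real.pi^2 / β) (by positivity)).const_mul (M * Real.sqrt (2 * Real.pi / β))) cF.aestronglyMeasurable ?_
    exact Filter.Eventually.of_forall bF1
  have bF2 : ∀ ξ, ‖𝓕 (deriv Wc) ξ‖^2 = (2 * Real.pi * ξ)^2 * ‖𝓕 Wc ξ‖^2 := by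
    intro ξ
    rw [hF]
    simp only [norm_smul, norm_mul, Complex.norm_I, Complex.norm_real, Complex.norm_ofNat, mul_one, mul_pow, Real.norm_eq_abs, sq_abs]
  have iF' : Integrable (𝓕 (deriv Wc)) := by
    have hb := (integrable_mul_exp_neg_mul_sq (b := 2 * Real.pi^2 / β) (by positivity)).norm.const_mul (2 * Real.pi * (M * Real.sqrt (2 * Real.pi / β)))
    refine Integrable.mono' hb (by rw [hF]; apply Continuous.aestronglyMeasurable; fun_prop) ?_
    refine Filter.Eventually.of_forall fun ξ => ?_
    have e : ‖𝓕 (deriv Wc) ξ‖ = 2 * Real.pi * |ξ| * ‖𝓕 Wc ξ‖ := by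
      rw [hF]; simp [norm_smul, abs_of_pos Real.pi_pos]
    rw [e, norm_mul, Real.norm_eq_abs, Real.norm_eq_abs, abs_of_pos (Real.exp_pos _)]
    calc 2 * Real.pi * |ξ| * ‖𝓕 Wc ξ‖ ≤ 2 * Real.pi * |ξ| * (M * Real.sqrt (2 * Real.pi / β) * Real.exp (-(2 * Real.pi^2 / β) * ξ^2)) := by
          gcongr; exact bF1 ξ
      _ = _ := by ring
  have P1 := plancherel_cont cWc iWc iF
  have P2 := plancherel_cont cWc' iWc' iF'
  have n1 : ∀ t, ‖Wc t‖^2 = (W t)^2 := by intro t; simp [hWc]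
  have n2 : ∀ t, ‖deriv Wc t‖^2 = (deriv W t)^2 := by intro t; rw [dWc]; simp
  simp_rw [n1] at P1
  simp_rw [n2, bF2] at P2
  rw [← P1, ← P2]
  have i1 : Integrable (fun ξ => ‖𝓕 Wc ξ‖^2) := by
    refine Integrable.mono' ((gI (4 * Real.pi^2 / β) (by positivity)).const_mul (M^2 * (2 * Real.pi / β))) (by apply Continuous.aestronglyMeasurable; fun_prop) ?_
    refine Filter.Eventually.of_forall fun ξ => ?_
    rw [norm_pow, norm_norm]
    refine (bF ξ).trans (le_of_eq ?_)
    rw [← mul_assoc]; congr 2; ring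
  have i2 := (gI (Real.pi^2 / β) (by positivity)).const_mul (M^2 * (Real.exp (- D^2 / (2 * β)) * (8 * Real.pi)))
  have key : ∀ ξ, (2 * Real.pi * ξ)^2 * ‖𝓕 Wc ξ‖^2 ≤ D^2 * ‖𝓕 Wc ξ‖^2 +
      M^2 * (Real.exp (- D^2 / (2 * β)) * (8 * Real.pi)) * Real.exp (- (Real.pi^2 / β) * ξ^2) := by
    intro ξ
    by_cases h : (2 * Real.pi * ξ)^2 ≤ D^2
    · have : 0 ≤ M^2 * (Real.exp (- D^2 / (2 * β)) * (8 * Real.pi)) * Real.exp (- (Real.pi^2 / β) * ξ^2) := by positivity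
      have : (2 * Real.pi * ξ)^2 * ‖𝓕 Wc ξ‖^2 ≤ D^2 * ‖𝓕 Wc ξ‖^2 := by gcongr
      linarith
    · push Not at h
      have h1 := lowfreq_tail hβ hD ξ
      have h2 := mul_le_mul_of_nonneg_left (bF ξ) (sub_nonneg.mpr h.le)
      have h3 := mul_le_mul_of_nonneg_left h1 (sq_nonneg M)
      nlinarith
  have i3 : Integrable (fun ξ => D^2 * ‖𝓕 Wc ξ‖^2) := i1.const_mul _
  calc ∫ ξ, (2 * Real.pi * ξ)^2 * ‖𝓕 Wc ξ‖^2 ≤ ∫ ξ, (D^2 * ‖𝓕 Wc ξ‖^2 +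
      M^2 * (Real.exp (- D^2 / (2 * β)) * (8 * Real.pi)) * Real.exp (- (Real.pi^2 / β) * ξ^2)) := by
        apply integral_mono_of_nonneg (Filter.Eventually.of_forall fun ξ => by positivity) (i3.add i2)
          (Filter.Eventually.of_forall key)
    _ = D^2 * (∫ ξ, ‖𝓕 Wc ξ‖^2) + M^2 * (Real.exp (- D^2 / (2 * β)) * (8 * Real.pi)) * Real.sqrt (Real.pi / (Real.pi^2 / β)) := by
        rw [integral_add i3 i2, integral_const_mul, integral_const_mul, integral_gaussian]
    _ = _ := by
        have : Real.pi * Real.sqrt (Real.pi / (Real.pi^2 / β)) = Real.sqrt (Real.pi * β) := by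
          conv_lhs => rw [← Real.sqrt_sq Real.pi_pos.le]
          rw [← Real.sqrt_mul (by positivity), Real.sqrt_sq Real.pi_pos.le]
          congr 1; field_simp
        rw [← this]; ring

end LowFreq

open MeasureTheory

section Gz
variable {Z : Type*} [NormedAddCommGroup Z] [NormedSpace ℝ Z]
variable {F : Type*} [NormedAddCommGroup F] [NormedSpace ℝ F]

/-- Gaussian smoothing in the direction `e0` -/
noncomputable def gz (lam : ℝ) (e0 : Z) (h : Z → F) (z : Z) : F :=
  ∫ s : ℝ, Real.exp (-lam * s^2) • h (z - s • e0)

variable {lam : ℝ} {e0 : Z}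

lemma gz_integrable {h : Z → F} {B : ℝ} (hl : 0 < lam) (hc : Continuous h) (hB : ∀ z, ‖h z‖ ≤ B) (z : Z) :
    Integrable (fun s : ℝ => Real.exp (-lam * s^2) • h (z - s • e0)) := by
  refine Integrable.mono' ((integrable_exp_neg_mul_sq hl).mul_const B)
    (by apply Continuous.aestronglyMeasurable; fun_prop) ?_
  refine Filter.Eventually.of_forall fun s => ?_
  rw [norm_smul, Real.norm_eq_abs, abs_of_pos (Real.exp_pos _)]
  gcongr
  exact hB _

lemma gz_continuous {h : Z → F} {B : ℝ} (hl : 0 < lam) (hc : Continuous h) (hB : ∀ z, ‖h z‖ ≤ B) :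
    Continuous (gz lam e0 h) := by
  unfold gz
  refine continuous_of_dominated (bound := fun s => Real.exp (-lam * s^2) * B) ?_ ?_ ?_ ?_
  · intro t; apply Continuous.aestronglyMeasurable; fun_prop
  · intro t; refine Filter.Eventually.of_forall fun s => ?_
    rw [norm_smul, Real.norm_eq_abs, abs_of_pos (Real.exp_pos _)]; gcongr; exact hB _
  · exact (integrable_exp_neg_mul_sq hl).mul_const B
  · refine Filter.Eventually.of_forall fun s => ?_
    fun_prop

lemma gz_hasFDerivAt {h : Z → F} {B B' : ℝ} (hl : 0 < lam) (hc : ContDiff ℝ 1 h) (hB : ∀ z, ‖h z‖ ≤ B)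
    (hB' : ∀ z, ‖fderiv ℝ h z‖ ≤ B') (z : Z) :
    HasFDerivAt (gz lam e0 h) (gz lam e0 (fderiv ℝ h) z) z := by
  have c0 := hc.continuous
  have c1 : Continuous (fderiv ℝ h) := hc.continuous_fderiv (by norm_num)
  unfold gz
  refine hasFDerivAt_integral_of_dominated_of_fderiv_le (bound := fun s => Real.exp (-lam * s^2) * B')
    (s := Set.univ) (F' := fun z (s : ℝ) => Real.exp (-lam * s^2) • fderiv ℝ h (z - s • e0))
    Filter.univ_mem ?_ ?_ ?_ ?_ ?_ ?_
  · refine Filter.Eventually.of_forall fun t => ?_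
    apply Continuous.aestronglyMeasurable; fun_prop
  · exact gz_integrable hl c0 hB z
  · haveI : SecondCountableTopologyEither ℝ (Z →L[ℝ] F) := ⟨Or.inl inferInstance⟩
    apply Continuous.aestronglyMeasurable; fun_prop
  · refine Filter.Eventually.of_forall fun s z _ => ?_
    rw [norm_smul, Real.norm_eq_abs, abs_of_pos (Real.exp_pos _)]; gcongr; exact hB' _
  · exact (integrable_exp_neg_mul_sq hl).mul_const B'
  · refine Filter.Eventually.of_forall fun s z _ => ?_
    have h1 : HasFDerivAt h (fderiv ℝ h (z - s • e0)) (z - s • e0) := (hc.differentiable (by norm_num) _).hasFDerivAt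
    have h2 := (h1.comp z ((hasFDerivAt_id z).sub_const (s • e0))).const_smul (Real.exp (-lam * s^2))
    simpa using! h2

lemma gz_fderiv {h : Z → F} {B B' : ℝ} (hl : 0 < lam) (hc : ContDiff ℝ 1 h) (hB : ∀ z, ‖h z‖ ≤ B)
    (hB' : ∀ z, ‖fderiv ℝ h z‖ ≤ B') : fderiv ℝ (gz lam e0 h) = gz lam e0 (fderiv ℝ h) :=
  funext fun z => (gz_hasFDerivAt hl hc hB hB' z).fderiv

lemma gz_contDiff1 {h : Z → F} {B B' : ℝ} (hl : 0 < lam) (hc : ContDiff ℝ 1 h) (hB : ∀ z, ‖h z‖ ≤ B)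
    (hB' : ∀ z, ‖fderiv ℝ h z‖ ≤ B') : ContDiff ℝ 1 (gz lam e0 h) := by
  rw [contDiff_one_iff_fderiv]
  refine ⟨fun z => (gz_hasFDerivAt hl hc hB hB' z).differentiableAt, ?_⟩
  rw [gz_fderiv hl hc hB hB']
  exact gz_continuous hl (hc.continuous_fderiv (by norm_num)) hB'

lemma gz_contDiff2 {h : Z → F} {B B' B'' : ℝ} (hl : 0 < lam) (hc : ContDiff ℝ 2 h) (hB : ∀ z, ‖h z‖ ≤ B)
    (hB' : ∀ z, ‖fderiv ℝ h z‖ ≤ B') (hB'' : ∀ z, ‖fderiv ℝ (fderiv ℝ h) z‖ ≤ B'') :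
    ContDiff ℝ 2 (gz lam e0 h) := by
  have hc1 : ContDiff ℝ 1 h := hc.of_le (by norm_num)
  rw [show (2 : WithTop ℕ∞) = 1 + 1 by norm_num, contDiff_succ_iff_fderiv]
  refine ⟨fun z => (gz_hasFDerivAt hl hc1 hB hB' z).differentiableAt, by simp, ?_⟩
  rw [gz_fderiv hl hc1 hB hB']
  exact gz_contDiff1 hl (hc.fderiv_right (by norm_num)) hB' hB''

lemma gz_dd {h : Z → ℝ} {B B' : ℝ} (hl : 0 < lam) (hc : ContDiff ℝ 1 h) (hB : ∀ z, ‖h z‖ ≤ B)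
    (hB' : ∀ z, ‖fderiv ℝ h z‖ ≤ B') (e : Z) (z : Z) : dd e (gz lam e0 h) z = gz lam e0 (dd e h) z := by
  unfold dd
  rw [gz_fderiv hl hc hB hB']
  unfold gz
  rw [ContinuousLinearMap.integral_apply (gz_integrable hl (hc.continuous_fderiv (by norm_num)) hB' z)]
  simp

/-- compactly supported versions -/
lemma bound_of_cs {h : Z → F} (hc : Continuous h) (hs : HasCompactSupport h) : ∃ B, ∀ z, ‖h z‖ ≤ B :=
  hs.exists_bound_of_continuous hc

lemma gz_contDiff2_cs {h : Z → ℝ} (hl : 0 < lam) (hc : ContDiff ℝ 2 h) (hs : HasCompactSupport h) :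
    ContDiff ℝ 2 (gz lam e0 h) := by
  obtain ⟨B, hB⟩ := bound_of_cs hc.continuous hs
  have c1 : ContDiff ℝ 1 (fderiv ℝ h) := hc.fderiv_right (by norm_num)
  obtain ⟨B', hB'⟩ := bound_of_cs c1.continuous (hs.fderiv ℝ)
  obtain ⟨B'', hB''⟩ := bound_of_cs (c1.continuous_fderiv (by norm_num)) ((hs.fderiv ℝ).fderiv ℝ)
  exact gz_contDiff2 hl hc hB hB' hB''

lemma hcs_dd {h : Z → ℝ} (hs : HasCompactSupport h) (e : Z) : HasCompactSupport (dd e h) :=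
  HasCompactSupport.intro hs (fun _ hz => dd_zero_of_notMem hz)

lemma gz_dd_cs {h : Z → ℝ} (hl : 0 < lam) (hc : ContDiff ℝ 1 h) (hs : HasCompactSupport h)
    (e : Z) : dd e (gz lam e0 h) = gz lam e0 (dd e h) := by
  obtain ⟨B, hB⟩ := bound_of_cs hc.continuous hs
  obtain ⟨B', hB'⟩ := bound_of_cs (hc.continuous_fderiv (by norm_num)) (hs.fderiv ℝ)
  exact funext fun z => gz_dd hl hc hB hB' e z

lemma gz_dd2_cs {h : Z → ℝ} (hl : 0 < lam) (hc : ContDiff ℝ 2 h) (hs : HasCompactSupport h)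
    (e : Z) : dd e (dd e (gz lam e0 h)) = gz lam e0 (dd e (dd e h)) := by
  rw [gz_dd_cs hl (hc.of_le (by norm_num)) hs, gz_dd_cs hl (contDiff1_dd hc) (hcs_dd hs e)]

/-- commutation with an operator whose coefficients do not depend on the `e0` direction -/
lemma gz_op {ι : Type*} [Fintype ι] {h : Z → ℝ} (hl : 0 < lam) (hc : ContDiff ℝ 2 h) (hs : HasCompactSupport h)
    (e : ι → Z) (ε : ι → Z → ℝ) (hε : ∀ j z (s : ℝ), ε j (z - s • e0) = ε j z) (z : Z) :
    ∑ j, ε j z * dd (e j) (dd (e j) (gz lam e0 h)) z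
      = gz lam e0 (fun z => ∑ j, ε j z * dd (e j) (dd (e j) h) z) z := by
  simp_rw [gz_dd2_cs hl hc hs]
  unfold gz
  simp_rw [← integral_const_mul]
  rw [← integral_finsetSum]
  · congr 1; ext s
    rw [smul_eq_mul, Finset.mul_sum]
    refine Finset.sum_congr rfl fun j _ => ?_
    rw [hε, smul_eq_mul]; ring
  · intro j _
    have cj : Continuous (dd (e j) (dd (e j) h)) := continuous_dd (contDiff1_dd hc)
    obtain ⟨B, hB⟩ := bound_of_cs cj (hcs_dd (hcs_dd hs (e j)) (e j))
    exact (gz_integrable hl cj hB z).const_mul _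

/-- weighted bound -/
lemma gz_weighted {h φ g : Z → ℝ} {B τ γ κ μ' v θ a : ℝ} (hB0 : 0 ≤ B)
    (hB : ∀ z, |h z| ≤ B) (hτ : 0 < τ) (hμ : 0 < μ') (hγ : γ = μ' + κ)
    (hφ : ∀ z (s : ℝ), φ z = φ (z - s • e0) + g (z - s • e0) * s + κ * s^2 / 2)
    (z : Z) (hh : ∀ s : ℝ, h (z - s • e0) ≠ 0 → φ (z - s • e0) ≤ θ ∧ |g (z - s • e0)| ≤ v ∧ a ≤ s^2)
    (hbig : 8 * Real.pi ≤ τ * μ') :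
    |Real.exp (τ * φ z) * gz (γ * τ / 2) e0 h z| ≤ B * Real.exp (τ * (θ + v^2 / μ' - μ' * a / 8)) := by
  unfold gz
  rw [← integral_const_mul]
  have hb : 0 < τ * μ' / 8 := by positivity
  have key : ∀ s : ℝ, ‖Real.exp (τ * φ z) * (Real.exp (-(γ * τ / 2) * s^2) • h (z - s • e0))‖
      ≤ B * Real.exp (τ * (θ + v^2 / μ' - μ' * a / 8)) * Real.exp (- (τ * μ' / 8) * s^2) := by
    intro s
    by_cases hs : h (z - s • e0) = 0
    · rw [hs]; simp; positivity
    obtain ⟨h1, h2, h3⟩ := hh s hs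
    rw [smul_eq_mul, norm_mul, norm_mul, Real.norm_eq_abs, Real.norm_eq_abs, Real.norm_eq_abs,
      abs_of_pos (Real.exp_pos _), abs_of_pos (Real.exp_pos _), ← mul_assoc, ← Real.exp_add, mul_comm, mul_assoc B,
      ← Real.exp_add]
    have hB1 := hB (z - s • e0)
    refine mul_le_mul hB1 (Real.exp_le_exp.mpr ?_) (Real.exp_pos _).le hB0
    rw [hφ z s, hγ]
    have h4 : g (z - s • e0) * s ≤ v^2 / μ' + μ' * s^2 / 4 := by
      have : g (z - s • e0) * s ≤ v * |s| := by
        calc _ ≤ |g (z - s • e0) * s| := le_abs_self _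
          _ = |g (z - s • e0)| * |s| := abs_mul _ _
          _ ≤ _ := by gcongr
      have h5 : v * |s| ≤ v^2 / μ' + μ' * |s|^2 / 4 := by
        have : 0 ≤ (v - μ' * |s| / 2)^2 / μ' := by positivity
        have e : (v - μ' * |s| / 2)^2 / μ' = v^2 / μ' - v * |s| + μ' * |s|^2 / 4 := by
          field_simp; ring
        linarith
      rw [sq_abs] at h5
      linarith
    have h6 : μ' * a ≤ μ' * s^2 := by gcongr
    have h7 : φ (z - s • e0) + g (z - s • e0) * s - μ' * s^2 / 2 ≤ θ + v^2 / μ' - μ' * a / 8 - μ' / 8 * s^2 := by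
      linarith
    have := mul_le_mul_of_nonneg_left h7 hτ.le
    linarith
  refine (norm_integral_le_of_norm_le ((integrable_exp_neg_mul_sq hb).const_mul _)
    (Filter.Eventually.of_forall key)).trans ?_
  rw [integral_const_mul, integral_gaussian]
  have : Real.sqrt (Real.pi / (τ * μ' / 8)) ≤ 1 := by
    rw [Real.sqrt_le_one]
    rw [div_le_one hb]; linarith
  calc _ ≤ B * Real.exp (τ * (θ + v^2 / μ' - μ' * a / 8)) * 1 := by gcongr
    _ = _ := mul_one _

/-- lower bound for the smoothing -/
lemma gz_lower {h : Z → ℝ} {B L : ℝ} (hl : 0 < lam) (hc : Continuous h) (hB : ∀ z, |h z| ≤ B)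
    (hL : ∀ z (s : ℝ), |h (z - s • e0) - h z| ≤ L * |s|) (hL0 : 0 ≤ L) (z : Z) :
    |gz lam e0 h z - h z * Real.sqrt (Real.pi / lam)| ≤ L * (Real.sqrt (2 * Real.pi) / lam) := by
  unfold gz
  have e1 : h z * Real.sqrt (Real.pi / lam) = ∫ s : ℝ, Real.exp (-lam * s^2) • h z := by
    simp_rw [smul_eq_mul]
    rw [integral_mul_const, integral_gaussian, mul_comm]
  have i1 : Integrable (fun s : ℝ => Real.exp (-lam * s^2) • h z) := (integrable_exp_neg_mul_sq hl).smul_const _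
  rw [e1, ← integral_sub (gz_integrable hl hc hB z) i1]
  have hl2 : 0 < lam / 2 := by positivity
  have key : ∀ s : ℝ, ‖Real.exp (-lam * s^2) • h (z - s • e0) - Real.exp (-lam * s^2) • h z‖
      ≤ L * (1 / Real.sqrt lam) * Real.exp (-(lam/2) * s^2) := by
    intro s
    rw [← smul_sub, norm_smul, Real.norm_eq_abs, Real.norm_eq_abs, abs_of_pos (Real.exp_pos _)]
    have h1 : |s| * Real.exp (-lam * s^2) ≤ (1 / Real.sqrt lam) * Real.exp (-(lam/2) * s^2) := by
      have e : Real.exp (-lam * s^2) = Real.exp (-(lam/2) * s^2) * Real.exp (-(lam/2) * s^2) := by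
        rw [← Real.exp_add]; congr 1; ring
      rw [e, ← mul_assoc]
      gcongr
      have h2 := Real.add_one_le_exp (lam/2 * s^2)
      have h3 : Real.exp (-(lam/2) * s^2) * Real.exp (lam/2 * s^2) = 1 := by rw [← Real.exp_add]; simp
      have h4 : |s| * Real.sqrt lam ≤ Real.exp (lam/2 * s^2) := by
        have : (Real.sqrt lam)^2 = lam := Real.sq_sqrt hl.le
        have : |s|^2 = s^2 := sq_abs s
        nlinarith [sq_nonneg (|s| * Real.sqrt lam - 1)]
      rw [le_div_iff₀ (Real.sqrt_pos.mpr hl)]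
      calc |s| * Real.exp (-(lam/2) * s^2) * Real.sqrt lam = (|s| * Real.sqrt lam) * Real.exp (-(lam/2) * s^2) := by ring
        _ ≤ Real.exp (lam/2 * s^2) * Real.exp (-(lam/2) * s^2) := by gcongr
        _ = 1 := by rw [mul_comm, h3]
    calc _ ≤ Real.exp (-lam * s^2) * (L * |s|) := by gcongr; exact hL z s
      _ = L * (|s| * Real.exp (-lam * s^2)) := by ring
      _ ≤ L * ((1 / Real.sqrt lam) * Real.exp (-(lam/2) * s^2)) := by gcongr
      _ = _ := by ring
  refine (norm_integral_le_of_norm_le ((integrable_exp_neg_mul_sq hl2).const_mul _)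
    (Filter.Eventually.of_forall key)).trans (le_of_eq ?_)
  rw [integral_const_mul, integral_gaussian, mul_assoc]
  congr 1
  rw [show Real.pi / (lam / 2) = (2 * Real.pi) / lam by field_simp, Real.sqrt_div (by positivity),
    div_mul_div_comm, one_mul, Real.mul_self_sqrt hl.le]

end Gz

section Conj
variable {Z : Type*} [NormedAddCommGroup Z] [NormedSpace ℝ Z]
variable {ι : Type*} [Fintype ι]

lemma dd_exp {e : Z} {φ : Z → ℝ} (hφ : Differentiable ℝ φ) (τ : ℝ) (z : Z) :
    dd e (fun z => Real.exp (τ * φ z)) z = Real.exp (τ * φ z) * (τ * dd e φ z) := by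
  unfold dd
  have h := ((hφ z).hasFDerivAt.const_mul τ).exp
  rw [h.fderiv]
  simp

lemma dd_expmul {e : Z} {φ V : Z → ℝ} (hφ : Differentiable ℝ φ) (hV : Differentiable ℝ V) (τ : ℝ) :
    dd e (fun z => Real.exp (τ * φ z) * V z) = fun z => Real.exp (τ * φ z) * (dd e V z + τ * dd e φ z * V z) := by
  ext z
  rw [dd_mul (by fun_prop) hV, dd_exp hφ]; ring

lemma conj_identity (e : ι → Z) (ε g : ι → Z → ℝ) (H : ι → ι → ℝ) (τ : ℝ) {φ V : Z → ℝ}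
    (hφ : Differentiable ℝ φ) (hg : ∀ j, Differentiable ℝ (g j)) (hφg : ∀ j z, dd (e j) φ z = g j z)
    (hH : ∀ j z, dd (e j) (g j) z = H j j) (hV : ContDiff ℝ 2 V) (z : Z) :
    conjOp e ε g H τ (fun z => Real.exp (τ * φ z) * V z) z
      = Real.exp (τ * φ z) * ∑ j, ε j z * dd (e j) (dd (e j) V) z := by
  have dV : Differentiable ℝ V := hV.differentiable (by norm_num)
  have dV' : ∀ j, Differentiable ℝ (dd (e j) V) := fun j => (contDiff1_dd hV).differentiable (by norm_num)
  unfold conjOp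
  rw [← Finset.sum_add_distrib, Finset.mul_sum]
  refine Finset.sum_congr rfl fun j _ => ?_
  have hgj := hg j
  have dVj := dV' j
  have e1 : dd (e j) (fun z => Real.exp (τ * φ z) * V z) = fun z => Real.exp (τ * φ z) * (dd (e j) V z + τ * g j z * V z) := by
    rw [dd_expmul hφ dV]; simp_rw [hφg]
  have e2 : dd (e j) (dd (e j) (fun z => Real.exp (τ * φ z) * V z)) z
     = Real.exp (τ * φ z) * (dd (e j) (dd (e j) V) z + τ * (H j j * V z + g j z * dd (e j) V z)
        + τ * g j z * (dd (e j) V z + τ * g j z * V z)) := by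
    rw [e1, dd_expmul hφ (by fun_prop)]
    simp only [hφg]
    rw [dd_add dVj (by fun_prop), dd_mul (by fun_prop) dV, dd_mul (by fun_prop) hgj, dd_const, hH]
    ring
  rw [e2, e1]
  ring
end Conj

open MeasureTheory

/-- one-dimensional (time-line) estimate -/
lemma line_bound {f φ g χ : ℝ → ℝ} {B τ γ κ μ' v σ η t0 : ℝ} (hB0 : 0 ≤ B)
    (hf : Continuous f) (hφc : Continuous φ) (hg : Continuous g) (hχc : Continuous χ)
    (hB : ∀ t, |f t| ≤ B) (hfs : ∀ t, f t ≠ 0 → |t - t0| ≤ σ ∧ φ t ≤ 0 ∧ |g t| ≤ v)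
    (hφ : ∀ t s : ℝ, φ t = φ (t - s) + g (t - s) * s + κ * s^2 / 2)
    (hχ1 : ∀ t, |χ t| ≤ 1) (hχ2 : ∀ t, |t - t0| ≤ 2 * σ → χ t = 1)
    (hτ : 0 < τ) (hμ : 0 < μ') (hγ : γ = μ' + κ) (hv : 0 < v) (hσ : 0 < σ)
    (hη : v^2 / μ' + η / 2 ≤ μ' * σ^2 / 16) (hbig : 8 * Real.pi ≤ τ * μ')
    {W : ℝ → ℝ} (hW : ∀ t, W t = Real.exp (τ * φ t) * gz (γ * τ / 2) (1:ℝ) f t) :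
    Integrable (fun t => (deriv W t)^2) ∧
    ∫ t, (χ t * deriv W t)^2 ≤ 4 * v^2 * τ^2 * ((∫ t, (χ t * W t)^2) + 2 * B^2 * Real.exp (-τ * η))
      + 32 * σ^2 * B^2 * Real.sqrt (Real.pi * (τ * μ')) * Real.exp (-τ * (v^2 / μ')) := by
  have hβ : 0 < τ * μ' := by positivity
  set ρ : ℝ → ℝ := fun s => f s * Real.exp (τ * (φ s + (g s)^2 / (2 * μ'))) with hρ
  have hρc : Continuous ρ := by rw [hρ]; fun_prop
  have hsub : ∀ s, s ∉ Set.Icc (t0 - σ) (t0 + σ) → f s = 0 := by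
    intro s hs
    by_contra h
    obtain ⟨h1, -, -⟩ := hfs s h
    rw [abs_le] at h1
    exact hs ⟨by linarith, by linarith⟩
  have hρs : HasCompactSupport ρ := by
    refine HasCompactSupport.intro (isCompact_Icc (a := t0 - σ) (b := t0 + σ)) fun s hs => ?_
    simp [hρ, hsub s hs]
  have hWρ : ∀ t, W t = ∫ s, ρ s * Real.exp (-(τ * μ' / 2) * (t - (s + g s / μ'))^2) := by
    intro t
    rw [hW, gz, ← integral_const_mul, ← integral_sub_left_eq_self _ _ t]
    congr 1; ext s
    have h1 : t - (t - s) • (1:ℝ) = s := by simp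
    rw [h1, hφ t (t - s), hρ, smul_eq_mul]
    have h2 : t - (t - s) = s := by ring
    rw [h2]
    simp only
    rw [mul_comm (Real.exp (-(γ * τ / 2) * (t - s) ^ 2)) (f s), mul_left_comm, ← Real.exp_add, mul_assoc, ← Real.exp_add]
    congr 2
    rw [hγ]; field_simp; ring
  have hD : (0:ℝ) ≤ 2 * v * τ := by positivity
  obtain ⟨i1, i2, hlow⟩ := lowfreq hρc hρs (c := fun s => s + g s / μ') (by fun_prop) hβ hD hWρ
  refine ⟨i2, ?_⟩
  have hρb : ∫ s, |ρ s| ≤ 2 * σ * (B * Real.exp (τ * (v^2 / (2 * μ')))) := by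
    have : ∫ s, |ρ s| = ∫ s in Set.Icc (t0 - σ) (t0 + σ), |ρ s| := by
      rw [setIntegral_eq_integral_of_forall_compl_eq_zero]
      intro s hs; simp [hρ, hsub s hs]
    rw [this]
    have hb : ∀ s ∈ Set.Icc (t0 - σ) (t0 + σ), ‖|ρ s|‖ ≤ B * Real.exp (τ * (v^2 / (2 * μ'))) := by
      intro s _
      rw [Real.norm_eq_abs, abs_abs, hρ]
      by_cases h : f s = 0
      · simp [h]; positivity
      obtain ⟨-, h2, h3⟩ := hfs s h
      simp only
      rw [abs_mul, abs_of_pos (Real.exp_pos _)]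
      refine mul_le_mul (hB s) (Real.exp_le_exp.mpr ?_) (Real.exp_pos _).le hB0
      have h4 : (g s)^2 ≤ v^2 := by rw [← sq_abs]; gcongr
      have h5 : (g s)^2 / (2 * μ') ≤ v^2 / (2 * μ') := by gcongr
      apply mul_le_mul_of_nonneg_left _ hτ.le
      linarith
    have := norm_setIntegral_le_of_norm_le_const (μ := volume) (by rw [Real.volume_Icc]; simp) hb
    rw [measureReal_def, Real.volume_Icc, ENNReal.toReal_ofReal (by linarith)] at this
    calc _ ≤ _ := le_abs_self _
      _ ≤ _ := this
      _ = _ := by ring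
  -- first reduction
  have hχsq : ∀ t, (χ t)^2 ≤ 1 := fun t => by
    rw [← sq_abs]; exact pow_le_one₀ (abs_nonneg _) (hχ1 t)
  have s1 : ∫ t, (χ t * deriv W t)^2 ≤ ∫ t, (deriv W t)^2 := by
    refine integral_mono_of_nonneg (Filter.Eventually.of_forall fun t => sq_nonneg _) i2
      (Filter.Eventually.of_forall fun t => ?_)
    simp only [mul_pow]
    have := mul_le_mul_of_nonneg_right (hχsq t) (sq_nonneg (deriv W t))
    linarith
  have iχ : Integrable (fun t => (χ t * W t)^2) := by
    simp_rw [mul_pow]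
    refine i1.bdd_mul (c := 1) (by apply Continuous.aestronglyMeasurable; fun_prop) ?_
    refine Filter.Eventually.of_forall fun t => ?_
    rw [Real.norm_eq_abs, abs_of_nonneg (sq_nonneg _)]; exact hχsq t
  have hpi : 0 < Real.pi / 4 := by positivity
  have iG : Integrable (fun t => B^2 * Real.exp (-τ * η) * Real.exp (-(Real.pi / 4) * (t - t0)^2)) :=
    (((integrable_exp_neg_mul_sq hpi).comp_sub_right t0)).const_mul _
  have s2 : ∫ t, (W t)^2 ≤ (∫ t, (χ t * W t)^2) + 2 * B^2 * Real.exp (-τ * η) := by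
    have : ∫ t, (W t)^2 ≤ ∫ t, ((χ t * W t)^2 + B^2 * Real.exp (-τ * η) * Real.exp (-(Real.pi / 4) * (t - t0)^2)) := by
      refine integral_mono i1 (iχ.add iG) fun t => ?_
      simp only
      by_cases ht : |t - t0| ≤ 2 * σ
      · rw [hχ2 t ht, one_mul]
        have : 0 ≤ B^2 * Real.exp (-τ * η) * Real.exp (-(Real.pi / 4) * (t - t0)^2) := by positivity
        linarith
      push Not at ht
      have hb := gz_weighted (e0 := (1:ℝ)) (h := f) (φ := φ) (g := g) (B := B) (τ := τ) (γ := γ) (κ := κ) (μ' := μ')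
        (v := v) (θ := 0) (a := (t - t0)^2 / 4) hB0 hB hτ hμ hγ (fun z s => by simpa using hφ z s) t
        (fun s hs => by
          obtain ⟨h1, h2, h3⟩ := hfs _ hs
          refine ⟨h2, h3, ?_⟩
          simp only [smul_eq_mul, mul_one] at h1
          have h4 : |t - t0| ≤ 2 * |s| := by
            have : |t - t0| ≤ |t - s - t0| + |s| := by
              have := abs_add_le (t - s - t0) s
              rwa [show t - s - t0 + s = t - t0 by ring] at this
            linarith
          have h5 : |t - t0|^2 ≤ (2 * |s|)^2 := by gcongr
          rw [mul_pow, sq_abs, sq_abs] at h5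
          linarith) hbig
      rw [← hW] at hb
      have h6 : (2 * σ)^2 ≤ |t - t0|^2 := by gcongr
      rw [sq_abs] at h6
      have hsq : (W t)^2 ≤ (B * Real.exp (τ * (0 + v ^ 2 / μ' - μ' * ((t - t0) ^ 2 / 4) / 8)))^2 := by
        rw [← sq_abs]; gcongr
      refine hsq.trans ?_
      rw [mul_pow, ← Real.exp_nat_mul, mul_assoc (B^2), ← Real.exp_add]
      have hle : ((2:ℕ):ℝ) * (τ * (0 + v ^ 2 / μ' - μ' * ((t - t0) ^ 2 / 4) / 8)) ≤ -τ * η + -(Real.pi / 4) * (t - t0)^2 := by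
        have h7 : τ * (v^2 / μ' + η / 2) ≤ τ * (μ' * σ^2 / 16) := by gcongr
        have h8 : τ * μ' * (2 * σ)^2 ≤ τ * μ' * (t - t0)^2 := by gcongr
        have h9 : 8 * Real.pi * (t - t0)^2 ≤ τ * μ' * (t - t0)^2 := by gcongr
        push_cast
        nlinarith
      have := Real.exp_le_exp.mpr hle
      have h10 : 0 ≤ (χ t * W t)^2 := sq_nonneg _
      nlinarith [sq_nonneg B, mul_le_mul_of_nonneg_left this (sq_nonneg B)]
    refine this.trans ?_
    rw [integral_add iχ iG, integral_const_mul]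
    have h1 := integral_sub_right_eq_self (fun t => Real.exp (-(Real.pi / 4) * t^2)) t0 (μ := volume)
    rw [h1, integral_gaussian]
    have : Real.pi / (Real.pi / 4) = 2^2 := by field_simp; norm_num
    rw [this, Real.sqrt_sq (by norm_num)]
    linarith
  have e1 : Real.exp (-(2 * v * τ)^2 / (2 * (τ * μ'))) = Real.exp (- 2 * τ * (v^2 / μ')) := by
    congr 1; field_simp
  rw [e1] at hlow
  have hρ0 : 0 ≤ ∫ s, |ρ s| := integral_nonneg fun s => abs_nonneg _
  have s3 : (∫ s, |ρ s|)^2 ≤ 4 * σ^2 * B^2 * Real.exp (τ * (v^2 / μ')) := by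
    calc _ ≤ (2 * σ * (B * Real.exp (τ * (v^2 / (2 * μ')))))^2 := by gcongr
      _ = 4 * σ^2 * B^2 * (Real.exp (τ * (v^2 / (2 * μ'))))^2 := by ring
      _ = _ := by rw [← Real.exp_nat_mul]; congr 2; push_cast; field_simp
  have s4 : 8 * Real.sqrt (Real.pi * (τ * μ')) * Real.exp (- 2 * τ * (v^2 / μ')) * (∫ s, |ρ s|)^2
     ≤ 32 * σ^2 * B^2 * Real.sqrt (Real.pi * (τ * μ')) * Real.exp (-τ * (v^2 / μ')) := by
    calc _ ≤ 8 * Real.sqrt (Real.pi * (τ * μ')) * Real.exp (- 2 * τ * (v^2 / μ')) * (4 * σ^2 * B^2 * Real.exp (τ * (v^2 / μ'))) := by gcongr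
      _ = 32 * σ^2 * B^2 * Real.sqrt (Real.pi * (τ * μ')) * (Real.exp (- 2 * τ * (v^2 / μ')) * Real.exp (τ * (v^2 / μ'))) := by ring
      _ = _ := by rw [← Real.exp_add]; congr 2; ring
  have s5 : (2 * v * τ)^2 * (∫ t, (W t)^2) ≤ 4 * v^2 * τ^2 * ((∫ t, (χ t * W t)^2) + 2 * B^2 * Real.exp (-τ * η)) := by
    rw [show (2 * v * τ)^2 = 4 * v^2 * τ^2 by ring]; gcongr
  linarith

open MeasureTheory

section Main
variable {n : ℕ} {ι : Type*} [Fintype ι]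

local notation "E" => EuclideanSpace ℝ (Fin n)
local notation "Z" => ℝ × EuclideanSpace ℝ (Fin n)
local notation "μZ" => Measure.prod (volume : Measure ℝ) (volume : Measure (EuclideanSpace ℝ (Fin n)))

/-- the box -/
def Qbox (t0 : ℝ) (x0 : E) (σ : ℝ) : Set Z := Metric.closedBall t0 (3 * σ) ×ˢ Metric.closedBall x0 σ

lemma Qbox_compact (t0 : ℝ) (x0 : E) (σ : ℝ) : IsCompact (Qbox t0 x0 σ) :=
  (isCompact_closedBall _ _).prod (isCompact_closedBall _ _)

lemma gz_line (lam : ℝ) (h : Z → ℝ) (t : ℝ) (x : E) :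
    gz lam ((1:ℝ), (0:E)) h (t, x) = gz lam (1:ℝ) (fun t => h (t, x)) t := by
  unfold gz; simp

lemma dd_line {h : Z → ℝ} (hh : Differentiable ℝ h) (t : ℝ) (x : E) :
    dd ((1:ℝ), (0:E)) h (t, x) = deriv (fun t => h (t, x)) t := by
  have h1 : HasDerivAt (fun t : ℝ => (t, x)) ((1:ℝ), (0:E)) t := (hasDerivAt_id t).prodMk (hasDerivAt_const t x)
  have := (hh (t, x)).hasFDerivAt.comp_hasDerivAt t h1
  unfold dd
  exact this.deriv.symm

lemma gz_zero_of {lam : ℝ} {h : Z → ℝ} {x0 : E} {σ : ℝ} {p : Z} (hh : ∀ z, h z ≠ 0 → z.2 ∈ Metric.closedBall x0 σ)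
    (hp : p.2 ∉ Metric.closedBall x0 σ) : gz lam ((1:ℝ), (0:E)) h p = 0 := by
  unfold gz
  have : ∀ s : ℝ, h (p - s • ((1:ℝ), (0:E))) = 0 := by
    intro s
    by_contra hc
    apply hp
    simpa using hh _ hc
  simp_rw [this]
  simp

/-- integral of a square, supported in a compact set with a pointwise bound -/
lemma int_sq_le {G : Z → ℝ} {Q : Set Z} (hQ : IsCompact Q) {M : ℝ} (h0 : ∀ z ∉ Q, G z = 0)
    (hM : ∀ z ∈ Q, |G z| ≤ M) : ∫ z, (G z)^2 ∂μZ ≤ M^2 * (μZ).real Q := by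
  have : ∫ z, (G z)^2 ∂μZ = ∫ z in Q, (G z)^2 ∂μZ := by
    rw [setIntegral_eq_integral_of_forall_compl_eq_zero]
    intro z hz; rw [h0 z hz]; simp
  rw [this]
  have hb : ∀ z ∈ Q, ‖(G z)^2‖ ≤ M^2 := by
    intro z hz
    rw [Real.norm_eq_abs, abs_of_nonneg (sq_nonneg _), ← sq_abs]
    gcongr
    exact hM z hz
  have := norm_setIntegral_le_of_norm_le_const (μ := μZ) hQ.measure_lt_top hb
  exact (le_abs_self _).trans this

/-- Laplacian-type operator on a product -/
lemma op_mul (e : ι → Z) (ε : ι → Z → ℝ) {X V : Z → ℝ} (hX : ContDiff ℝ 2 X) (hV : ContDiff ℝ 2 V) (z : Z) :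
    ∑ j, ε j z * dd (e j) (dd (e j) (fun z => X z * V z)) z
      = X z * (∑ j, ε j z * dd (e j) (dd (e j) V) z)
        + ∑ j, ε j z * (2 * dd (e j) X z * dd (e j) V z + dd (e j) (dd (e j) X) z * V z) := by
  rw [Finset.mul_sum, ← Finset.sum_add_distrib]
  refine Finset.sum_congr rfl fun j _ => ?_
  have dX : Differentiable ℝ X := hX.differentiable (by norm_num)
  have dV : Differentiable ℝ V := hV.differentiable (by norm_num)
  have dX1 : Differentiable ℝ (dd (e j) X) := (contDiff1_dd hX).differentiable (by norm_num)
  have dV1 : Differentiable ℝ (dd (e j) V) := (contDiff1_dd hV).differentiable (by norm_num)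
  have e1 : dd (e j) (fun z => X z * V z) = fun z => dd (e j) X z * V z + X z * dd (e j) V z :=
    funext fun z => dd_mul dX dV z
  rw [e1, dd_add (by fun_prop) (by fun_prop), dd_mul dX1 dV, dd_mul dX dV1]
  ring

lemma add_sq_le2 (a b : ℝ) : (a + b)^2 ≤ 2 * a^2 + 2 * b^2 := by nlinarith [sq_nonneg (a - b)]

lemma sqrt_aux {τ μ' : ℝ} (hτ1 : 1 ≤ τ) (hμ : 0 < μ') :
    Real.sqrt (Real.pi * (τ * μ')) ≤ τ^2 * (1 + Real.pi * μ') := by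
  have hτ : 0 < τ := by linarith
  have h1 : Real.sqrt (Real.pi * (τ * μ')) ≤ 1 + Real.pi * (τ * μ') := by
    rw [Real.sqrt_le_left (by positivity)]
    have : 0 ≤ Real.pi * (τ * μ') := by positivity
    nlinarith
  have h2 : 0 < Real.pi * μ' := by positivity
  have h3 : 1 ≤ τ^2 := by nlinarith
  have h4 : τ ≤ τ^2 := by nlinarith
  have h5 : τ * (Real.pi * μ') ≤ τ^2 * (Real.pi * μ') := by gcongr
  linarith

set_option maxHeartbeats 1000000 in
lemma main_decay (e : ι → Z) (o : ι) (heo : e o = ((1:ℝ), (0:E))) (ε g : ι → Z → ℝ) (H : ι → ι → ℝ) (φ f : Z → ℝ)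
    (χ : ℝ → ℝ) {C M τ0 v C0 σ η μ' κ γ t0 : ℝ} {x0 : E}
    (hC : 0 < C) (hM : 8 * C * v^2 + 1 ≤ M)
    (hCar : ∀ τ ≥ τ0, ∀ w : Z → ℝ, ContDiff ℝ 2 w → HasCompactSupport w → tsupport w ⊆ Qbox t0 x0 σ →
      τ^3 * M * ∫ z, (w z)^2 ∂μZ ≤ C * (∫ z, (conjOp e ε g H τ w z)^2 ∂μZ + τ * ∫ z, (dd (e o) w z)^2 ∂μZ))
    (hφC : ContDiff ℝ 2 φ) (hg : ∀ j, ContDiff ℝ 1 (g j)) (hφg : ∀ j z, dd (e j) φ z = g j z)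
    (hH : ∀ j z, dd (e j) (g j) z = H j j)
    (hφ : ∀ z (s : ℝ), φ z = φ (z - s • e o) + g o (z - s • e o) * s + κ * s^2 / 2)
    (hεc : ∀ j, Continuous (ε j)) (hεt : ∀ j z (s : ℝ), ε j (z - s • e o) = ε j z)
    (hεb : ∀ j, ∀ z ∈ Qbox t0 x0 σ, |ε j z| ≤ C0) (hC0 : 0 ≤ C0)
    (hf : ContDiff ℝ 2 f)
    (hfs : ∀ z ∈ tsupport f, |z.1 - t0| ≤ σ ∧ z.2 ∈ Metric.closedBall x0 σ ∧ φ z ≤ 0 ∧ |g o z| ≤ v)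
    (hF : ∀ z, (∑ j, ε j z * dd (e j) (dd (e j) f) z) ≠ 0 → φ z ≤ -η)
    (hχC : ContDiff ℝ 2 χ) (hχ1 : ∀ t, |χ t| ≤ 1) (hχ2 : ∀ t, |t - t0| ≤ 2 * σ → χ t = 1)
    (hχ3 : ∀ t, 3 * σ < |t - t0| → χ t = 0)
    (hμ : 0 < μ') (hγ : γ = μ' + κ) (hγ0 : 0 < γ) (hv : 0 < v) (hσ : 0 < σ) (hη0 : 0 < η)
    (hη : v^2 / μ' + η / 2 ≤ μ' * σ^2 / 16) (hη2 : v^2 / μ' ≤ η / 2) :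
    ∃ A b τ1 : ℝ, 0 < b ∧ 0 ≤ A ∧ ∀ τ ≥ τ1, Integrable (fun z => (Real.exp (τ * φ z) * (χ z.1 * gz (γ * τ / 2) (e o) f z))^2) μZ ∧
      ∫ z, (Real.exp (τ * φ z) * (χ z.1 * gz (γ * τ / 2) (e o) f z))^2 ∂μZ ≤ A * Real.exp (- b * τ) := by
  classical
  set Q := Qbox t0 x0 σ with hQ
  have hQc : IsCompact Q := Qbox_compact _ _ _
  have hfcs : HasCompactSupport f := by
    refine hQc.of_isClosed_subset (isClosed_tsupport f) fun z hz => ?_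
    obtain ⟨h1, h2, -⟩ := hfs z hz
    refine ⟨?_, h2⟩
    rw [Metric.mem_closedBall, Real.dist_eq]; linarith
  set F : Z → ℝ := fun z => ∑ j, ε j z * dd (e j) (dd (e j) f) z with hFdef
  have cf2 : ∀ j, Continuous (dd (e j) (dd (e j) f)) := fun j => continuous_dd (contDiff1_dd hf)
  have cf1 : ∀ j, Continuous (dd (e j) f) := fun j => (contDiff1_dd hf).continuous
  have hFc : Continuous F := by rw [hFdef]; fun_prop
  have hFns : ∀ z, F z ≠ 0 → z ∈ tsupport f := by
    intro z hz
    by_contra h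
    apply hz
    rw [hFdef]; simp only
    exact Finset.sum_eq_zero fun j _ => by rw [dd2_zero_of_notMem h, mul_zero]
  have hFcs : HasCompactSupport F := HasCompactSupport.intro hfcs fun z hz => by
    by_contra h; exact hz (hFns z h)
  have hf1ns : ∀ j z, dd (e j) f z ≠ 0 → z ∈ tsupport f := by
    intro j z hz; by_contra h; exact hz (dd_zero_of_notMem h)
  have hfns : ∀ z, f z ≠ 0 → z ∈ tsupport f := fun z hz => subset_tsupport f hz
  -- uniform bounds
  obtain ⟨Bf, hBf⟩ := bound_of_cs hf.continuous hfcs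
  obtain ⟨BF, hBF⟩ := bound_of_cs hFc hFcs
  choose Bd hBd using fun j => bound_of_cs (cf1 j) (hcs_dd hfcs (e j))
  have hBf0 : 0 ≤ Bf := (norm_nonneg _).trans (hBf 0)
  have hBF0 : 0 ≤ BF := (norm_nonneg _).trans (hBF 0)
  have hBd0 : ∀ j, 0 ≤ Bd j := fun j => (norm_nonneg _).trans (hBd j 0)
  set X1 : Z → ℝ := fun z => χ z.1 with hX1
  have hX1C : ContDiff ℝ 2 X1 := hχC.comp contDiff_fst
  choose b1 hb1 using fun j => hQc.exists_bound_of_continuousOn (f := dd (e j) X1)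
    (contDiff1_dd hX1C).continuous.continuousOn
  choose b2 hb2 using fun j => hQc.exists_bound_of_continuousOn (f := dd (e j) (dd (e j) X1))
    (continuous_dd (contDiff1_dd hX1C)).continuousOn
  have hzQ : ((t0, x0) : Z) ∈ Q := ⟨by simp; positivity, by simp; positivity⟩
  have hb10 : ∀ j, 0 ≤ b1 j := fun j => (norm_nonneg _).trans (hb1 j _ hzQ)
  have hb20 : ∀ j, 0 ≤ b2 j := fun j => (norm_nonneg _).trans (hb2 j _ hzQ)
  -- vanishing of derivatives of the cutoff
  have hXloc : ∀ z : Z, |z.1 - t0| < 2 * σ → X1 =ᶠ[nhds z] fun _ => 1 := by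
    intro z hz
    have : ∀ᶠ y : Z in nhds z, |y.1 - t0| < 2 * σ :=
      (continuous_abs.comp (continuous_fst.sub continuous_const)).continuousAt.eventually_lt continuousAt_const hz
    filter_upwards [this] with y hy
    exact hχ2 _ hy.le
  have hXd : ∀ j (z : Z), |z.1 - t0| < 2 * σ → dd (e j) X1 z = 0 := by
    intro j z hz
    unfold dd; rw [(hXloc z hz).fderiv_eq]; simp
  have hXdd : ∀ j (z : Z), |z.1 - t0| < 2 * σ → dd (e j) (dd (e j) X1) z = 0 := by
    intro j z hz
    have : dd (e j) X1 =ᶠ[nhds z] fun _ => 0 := by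
      have : ∀ᶠ y : Z in nhds z, |y.1 - t0| < 2 * σ :=
        (continuous_abs.comp (continuous_fst.sub continuous_const)).continuousAt.eventually_lt continuousAt_const hz
      filter_upwards [this] with y hy
      exact hXd j y hy
    rw [dd, this.fderiv_eq]; simp
  set A1 : ℝ := BF + ∑ j, C0 * (2 * b1 j * Bd j + b2 j * Bf) with hA1
  have hA10 : 0 ≤ A1 := add_nonneg hBF0 (Finset.sum_nonneg fun j _ => by
    have := hb10 j; have := hb20 j; have := hBd0 j; positivity)
  set VQ := (μZ).real Q with hVQ
  set VB := (volume : Measure E).real (Metric.closedBall x0 σ) with hVB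
  have hVQ0 : 0 ≤ VQ := measureReal_nonneg
  have hVB0 : 0 ≤ VB := measureReal_nonneg
  set b : ℝ := min η (v^2 / μ') with hb
  have hb0 : 0 < b := lt_min hη0 (by positivity)
  set A : ℝ := C * (A1^2 * VQ + (2 * (b1 o * Bf)^2 * VQ
     + 2 * VB * (8 * v^2 * Bf^2 + 32 * σ^2 * Bf^2 * (1 + Real.pi * μ')))) with hA
  have hA0 : 0 ≤ A := by positivity
  refine ⟨A, b, max (max τ0 1) (8 * Real.pi / μ'), hb0, hA0, fun τ hτ' => ?_⟩
  have hτ0 : τ0 ≤ τ := (le_max_left _ _).trans ((le_max_left _ _).trans hτ')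
  have hτ1 : 1 ≤ τ := (le_max_right _ _).trans ((le_max_left _ _).trans hτ')
  have hbig : 8 * Real.pi ≤ τ * μ' := by
    have := (le_max_right _ _).trans hτ'
    rwa [div_le_iff₀ hμ] at this
  have hτ : 0 < τ := by linarith
  have hl : 0 < γ * τ / 2 := by positivity
  set V := gz (γ * τ / 2) (e o) f with hV
  have hVC : ContDiff ℝ 2 V := gz_contDiff2_cs hl hf hfcs
  set w : Z → ℝ := fun z => Real.exp (τ * φ z) * (X1 z * V z) with hw
  have hwC : ContDiff ℝ 2 w := by rw [hw]; fun_prop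
  have hXzero : ∀ z : Z, z ∉ Q → X1 z * V z = 0 := by
    intro z hz
    by_cases h1 : z.1 ∈ Metric.closedBall t0 (3 * σ)
    · have h2 : z.2 ∉ Metric.closedBall x0 σ := fun h2 => hz ⟨h1, h2⟩
      rw [hV, heo, gz_zero_of (x0 := x0) (σ := σ) (fun z hz => (hfs z (hfns z hz)).2.1) h2, mul_zero]
    · rw [Metric.mem_closedBall, not_le, Real.dist_eq] at h1
      rw [hX1]; simp only; rw [hχ3 _ h1, zero_mul]
  have hwQ : tsupport w ⊆ Q := by
    refine closure_minimal (fun z hz => ?_) hQc.isClosed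
    by_contra h
    exact hz (by simp only [hw]; rw [hXzero z h, mul_zero])
  have hwcs : HasCompactSupport w := hQc.of_isClosed_subset (isClosed_tsupport w) hwQ
  have hcar := hCar τ hτ0 w hwC hwcs hwQ
  -- weighted bounds
  have wF : ∀ z, |Real.exp (τ * φ z) * gz (γ * τ / 2) (e o) F z| ≤ BF * Real.exp (-τ * η / 2) := by
    intro z
    refine (gz_weighted (v := v) (θ := -η) (a := 0) hBF0 hBF hτ hμ hγ hφ z (fun s hs =>
      ⟨hF _ hs, (hfs _ (hFns _ hs)).2.2.2, sq_nonneg s⟩) hbig).trans ?_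
    gcongr
    have : τ * (v^2 / μ') ≤ τ * (η / 2) := by gcongr
    linarith
  have wfar : ∀ (h : Z → ℝ) (B : ℝ), 0 ≤ B → (∀ z, ‖h z‖ ≤ B) → (∀ z, h z ≠ 0 → z ∈ tsupport f) →
      ∀ z : Z, 2 * σ ≤ |z.1 - t0| → |Real.exp (τ * φ z) * gz (γ * τ / 2) (e o) h z| ≤ B * Real.exp (-τ * η / 2) := by
    intro h B hB0 hB hns z hz
    refine (gz_weighted (v := v) (θ := 0) (a := σ^2) hB0 hB hτ hμ hγ hφ z (fun s hs => ?_) hbig).trans ?_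
    · obtain ⟨h1, -, h3, h4⟩ := hfs _ (hns _ hs)
      refine ⟨h3, h4, ?_⟩
      rw [heo] at h1
      simp only [Prod.smul_mk, smul_eq_mul, mul_one, smul_zero, Prod.fst_sub] at h1
      have h5 : σ ≤ |s| := by
        have := abs_add_le (z.1 - s - t0) s
        rw [show z.1 - s - t0 + s = z.1 - t0 by ring] at this
        linarith
      have : σ^2 ≤ |s|^2 := by gcongr
      rwa [sq_abs] at this
    · gcongr
      have : τ * (v^2 / μ' + η / 2) ≤ τ * (μ' * σ^2 / 16) := by gcongr
      have : 0 ≤ τ * (μ' * σ^2 / 16) := by positivity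
      linarith
  -- the source term
  have hG : ∀ z, conjOp e ε g H τ w z = X1 z * (Real.exp (τ * φ z) * gz (γ * τ / 2) (e o) F z)
      + ∑ j, ε j z * (2 * dd (e j) X1 z * (Real.exp (τ * φ z) * gz (γ * τ / 2) (e o) (dd (e j) f) z)
        + dd (e j) (dd (e j) X1) z * (Real.exp (τ * φ z) * gz (γ * τ / 2) (e o) f z)) := by
    intro z
    have h1 := conj_identity e ε g H τ (φ := φ) (V := fun z => X1 z * V z) (hφC.differentiable (by norm_num))
      (fun j => (hg j).differentiable (by norm_num)) hφg hH (hX1C.mul hVC) z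
    rw [hw]; rw [h1, op_mul e ε hX1C hVC, mul_add, gz_op hl hf hfcs e ε hεt, Finset.mul_sum]
    congr 1
    · ring
    · refine Finset.sum_congr rfl fun j _ => ?_
      rw [hV, gz_dd_cs hl (hf.of_le (by norm_num)) hfcs]
      ring
  have hGb : ∀ z ∈ Q, |conjOp e ε g H τ w z| ≤ A1 * Real.exp (-τ * η / 2) := by
    intro z hz
    rw [hG, hA1, add_mul, Finset.sum_mul]
    refine (abs_add_le _ _).trans (add_le_add ?_ ((Finset.abs_sum_le_sum_abs _ _).trans (Finset.sum_le_sum fun j _ => ?_)))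
    · rw [abs_mul]
      calc _ ≤ 1 * (BF * Real.exp (-τ * η / 2)) := by gcongr; exacts [hχ1 _, wF z]
        _ = _ := one_mul _
    · rw [abs_mul, mul_assoc C0]
      refine mul_le_mul (hεb j z hz) ?_ (abs_nonneg _) hC0
      have p0 := hb10 j
      have p1 := hb20 j
      have p2 := hBd0 j
      rcases lt_or_ge |z.1 - t0| (2 * σ) with hlt | hge
      · rw [hXd j z hlt, hXdd j z hlt]; simp; positivity
      · have q1 := wfar (dd (e j) f) (Bd j) (hBd0 j) (hBd j) (hf1ns j) z hge
        have q2 := wfar f Bf hBf0 hBf hfns z hge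
        have q3 := hb1 j z hz
        have q4 := hb2 j z hz
        rw [Real.norm_eq_abs] at q3 q4
        refine (abs_add_le _ _).trans ?_
        rw [abs_mul, abs_mul _ (Real.exp (τ * φ z) * gz (γ * τ / 2) (e o) f z), abs_mul (2:ℝ), abs_two]
        calc _ ≤ 2 * b1 j * (Bd j * Real.exp (-τ * η / 2)) + b2 j * (Bf * Real.exp (-τ * η / 2)) := by gcongr
          _ = _ := by ring
  have hGint : ∫ z, (conjOp e ε g H τ w z)^2 ∂μZ ≤ (A1 * Real.exp (-τ * η / 2))^2 * VQ := by
    refine int_sq_le hQc (fun z hz => ?_) hGb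
    have hz' : z ∉ tsupport w := fun h => hz (hwQ h)
    unfold conjOp
    simp only [dd2_zero_of_notMem hz', dd_zero_of_notMem hz', image_eq_zero_of_notMem_tsupport hz']
    simp
  -- time derivative
  set W : Z → ℝ := fun z => Real.exp (τ * φ z) * V z with hWdef
  have hWC : ContDiff ℝ 2 W := by rw [hWdef]; fun_prop
  have hwW : w = fun z => X1 z * W z := by ext z; simp only [hw, hWdef]; ring
  have hdw : ∀ z, dd (e o) w z = dd (e o) X1 z * W z + X1 z * dd (e o) W z := by
    intro z; rw [hwW]
    exact dd_mul (hX1C.differentiable (by norm_num)) (hWC.differentiable (by norm_num)) z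
  have hWzero : ∀ z : Z, z.2 ∉ Metric.closedBall x0 σ → W z = 0 := by
    intro z hz
    simp only [hWdef]
    rw [hV, heo, gz_zero_of (x0 := x0) (σ := σ) (fun z hz => (hfs z (hfns z hz)).2.1) hz, mul_zero]
  have hdWzero : ∀ z : Z, z.2 ∉ Metric.closedBall x0 σ → dd (e o) W z = 0 := by
    intro z hz
    have hz2 : ∀ᶠ y : Z in nhds z, y.2 ∉ Metric.closedBall x0 σ :=
      continuous_snd.continuousAt.eventually (Metric.isClosed_closedBall.isOpen_compl.mem_nhds hz)
    have : W =ᶠ[nhds z] fun _ => 0 := by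
      filter_upwards [hz2] with y hy
      exact hWzero y hy
    rw [dd, this.fderiv_eq]; simp
  have hXWzero : ∀ z : Z, z ∉ Q → X1 z * dd (e o) W z = 0 := by
    intro z hz
    by_cases h1 : z.1 ∈ Metric.closedBall t0 (3 * σ)
    · have h2 : z.2 ∉ Metric.closedBall x0 σ := fun h2 => hz ⟨h1, h2⟩
      rw [hdWzero z h2, mul_zero]
    · rw [Metric.mem_closedBall, not_le, Real.dist_eq] at h1
      rw [hX1]; simp only; rw [hχ3 _ h1, zero_mul]
  have cdW : Continuous (dd (e o) W) := (contDiff1_dd hWC).continuous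
  have cX1 := hX1C.continuous
  have cdX1 : Continuous (dd (e o) X1) := (contDiff1_dd hX1C).continuous
  have iXW : Integrable (fun z => (X1 z * dd (e o) W z)^2) μZ := by
    apply Continuous.integrable_of_hasCompactSupport (by fun_prop)
    exact HasCompactSupport.intro hQc fun z hz => by rw [hXWzero z hz]; simp
  have iw : Integrable (fun z => (w z)^2) μZ := by
    apply Continuous.integrable_of_hasCompactSupport (hwC.continuous.pow 2)
    exact HasCompactSupport.intro hQc fun z hz => by
      change (w z)^2 = 0
      simp only [hw]; rw [hXzero z hz]; simp
  set En : ℝ := 4 * v^2 * τ^2 * (2 * Bf^2 * Real.exp (-τ * η))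
      + 32 * σ^2 * Bf^2 * Real.sqrt (Real.pi * (τ * μ')) * Real.exp (-τ * (v^2 / μ')) with hEn
  have hEn0 : 0 ≤ En := by positivity
  have s1 : ∫ z, (X1 z * dd (e o) W z)^2 ∂μZ ≤ 4 * v^2 * τ^2 * ∫ z, (w z)^2 ∂μZ + VB * En := by
    rw [integral_prod_symm _ iXW, integral_prod_symm _ iw, ← integral_const_mul]
    have e1 : VB * En = ∫ x : E, (Metric.closedBall x0 σ).indicator (fun _ => En) x := by
      rw [integral_indicator_const _ Metric.isClosed_closedBall.measurableSet, smul_eq_mul]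
    rw [e1]
    have i2 : Integrable (fun x : E => 4 * v^2 * τ^2 * ∫ t : ℝ, (w (t, x))^2) :=
      (Integrable.integral_prod_right iw).const_mul _
    have i3 : Integrable (fun x : E => (Metric.closedBall x0 σ).indicator (fun _ => En) x) :=
      (integrable_indicator_iff Metric.isClosed_closedBall.measurableSet).mpr
        (integrableOn_const (isCompact_closedBall x0 σ).measure_lt_top.ne)
    rw [← integral_add i2 i3]
    refine integral_mono (Integrable.integral_prod_right iXW) (i2.add i3) fun x => ?_
    simp only
    by_cases hx : x ∈ Metric.closedBall x0 σ
    · rw [Set.indicator_of_mem hx]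
      have hl := (line_bound (f := fun t => f (t, x)) (φ := fun t => φ (t, x)) (g := fun t => g o (t, x)) (χ := χ)
        (B := Bf) (τ := τ) (γ := γ) (κ := κ) (μ' := μ') (v := v) (σ := σ) (η := η) (t0 := t0) hBf0
        (by have := hf.continuous; fun_prop) (by have := hφC.continuous; fun_prop)
        (by have := (hg o).continuous; fun_prop) hχC.continuous (fun t => hBf (t, x))
        (fun t ht => by
          obtain ⟨q1, -, q3, q4⟩ := hfs _ (hfns _ ht)
          exact ⟨q1, q3, q4⟩)
        (fun t s => by simpa [heo] using hφ (t, x) s) hχ1 hχ2 hτ hμ hγ hv hσ hη hbig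
        (W := fun t => W (t, x)) (fun t => by simp only [hWdef, hV]; rw [heo, gz_line])).2
      have e2 : ∀ t : ℝ, X1 (t, x) * dd (e o) W (t, x) = χ t * deriv (fun t => W (t, x)) t := by
        intro t; rw [heo, dd_line (hWC.differentiable (by norm_num))]
      have e3 : ∀ t : ℝ, w (t, x) = χ t * W (t, x) := fun t => by rw [hwW]
      simp_rw [e2, e3]
      refine hl.trans (le_of_eq ?_)
      rw [hEn]; ring
    · rw [Set.indicator_of_notMem hx]
      have e2 : ∀ t : ℝ, X1 (t, x) * dd (e o) W (t, x) = 0 := fun t => by rw [hdWzero (t, x) hx, mul_zero]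
      simp_rw [e2]
      simp
      positivity
  have s2 : ∫ z, (dd (e o) X1 z * W z)^2 ∂μZ ≤ (b1 o * Bf * Real.exp (-τ * η / 2))^2 * VQ := by
    have z0 : ∀ z, z ∉ Q → dd (e o) X1 z * W z = 0 := by
      intro z hz
      by_cases h1 : z.1 ∈ Metric.closedBall t0 (3 * σ)
      · have h2 : z.2 ∉ Metric.closedBall x0 σ := fun h2 => hz ⟨h1, h2⟩
        rw [hWzero z h2, mul_zero]
      · rw [Metric.mem_closedBall, not_le, Real.dist_eq] at h1
        have hz2 : ∀ᶠ y : Z in nhds z, 3 * σ < |y.1 - t0| :=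
          continuousAt_const.eventually_lt (continuous_abs.comp (continuous_fst.sub continuous_const)).continuousAt h1
        have : X1 =ᶠ[nhds z] fun _ => 0 := by
          filter_upwards [hz2] with y hy
          exact hχ3 _ hy
        rw [dd, this.fderiv_eq]; simp
    refine int_sq_le hQc z0 fun z hz => ?_
    rcases lt_or_ge |z.1 - t0| (2 * σ) with hlt | hge
    · rw [hXd o z hlt]; simp
      have := hb10 o; positivity
    · have q2 := wfar f Bf hBf0 hBf hfns z hge
      have q3 := hb1 o z hz
      rw [Real.norm_eq_abs] at q3
      rw [abs_mul, mul_assoc]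
      have := hb10 o
      gcongr
  have s3 : ∫ z, (dd (e o) w z)^2 ∂μZ ≤ 2 * ∫ z, (dd (e o) X1 z * W z)^2 ∂μZ + 2 * ∫ z, (X1 z * dd (e o) W z)^2 ∂μZ := by
    have idw : Integrable (fun z => (dd (e o) w z)^2) μZ := by
      apply Continuous.integrable_of_hasCompactSupport ((contDiff1_dd hwC).continuous.pow 2)
      exact HasCompactSupport.intro hwcs fun z hz => by
        change (dd (e o) w z)^2 = 0
        rw [dd_zero_of_notMem hz]; simp
    have iXW2 : Integrable (fun z => (dd (e o) X1 z * W z)^2) μZ := by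
      have e5 : (fun z => (dd (e o) X1 z * W z)^2) = fun z => (dd (e o) w z - X1 z * dd (e o) W z)^2 := by
        ext z; rw [hdw]; ring
      rw [e5]
      apply Continuous.integrable_of_hasCompactSupport (by have := (contDiff1_dd (e := e o) hwC).continuous; fun_prop)
      refine HasCompactSupport.intro hQc fun z hz => ?_
      rw [hXWzero z hz, dd_zero_of_notMem (fun h => hz (hwQ h))]; simp
    rw [← integral_const_mul, ← integral_const_mul, ← integral_add (iXW2.const_mul 2) (iXW.const_mul 2)]
    refine integral_mono idw ((iXW2.const_mul 2).add (iXW.const_mul 2)) fun z => ?_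
    simp only
    rw [hdw]
    exact add_sq_le2 _ _
  -- final bookkeeping
  set I := ∫ z, (w z)^2 ∂μZ with hI
  have hI0 : 0 ≤ I := integral_nonneg fun z => sq_nonneg _
  set ex := Real.exp (- b * τ) with hex
  have hex0 : 0 < ex := Real.exp_pos _
  have x1 : Real.exp (-τ * η) ≤ ex := by
    apply Real.exp_le_exp.mpr
    have : b * τ ≤ η * τ := by gcongr; exact min_le_left _ _
    linarith
  have x2 : Real.exp (-τ * (v^2 / μ')) ≤ ex := by
    apply Real.exp_le_exp.mpr
    have : b * τ ≤ (v^2 / μ') * τ := by gcongr; exact min_le_right _ _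
    linarith
  have x3 : (Real.exp (-τ * η / 2))^2 ≤ ex := by
    rw [← Real.exp_nat_mul]
    refine le_trans (le_of_eq ?_) x1
    congr 1; push_cast; ring
  have x4 := sqrt_aux hτ1 hμ
  have y1 : (A1 * Real.exp (-τ * η / 2))^2 * VQ ≤ τ^3 * ex * (A1^2 * VQ) := by
    have : (1:ℝ) ≤ τ^3 := one_le_pow₀ hτ1
    calc _ = A1^2 * VQ * (Real.exp (-τ * η / 2))^2 := by ring
      _ ≤ A1^2 * VQ * (1 * ex) := by gcongr; linarith
      _ ≤ A1^2 * VQ * (τ^3 * ex) := by gcongr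
      _ = _ := by ring
  have y2 : (b1 o * Bf * Real.exp (-τ * η / 2))^2 * VQ ≤ τ^2 * ex * ((b1 o * Bf)^2 * VQ) := by
    have : (1:ℝ) ≤ τ^2 := one_le_pow₀ hτ1
    calc _ = (b1 o * Bf)^2 * VQ * (Real.exp (-τ * η / 2))^2 := by ring
      _ ≤ (b1 o * Bf)^2 * VQ * (1 * ex) := by gcongr; linarith
      _ ≤ (b1 o * Bf)^2 * VQ * (τ^2 * ex) := by gcongr
      _ = _ := by ring
  have y3 : En ≤ τ^2 * ex * (8 * v^2 * Bf^2 + 32 * σ^2 * Bf^2 * (1 + Real.pi * μ')) := by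
    rw [hEn]
    calc _ ≤ 4 * v^2 * τ^2 * (2 * Bf^2 * ex) + 32 * σ^2 * Bf^2 * (τ^2 * (1 + Real.pi * μ')) * ex := by gcongr
      _ = _ := by ring
  have y4 : VB * En ≤ VB * (τ^2 * ex * (8 * v^2 * Bf^2 + 32 * σ^2 * Bf^2 * (1 + Real.pi * μ'))) := by gcongr
  have y5 : ∫ z, (dd (e o) w z)^2 ∂μZ ≤ 8 * v^2 * τ^2 * I + τ^2 * ex * (2 * (b1 o * Bf)^2 * VQ
     + 2 * VB * (8 * v^2 * Bf^2 + 32 * σ^2 * Bf^2 * (1 + Real.pi * μ'))) := by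
    linarith
  have y6 := mul_le_mul_of_nonneg_left y5 hτ.le
  have y7 : τ^3 * M * I ≤ C * (τ^3 * ex * (A1^2 * VQ) + τ * (8 * v^2 * τ^2 * I + τ^2 * ex * (2 * (b1 o * Bf)^2 * VQ
     + 2 * VB * (8 * v^2 * Bf^2 + 32 * σ^2 * Bf^2 * (1 + Real.pi * μ'))))) := by
    refine hcar.trans ?_
    gcongr
    linarith
  have y8 : τ^3 * (8 * C * v^2 + 1) * I ≤ τ^3 * M * I := by gcongr
  have y9 : τ^3 * I ≤ τ^3 * (A * ex) := by
    rw [hA]; linarith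
  exact ⟨iw, le_of_mul_le_mul_left y9 (by positivity)⟩
end Main

open MeasureTheory

lemma exp_beats {A b c τ1 : ℝ} (hb : 0 < b) (hc : 0 < c)
    (h : ∀ τ ≥ τ1, c * Real.exp (3 * b * τ / 4) ≤ A * τ) : False := by
  set τ := max (max τ1 1) ((|A| + 1) / (c * (9 * b^2 / 64))) with hτ
  have h1 : τ1 ≤ τ := (le_max_left _ _).trans (le_max_left _ _)
  have h2 : 1 ≤ τ := (le_max_right _ _).trans (le_max_left _ _)
  have h3 : |A| + 1 ≤ τ * (c * (9 * b^2 / 64)) := by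
    have := le_max_right (max τ1 1) ((|A| + 1) / (c * (9 * b^2 / 64)))
    rwa [← hτ, div_le_iff₀ (by positivity)] at this
  have h4 := h τ h1
  have h5 : (3 * b * τ / 8)^2 ≤ Real.exp (3 * b * τ / 4) := by
    have e : Real.exp (3 * b * τ / 4) = (Real.exp (3 * b * τ / 8))^2 := by
      rw [← Real.exp_nat_mul]; congr 1; push_cast; ring
    rw [e]
    have := Real.add_one_le_exp (3 * b * τ / 8)
    gcongr
    linarith
  have h6 : c * (3 * b * τ / 8)^2 ≤ A * τ := (mul_le_mul_of_nonneg_left h5 hc.le).trans h4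
  have h7 : (τ * (c * (9 * b^2 / 64))) * τ ≤ A * τ := by
    calc _ = c * (3 * b * τ / 8)^2 := by ring
      _ ≤ _ := h6
  have h8 := le_of_mul_le_mul_right h7 (by linarith)
  have := le_abs_self A
  linarith

section Main
variable {n : ℕ}
local notation "E" => EuclideanSpace ℝ (Fin n)
local notation "Z" => ℝ × EuclideanSpace ℝ (Fin n)
local notation "μZ" => Measure.prod (volume : Measure ℝ) (volume : Measure (EuclideanSpace ℝ (Fin n)))

lemma decay_vanish (e0 : Z) {φ f : Z → ℝ} {χ : ℝ → ℝ} {A b τ1 γ : ℝ} (hb : 0 < b) (hγ : 0 < γ)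
    (hf : ContDiff ℝ 2 f) (hfc : HasCompactSupport f) (hφ : Continuous φ) (z1 : Z)
    (hχ : ∀ᶠ z : Z in nhds z1, χ z.1 = 1) (hφ1 : -b / 8 < φ z1)
    (H : ∀ τ ≥ τ1, Integrable (fun z => (Real.exp (τ * φ z) * (χ z.1 * gz (γ * τ / 2) e0 f z))^2) μZ ∧
      ∫ z, (Real.exp (τ * φ z) * (χ z.1 * gz (γ * τ / 2) e0 f z))^2 ∂μZ ≤ A * Real.exp (- b * τ)) : f z1 = 0 := by
  by_contra hne
  set m := |f z1| / 2 with hm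
  have hf0 : 0 < |f z1| := abs_pos.mpr hne
  have hm0 : 0 < m := by positivity
  have ev1 : ∀ᶠ z in nhds z1, m < |f z| :=
    continuousAt_const.eventually_lt (continuous_abs.comp hf.continuous).continuousAt (by change |f z1| / 2 < |f z1|; linarith)
  have ev2 : ∀ᶠ z in nhds z1, -b / 8 < φ z :=
    continuousAt_const.eventually_lt hφ.continuousAt hφ1
  obtain ⟨r, hr, hball⟩ := Metric.eventually_nhds_iff_ball.mp (hχ.and (ev1.and ev2))
  obtain ⟨Kl, hKl⟩ := hf.lipschitzWith_of_hasCompactSupport hfc (by norm_num)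
  set L : ℝ := Kl * ‖e0‖ with hL
  have hL0 : 0 ≤ L := by positivity
  have hLip : ∀ z (s : ℝ), |f (z - s • e0) - f z| ≤ L * |s| := by
    intro z s
    have := hKl.dist_le_mul (z - s • e0) z
    rw [Real.dist_eq, dist_eq_norm, show z - s • e0 - z = -(s • e0) by abel, norm_neg, norm_smul, Real.norm_eq_abs] at this
    rw [hL]; linarith
  obtain ⟨B, hB⟩ := bound_of_cs hf.continuous hfc
  set VO := (μZ).real (Metric.ball z1 r) with hVO
  have hVO0 : 0 < VO := by
    rw [hVO, measureReal_def]
    apply ENNReal.toReal_pos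
    · exact (Metric.isOpen_ball.measure_pos _ ⟨z1, Metric.mem_ball_self hr⟩).ne'
    · exact ((measure_mono Metric.ball_subset_closedBall).trans_lt (isCompact_closedBall z1 r).measure_lt_top).ne
  refine exp_beats (A := A) (c := VO * (m^2 * Real.pi / (2 * γ))) (τ1 := max (max τ1 1) (16 * L^2 / (m^2 * γ))) hb (by positivity) ?_
  intro τ hτ'
  have h1 : τ1 ≤ τ := (le_max_left _ _).trans ((le_max_left _ _).trans hτ')
  have h2 : 1 ≤ τ := (le_max_right _ _).trans ((le_max_left _ _).trans hτ')
  have h3 : 16 * L^2 ≤ τ * (m^2 * γ) := by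
    have := (le_max_right _ _).trans hτ'
    rwa [div_le_iff₀ (by positivity)] at this
  have hτ0 : 0 < τ := by linarith
  have hl : 0 < γ * τ / 2 := by positivity
  obtain ⟨i1, h4⟩ := H τ h1
  have low : ∀ z ∈ Metric.ball z1 r, Real.exp (-b * τ / 4) * (m^2 * Real.pi / (2 * γ * τ))
      ≤ (Real.exp (τ * φ z) * (χ z.1 * gz (γ * τ / 2) e0 f z))^2 := by
    intro z hz
    obtain ⟨c1, c2, c3⟩ := hball z hz
    rw [c1, one_mul, mul_pow]
    have g1 := gz_lower (e0 := e0) hl hf.continuous hB hLip hL0 z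
    have sq1 : Real.sqrt (2 * Real.pi) / (γ * τ / 2) = Real.sqrt 2 * Real.sqrt (Real.pi / (γ * τ / 2)) / Real.sqrt (γ * τ / 2) := by
      generalize hq : γ * τ / 2 = q at hl
      rw [Real.sqrt_mul (by norm_num), Real.sqrt_div (by positivity), ← mul_div_assoc, div_div, Real.mul_self_sqrt hl.le]
    have sq2 : L * Real.sqrt 2 ≤ m / 2 * Real.sqrt (γ * τ / 2) := by
      apply (sq_le_sq₀ (by positivity) (by positivity)).mp
      rw [mul_pow L, mul_pow (m / 2), Real.sq_sqrt (by norm_num), Real.sq_sqrt hl.le]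
      linarith
    set R := Real.sqrt (Real.pi / (γ * τ / 2)) with hR
    have hR0 : 0 < R := by rw [hR]; positivity
    have g2 : L * (Real.sqrt (2 * Real.pi) / (γ * τ / 2)) ≤ m / 2 * R := by
      rw [sq1, ← mul_div_assoc, div_le_iff₀ (by positivity)]
      calc _ = (L * Real.sqrt 2) * R := by ring
        _ ≤ (m / 2 * Real.sqrt (γ * τ / 2)) * R := by gcongr
        _ = _ := by ring
    have g3 : m / 2 * R ≤ |gz (γ * τ / 2) e0 f z| := by
      have t1 : |f z * R| ≤ |gz (γ * τ / 2) e0 f z| + |gz (γ * τ / 2) e0 f z - f z * R| := by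
        have := abs_sub_abs_le_abs_sub (f z * R) (gz (γ * τ / 2) e0 f z)
        rw [abs_sub_comm] at this
        linarith
      rw [abs_mul, abs_of_pos hR0] at t1
      have : m * R ≤ |f z| * R := by gcongr
      linarith
    have g4 : m^2 * Real.pi / (2 * γ * τ) ≤ (gz (γ * τ / 2) e0 f z)^2 := by
      calc _ = (m / 2 * R)^2 := by
            rw [mul_pow, hR, Real.sq_sqrt (by positivity)]; field_simp
        _ ≤ |gz (γ * τ / 2) e0 f z|^2 := by gcongr
        _ = _ := sq_abs _
    have g5 : Real.exp (-b * τ / 4) ≤ (Real.exp (τ * φ z))^2 := by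
      rw [← Real.exp_nat_mul]
      apply Real.exp_le_exp.mpr
      push_cast
      have : τ * (-b / 8) ≤ τ * φ z := by gcongr
      linarith
    gcongr
  have h5 : VO * (Real.exp (-b * τ / 4) * (m^2 * Real.pi / (2 * γ * τ))) ≤ A * Real.exp (- b * τ) := by
    refine le_trans ?_ h4
    have e1 : VO * (Real.exp (-b * τ / 4) * (m^2 * Real.pi / (2 * γ * τ)))
       = ∫ z in Metric.ball z1 r, (Real.exp (-b * τ / 4) * (m^2 * Real.pi / (2 * γ * τ))) ∂μZ := by
      rw [setIntegral_const, smul_eq_mul]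
    rw [e1]
    refine le_trans (setIntegral_mono_on ?_ i1.integrableOn Metric.isOpen_ball.measurableSet low) ?_
    · exact integrableOn_const ((measure_mono Metric.ball_subset_closedBall).trans_lt (isCompact_closedBall z1 r).measure_lt_top).ne
    · exact setIntegral_le_integral i1 (Filter.Eventually.of_forall fun z => sq_nonneg _)
  have e2 : Real.exp (3 * b * τ / 4) = Real.exp (-b * τ / 4) / Real.exp (- b * τ) := by
    rw [← Real.exp_sub]; congr 1; ring
  rw [e2, ← mul_div_assoc, div_le_iff₀ (Real.exp_pos _)]
  calc _ = (VO * (Real.exp (-b * τ / 4) * (m^2 * Real.pi / (2 * γ * τ)))) * τ := by field_simp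
    _ ≤ (A * Real.exp (- b * τ)) * τ := by gcongr
    _ = _ := by ring
end Main

open MeasureTheory

section Weight
variable {Y : Type*} [NormedAddCommGroup Y] [NormedSpace ℝ Y] {ι : Type*} [Fintype ι] [DecidableEq ι]

/-- linear form with coefficients `ℓ` -/
noncomputable def linf (co : ι → Y →L[ℝ] ℝ) (ℓ : ι → ℝ) : Y →L[ℝ] ℝ := ∑ j, ℓ j • co j

/-- the weight -/
noncomputable def wphi (co : ι → Y →L[ℝ] ℝ) (ℓ : ι → ℝ) (K N : ℝ) (p0 : Y) (z : Y) : ℝ :=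
  linf co ℓ (z - p0) + K / 2 * (linf co ℓ (z - p0))^2 - 2 * N * ∑ j, (co j (z - p0))^2

/-- its partial derivatives -/
noncomputable def wgrad (co : ι → Y →L[ℝ] ℝ) (ℓ : ι → ℝ) (K N : ℝ) (p0 : Y) (j : ι) (z : Y) : ℝ :=
  ℓ j + K * linf co ℓ (z - p0) * ℓ j - 4 * N * co j (z - p0)

variable (co : ι → Y →L[ℝ] ℝ) (eb : ι → Y)
  (ℓ : ι → ℝ) (K N : ℝ) (p0 : Y)

lemma linf_eb (hco : ∀ j k, co j (eb k) = if j = k then 1 else 0)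
    (j : ι) : linf co ℓ (eb j) = ℓ j := by
  simp [linf, hco]

lemma wphi_contDiff {m : WithTop ℕ∞} : ContDiff ℝ m (wphi co ℓ K N p0) := by
  unfold wphi; fun_prop

lemma wgrad_contDiff {m : WithTop ℕ∞} (j : ι) : ContDiff ℝ m (wgrad co ℓ K N p0 j) := by
  unfold wgrad; fun_prop

lemma dd_wphi (hco : ∀ j k, co j (eb k) = if j = k then 1 else 0)
    (j : ι) (z : Y) : dd (eb j) (wphi co ℓ K N p0) z = wgrad co ℓ K N p0 j z := by
  have h0 : HasFDerivAt (fun z : Y => z - p0) (ContinuousLinearMap.id ℝ Y) z := (hasFDerivAt_id z).sub_const p0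
  have hL : HasFDerivAt (fun z => linf co ℓ (z - p0)) (linf co ℓ) z := by
    exact ((linf co ℓ).hasFDerivAt (x := z - p0)).comp z h0
  have hc : ∀ k, HasFDerivAt (fun z => co k (z - p0)) (co k) z := fun k => by
    exact ((co k).hasFDerivAt (x := z - p0)).comp z h0
  have h1 := (hL.add ((hL.pow 2).const_mul (K / 2))).sub
    ((HasFDerivAt.fun_sum (u := Finset.univ) fun k _ => (hc k).pow 2).const_mul (2 * N))
  have h2 : HasFDerivAt (wphi co ℓ K N p0) _ z := h1
  unfold dd
  rw [h2.fderiv]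
  simp [linf_eb co eb ℓ hco, hco, wgrad]
  ring

lemma dd_wgrad (hco : ∀ j k, co j (eb k) = if j = k then 1 else 0)
    (j k : ι) (z : Y) : dd (eb j) (wgrad co ℓ K N p0 k) z
    = K * ℓ j * ℓ k - 4 * N * (if j = k then 1 else 0) := by
  have h0 : HasFDerivAt (fun z : Y => z - p0) (ContinuousLinearMap.id ℝ Y) z := (hasFDerivAt_id z).sub_const p0
  have hL : HasFDerivAt (fun z => linf co ℓ (z - p0)) (linf co ℓ) z := by
    exact ((linf co ℓ).hasFDerivAt (x := z - p0)).comp z h0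
  have hc : ∀ k, HasFDerivAt (fun z => co k (z - p0)) (co k) z := fun k => by
    exact ((co k).hasFDerivAt (x := z - p0)).comp z h0
  have h1 := (((hasFDerivAt_const (ℓ k) z).add ((hL.const_mul K).mul_const (ℓ k)))).sub ((hc k).const_mul (4 * N))
  have h2 : HasFDerivAt (wgrad co ℓ K N p0 k) _ z := h1
  unfold dd
  rw [h2.fderiv]
  simp [linf_eb co eb ℓ hco, hco, eq_comm]
  ring

lemma wphi_shift (hco : ∀ j k, co j (eb k) = if j = k then 1 else 0)
    (o : ι) (z : Y) (s : ℝ) : wphi co ℓ K N p0 z = wphi co ℓ K N p0 (z - s • eb o)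
    + wgrad co ℓ K N p0 o (z - s • eb o) * s + (K * (ℓ o)^2 - 4 * N) * s^2 / 2 := by
  obtain ⟨y, rfl⟩ : ∃ y, z = y + s • eb o := ⟨z - s • eb o, by simp⟩
  rw [add_sub_cancel_right]
  unfold wphi wgrad
  have h1 : y + s • eb o - p0 = (y - p0) + s • eb o := by abel
  rw [h1]
  generalize y - p0 = y
  simp only [map_add, map_smul, linf_eb co eb ℓ hco, hco, smul_eq_mul]
  have h2 : ∑ j, (co j y + s * (if j = o then 1 else 0))^2 = ∑ j, (co j y)^2 + 2 * s * co o y + s^2 := by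
    have : ∀ j, (co j y + s * (if j = o then 1 else 0))^2 = (co j y)^2 + (if j = o then 2 * s * co j y + s^2 else 0) := by
      intro j; split_ifs <;> ring
    simp_rw [this, Finset.sum_add_distrib]
    simp; ring
  rw [h2]; ring

lemma wphi_neg {N K : ℝ} (hN : 0 < N) {z : Y} (h1 : |K * linf co ℓ (z - p0)| ≤ 1/2)
    (h2 : linf co ℓ (z - p0) ≤ N * ∑ j, (co j (z - p0))^2) :
    wphi co ℓ K N p0 z ≤ - (N / 2) * ∑ j, (co j (z - p0))^2 := by
  unfold wphi
  have h3 : 0 ≤ ∑ j, (co j (z - p0))^2 := Finset.sum_nonneg fun j _ => sq_nonneg _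
  generalize (∑ j, (co j (z - p0))^2) = S at *
  generalize linf co ℓ (z - p0) = L at *
  rw [abs_le] at h1
  have h4 : 0 ≤ N * S := by positivity
  have e : L + K / 2 * L^2 = L * (1 + K * L / 2) := by ring
  rw [e]
  rcases le_total L 0 with hL | hL
  · have : L * (1 + K * L / 2) ≤ 0 := mul_nonpos_of_nonpos_of_nonneg hL (by linarith)
    linarith
  · have : L * (1 + K * L / 2) ≤ L * (5 / 4) := by gcongr; linarith
    linarith
end Weight

open MeasureTheory

section LocalUC
variable {n : ℕ} {ι : Type*} [Fintype ι] [DecidableEq ι]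

local notation "E" => EuclideanSpace ℝ (Fin n)
local notation "Z" => ℝ × EuclideanSpace ℝ (Fin n)
local notation "μZ" => Measure.prod (volume : Measure ℝ) (volume : Measure (EuclideanSpace ℝ (Fin n)))

lemma dd_congr {e : Z} {f g : Z → ℝ} {z : Z} (h : f =ᶠ[nhds z] g) : dd e f =ᶠ[nhds z] dd e g := by
  filter_upwards [h.fderiv (𝕜 := ℝ)] with w hw
  unfold dd; rw [hw]

/-- Local unique continuation across a quadratic hypersurface. -/
lemma local_uc (e : ι → Z) (co : ι → Z →L[ℝ] ℝ) (hco : ∀ j k, co j (e k) = if j = k then 1 else 0)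
    (o : ι) (heo : e o = ((1:ℝ), (0:E))) (hnorm : ∀ y : Z, ‖y‖^2 ≤ ∑ j, (co j y)^2)
    (ε : ι → Z → ℝ) (hε : ∀ j, ContDiff ℝ 1 (ε j)) (hεd : ∀ j z, dd (e j) (ε j) z = 0)
    (hε1 : ∀ j ≠ o, ∀ z, ε j z = 1) (hεt : ∀ j z (s : ℝ), ε j (z - s • e o) = ε j z)
    (u : Z → ℝ) (hu : ContDiff ℝ 2 u) (hPDE : ∀ z, ∑ j, ε j z * dd (e j) (dd (e j) u) z = 0)
    (ℓ : ι → ℝ) {N r0 : ℝ} (hN : 0 < N) (hr0 : 0 < r0) (p0 : Z)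
    (hpos : 0 < ∑ j, ε j p0 * (ℓ j)^2)
    (hz : ∀ z, ‖z - p0‖ < r0 → N * ∑ j, (co j (z - p0))^2 < linf co ℓ (z - p0) → u z = 0) :
    ∀ᶠ z in nhds p0, u z = 0 := by
  set m0 := ∑ j, ε j p0 * (ℓ j)^2 with hm0
  set C0 : ℝ := 1 + ∑ j, |ε j p0| + ∑ j, |ℓ j| + ∑ j, ∑ k, |dd (e j) (ε k) p0| with hC0d
  have a1 : 0 ≤ ∑ j, |ε j p0| := Finset.sum_nonneg fun _ _ => abs_nonneg _
  have a2 : 0 ≤ ∑ j, |ℓ j| := Finset.sum_nonneg fun _ _ => abs_nonneg _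
  have a3 : 0 ≤ ∑ j, ∑ k, |dd (e j) (ε k) p0| :=
    Finset.sum_nonneg fun _ _ => Finset.sum_nonneg fun _ _ => abs_nonneg _
  have b1 : ∀ j, |ε j p0| < C0 := fun j => by
    have := Finset.single_le_sum (f := fun j => |ε j p0|) (fun _ _ => abs_nonneg _) (Finset.mem_univ j)
    linarith
  have b2 : ∀ j, |ℓ j| < C0 := fun j => by
    have := Finset.single_le_sum (f := fun j => |ℓ j|) (fun _ _ => abs_nonneg _) (Finset.mem_univ j)
    linarith
  have b3 : ∀ j k, |dd (e j) (ε k) p0| < C0 := fun j k => by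
    have h1 := Finset.single_le_sum (f := fun j => ∑ k, |dd (e j) (ε k) p0|)
      (fun _ _ => Finset.sum_nonneg fun _ _ => abs_nonneg _) (Finset.mem_univ j)
    have h2 := Finset.single_le_sum (f := fun k => |dd (e j) (ε k) p0|) (fun _ _ => abs_nonneg _) (Finset.mem_univ k)
    linarith
  have hC0 : 0 < C0 := by linarith
  obtain ⟨C, hC, hcar⟩ := carleman_ineq μZ e ℓ o N C0 (m0 / 2) hN.le hC0.le (by linarith)
  set K := (C + 8 * C * C0^2 + 1) / (4 * (m0 / 2)^2) with hK
  have hK0 : 0 < K := by positivity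
  have hKM : 4 * K * (m0 / 2)^2 - C = 8 * C * C0^2 + 1 := by
    rw [hK]; field_simp; ring
  obtain ⟨τ0, -, hcar⟩ := hcar K hK0.le
  have hgC : ∀ j, ContDiff ℝ 1 (wgrad co ℓ K N p0 j) := fun j => wgrad_contDiff _ _ _ _ _ j
  have hdg := dd_wgrad co e ℓ K N p0 hco
  have hcar := hcar ε (wgrad co ℓ K N p0) hε hgC hεd hε1 hdg
  -- local bounds
  have hg0 : ∀ j, wgrad co ℓ K N p0 j p0 = ℓ j := fun j => by simp [wgrad]
  have ev : ∀ᶠ z in nhds p0, (∀ j, |ε j z| < C0) ∧ (∀ j, |wgrad co ℓ K N p0 j z| < C0)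
      ∧ (∀ j k, |dd (e j) (ε k) z| < C0) ∧ m0 / 2 < ∑ j, ℓ j * (ε j z * wgrad co ℓ K N p0 j z)
      ∧ |K * linf co ℓ (z - p0)| < 1 / 2 := by
    have cε : ∀ j, Continuous (ε j) := fun j => (hε j).continuous
    have cg : ∀ j, Continuous (wgrad co ℓ K N p0 j) := fun j => (hgC j).continuous
    have cd : ∀ j k, Continuous (dd (e j) (ε k)) := fun j k => continuous_dd (hε k)
    refine (Filter.eventually_all.2 fun j => ?_).and ((Filter.eventually_all.2 fun j => ?_).and
      ((Filter.eventually_all.2 fun j => Filter.eventually_all.2 fun k => ?_).and (Filter.Eventually.and ?_ ?_)))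
    · exact (cε j).abs.continuousAt.eventually_lt continuousAt_const (b1 j)
    · refine (cg j).abs.continuousAt.eventually_lt continuousAt_const ?_
      rw [hg0]; exact b2 j
    · exact (cd j k).abs.continuousAt.eventually_lt continuousAt_const (b3 j k)
    · have : Continuous fun z => ∑ j, ℓ j * (ε j z * wgrad co ℓ K N p0 j z) := by fun_prop
      refine continuousAt_const.eventually_lt this.continuousAt ?_
      have h1 : ∑ j, ℓ j * (ε j p0 * wgrad co ℓ K N p0 j p0) = m0 :=
        Finset.sum_congr rfl fun j _ => by rw [hg0]; ring
      rw [h1]; linarith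
    · have : Continuous fun z => |K * linf co ℓ (z - p0)| := by fun_prop
      refine this.continuousAt.eventually_lt continuousAt_const ?_
      simp
  obtain ⟨R1, hR1, hball⟩ := Metric.eventually_nhds_iff.1 ev
  set R := min R1 r0 with hR
  have hR0 : 0 < R := lt_min hR1 hr0
  set σ := R / 4 with hσd
  have hσ : 0 < σ := by positivity
  have hb : ∀ z, ‖z - p0‖ ≤ 3 * σ → (∀ j, |ε j z| < C0) ∧ (∀ j, |wgrad co ℓ K N p0 j z| < C0)
      ∧ (∀ j k, |dd (e j) (ε k) z| < C0) ∧ m0 / 2 < ∑ j, ℓ j * (ε j z * wgrad co ℓ K N p0 j z)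
      ∧ |K * linf co ℓ (z - p0)| < 1 / 2 := by
    intro z hzz
    apply hball
    rw [dist_eq_norm]
    have : R ≤ R1 := min_le_left _ _
    linarith
  have hQ : ∀ z ∈ Qbox p0.1 p0.2 σ, ‖z - p0‖ ≤ 3 * σ := by
    rintro z ⟨h1, h2⟩
    rw [Metric.mem_closedBall, dist_eq_norm] at h1 h2
    rw [Prod.norm_def]
    exact max_le h1 (by change ‖z.2 - p0.2‖ ≤ _; linarith)
  -- cutoffs
  let χb : ContDiffBump p0 := ⟨σ / 2, σ, by positivity, by linarith⟩
  let χ : ContDiffBump p0.1 := ⟨2 * σ, 3 * σ, by positivity, by linarith⟩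
  set f : Z → ℝ := fun z => χb z * u z with hfd
  have hf : ContDiff ℝ 2 f := χb.contDiff.mul hu
  have hts : ∀ z ∈ tsupport f, ‖z - p0‖ ≤ σ ∧ linf co ℓ (z - p0) ≤ N * ∑ j, (co j (z - p0))^2 := by
    have hcl : IsClosed {z : Z | ‖z - p0‖ ≤ σ ∧ linf co ℓ (z - p0) ≤ N * ∑ j, (co j (z - p0))^2} := by
      rw [Set.setOf_and]
      exact (isClosed_le (by fun_prop) continuous_const).inter (isClosed_le (by fun_prop) (by fun_prop))
    refine closure_minimal ?_ hcl
    intro z hzz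
    have h1 : χb z * u z ≠ 0 := hzz
    have h2 : ‖z - p0‖ < σ := by
      by_contra hcon
      apply h1
      rw [χb.zero_of_le_dist (by rw [dist_eq_norm]; exact not_lt.1 hcon), zero_mul]
    refine ⟨h2.le, ?_⟩
    by_contra hcon
    apply h1
    rw [hz z (h2.trans_le (by have : R ≤ r0 := min_le_right _ _
                              linarith)) (not_le.1 hcon), mul_zero]
  have hφneg : ∀ z ∈ tsupport f, wphi co ℓ K N p0 z ≤ - (N / 2) * ∑ j, (co j (z - p0))^2 := by
    intro z hzz
    obtain ⟨h1, h2⟩ := hts z hzz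
    exact wphi_neg co ℓ p0 hN (hb z (by linarith)).2.2.2.2.le h2
  set η := N * σ^2 / 8 with hη
  have hη0 : 0 < η := by positivity
  set μ' := 2 * C0^2 / η + 4 * N + 1 with hμ
  have hμ0 : 0 < μ' := by positivity
  have hη2 : C0^2 / μ' ≤ η / 2 := by
    rw [div_le_iff₀ hμ0, hμ]
    have : η / 2 * (2 * C0^2 / η + 4 * N + 1) = C0^2 + η / 2 * (4 * N + 1) := by
      field_simp
      ring
    rw [this]
    have : 0 ≤ η / 2 * (4 * N + 1) := by positivity
    linarith
  have hη1 : C0^2 / μ' + η / 2 ≤ μ' * σ^2 / 16 := by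
    have h1 : 4 * N ≤ μ' := by
      have : 0 ≤ 2 * C0^2 / η := by positivity
      linarith
    have h2 : 4 * N * σ^2 ≤ μ' * σ^2 := by gcongr
    have h3 : 4 * N * σ^2 = 32 * η := by rw [hη]; ring
    linarith
  obtain ⟨A, b, τ1, hb0, -, hdec⟩ := main_decay e o heo ε (wgrad co ℓ K N p0)
    (fun j k => K * ℓ j * ℓ k - 4 * N * (if j = k then 1 else 0)) (wphi co ℓ K N p0) f χ
    (C := C) (M := 4 * K * (m0 / 2)^2 - C) (τ0 := τ0) (v := C0) (C0 := C0) (σ := σ) (η := η) (μ' := μ')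
    (κ := K * (ℓ o)^2 - 4 * N) (γ := μ' + (K * (ℓ o)^2 - 4 * N)) (t0 := p0.1) (x0 := p0.2)
    hC hKM.ge
    (by
      intro τ hτ w hw hwc hws
      apply hcar τ hτ w hw hwc
      intro z hzz
      obtain ⟨h1, h2, h3, h4, -⟩ := hb z (hQ z (hws hzz))
      exact ⟨fun j => (h1 j).le, fun j => (h2 j).le, fun j k => (h3 j k).le, h4.le⟩)
    (wphi_contDiff _ _ _ _ _) hgC (dd_wphi co e ℓ K N p0 hco) (fun j z => hdg j j z)
    (wphi_shift co e ℓ K N p0 hco o) (fun j => (hε j).continuous) hεt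
    (fun j z hzz => ((hb z (hQ z hzz)).1 j).le) hC0.le hf
    (by
      intro z hzz
      have h1 := (hts z hzz).1
      rw [Prod.norm_def] at h1
      refine ⟨(le_max_left _ _).trans h1, ?_, ?_, ((hb z (by have := (hts z hzz).1; linarith)).2.1 o).le⟩
      · rw [Metric.mem_closedBall, dist_eq_norm]; exact (le_max_right _ _).trans h1
      · refine (hφneg z hzz).trans ?_
        have : 0 ≤ ∑ j, (co j (z - p0))^2 := Finset.sum_nonneg fun _ _ => sq_nonneg _
        have : 0 ≤ N / 2 * ∑ j, (co j (z - p0))^2 := by positivity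
        linarith)
    (by
      intro z hF
      have hzs : z ∈ tsupport f := by
        by_contra hcon
        exact hF (Finset.sum_eq_zero fun j _ => by rw [dd2_zero_of_notMem hcon, mul_zero])
      have hzn : σ / 2 ≤ ‖z - p0‖ := by
        by_contra hcon
        apply hF
        rw [← hPDE z]
        have hfu : f =ᶠ[nhds z] u := by
          have : ∀ᶠ w in nhds z, ‖w - p0‖ < σ / 2 :=
            ContinuousAt.eventually_lt (by fun_prop) continuousAt_const (not_le.1 hcon)
          filter_upwards [this] with w hw
          have : χb w = 1 := χb.one_of_mem_closedBall (by
            rw [Metric.mem_closedBall, dist_eq_norm]; exact hw.le)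
          rw [hfd]; simp only; rw [this, one_mul]
        refine Finset.sum_congr rfl fun j _ => ?_
        rw [(dd_congr (e := e j) (dd_congr (e := e j) hfu)).eq_of_nhds]
      refine (hφneg z hzs).trans ?_
      have h1 := hnorm (z - p0)
      have h2 : (σ / 2)^2 ≤ ‖z - p0‖^2 := by gcongr
      have h3 : N / 2 * (σ / 2)^2 ≤ N / 2 * ∑ j, (co j (z - p0))^2 := by gcongr; linarith
      have h4 : N / 2 * (σ / 2)^2 = η := by rw [hη]; ring
      linarith)
    χ.contDiff
    (fun t => by rw [abs_of_nonneg χ.nonneg]; exact χ.le_one)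
    (fun t ht => χ.one_of_mem_closedBall (by rw [Metric.mem_closedBall, Real.dist_eq]; exact ht))
    (fun t ht => χ.zero_of_le_dist (by rw [Real.dist_eq]; exact ht.le))
    hμ0 rfl
    (by
      have : 0 ≤ 2 * C0^2 / η := by positivity
      have : 0 ≤ K * (ℓ o)^2 := by positivity
      rw [hμ]; linarith)
    hC0 hσ hη0 hη1 hη2
  have hφ0 : wphi co ℓ K N p0 p0 = 0 := by simp [wphi]
  have hφc : Continuous (wphi co ℓ K N p0) := (wphi_contDiff (m := 0) co ℓ K N p0).continuous
  have e1 : ∀ᶠ z in nhds p0, -b / 8 < wphi co ℓ K N p0 z :=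
    continuousAt_const.eventually_lt hφc.continuousAt (by rw [hφ0]; linarith)
  have e2 : ∀ᶠ z : Z in nhds p0, |z.1 - p0.1| < 2 * σ :=
    ContinuousAt.eventually_lt (by fun_prop) continuousAt_const (by simpa using hσ)
  have e3 : ∀ᶠ z in nhds p0, ‖z - p0‖ < σ / 2 :=
    ContinuousAt.eventually_lt (by fun_prop) continuousAt_const (by simpa using hσ)
  have hfc : HasCompactSupport f := by
    refine (Qbox_compact p0.1 p0.2 σ).of_isClosed_subset (isClosed_tsupport f) fun z hzz => ?_
    have h1 := (hts z hzz).1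
    rw [Prod.norm_def] at h1
    refine ⟨?_, ?_⟩
    · rw [Metric.mem_closedBall, dist_eq_norm]; exact ((le_max_left _ _).trans h1).trans (by linarith)
    · rw [Metric.mem_closedBall, dist_eq_norm]; exact (le_max_right _ _).trans h1
  filter_upwards [e1, e2, e3] with z h1 h2 h3
  have hfz : f z = 0 := by
    refine decay_vanish (e o) hb0 ?_ hf hfc hφc z (χ := χ) ?_ h1 hdec
    · have : 0 ≤ 2 * C0^2 / η := by positivity
      have : 0 ≤ K * (ℓ o)^2 := by positivity
      rw [hμ]; linarith
    · have : ∀ᶠ w : Z in nhds z, |w.1 - p0.1| < 2 * σ :=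
        ContinuousAt.eventually_lt (by fun_prop) continuousAt_const h2
      filter_upwards [this] with w hw
      exact χ.one_of_mem_closedBall (by rw [Metric.mem_closedBall, Real.dist_eq]; exact hw.le)
  have : χb z = 1 := χb.one_of_mem_closedBall (by rw [Metric.mem_closedBall, dist_eq_norm]; exact h3.le)
  rw [hfd] at hfz; simp only at hfz
  rwa [this, one_mul] at hfz
end LocalUC

open MeasureTheory

section Concrete
variable {n : ℕ}

local notation "E" => EuclideanSpace ℝ (Fin n)
local notation "Z" => ℝ × EuclideanSpace ℝ (Fin n)

/-- basis of space-time -/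
noncomputable def ebz (n : ℕ) : Option (Fin n) → ℝ × EuclideanSpace ℝ (Fin n)
  | none => (1, 0)
  | some i => (0, EuclideanSpace.single i 1)

/-- coordinates of space-time -/
noncomputable def cobz (n : ℕ) : Option (Fin n) → (ℝ × EuclideanSpace ℝ (Fin n)) →L[ℝ] ℝ
  | none => ContinuousLinearMap.fst ℝ ℝ _
  | some i => (EuclideanSpace.proj i).comp (ContinuousLinearMap.snd ℝ ℝ _)

/-- principal coefficients -/
noncomputable def epz (c : E → ℝ) : Option (Fin n) → Z → ℝ
  | none => fun z => - ((c z.2)^2)⁻¹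
  | some _ => fun _ => 1

lemma wave_uc_quad {c : E → ℝ} (hc : ContDiff ℝ 1 c) (hcpos : ∀ x, 0 < c x) {u : Z → ℝ} (hu : ContDiff ℝ 2 u)
    (hPDE : ∀ z : Z, - ((c z.2)^2)⁻¹ * dd ((1:ℝ), (0:E)) (dd ((1:ℝ), (0:E)) u) z
      + ∑ i, dd ((0:ℝ), (EuclideanSpace.single i 1 : E)) (dd ((0:ℝ), (EuclideanSpace.single i 1 : E)) u) z = 0)
    {v : ℝ} {ω : E} {p0 : Z} {N r0 : ℝ} (hN : 0 < N) (hr0 : 0 < r0)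
    (hpos : ((c p0.2)^2)⁻¹ * v^2 < ‖ω‖^2)
    (hz : ∀ z : Z, ‖z - p0‖ < r0 → N * ((z.1 - p0.1)^2 + ‖z.2 - p0.2‖^2) < v * (z.1 - p0.1) + inner ℝ ω (z.2 - p0.2) → u z = 0) :
    ∀ᶠ z in nhds p0, u z = 0 := by
  have hsum : ∀ y : Z, ∑ j, (cobz n j y)^2 = y.1^2 + ‖y.2‖^2 := by
    intro y
    rw [Fintype.sum_option, EuclideanSpace.real_norm_sq_eq]
    simp [cobz]
  have hlin : ∀ y : Z, linf (cobz n) (fun j : Option (Fin n) => j.elim v (fun i => ω i)) y = v * y.1 + inner ℝ ω y.2 := by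
    intro y
    simp only [linf, Fintype.sum_option]
    simp [cobz, PiLp.inner_apply, mul_comm]
  have hεc : ContDiff ℝ 1 (epz c none) := by
    unfold epz
    have : ContDiff ℝ 1 (fun z : Z => (c z.2)^2) := (hc.comp contDiff_snd).pow 2
    exact (this.inv fun z => (pow_pos (hcpos _) 2).ne').neg
  refine local_uc (ebz n) (cobz n) ?_ none rfl ?_ (epz c) ?_ ?_ ?_ ?_ u hu ?_
    (fun j : Option (Fin n) => j.elim v (fun i => ω i)) hN hr0 p0 ?_ ?_
  · rintro (_ | i) (_ | k) <;> simp [ebz, cobz]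
  · intro y
    rw [hsum, Prod.norm_def]
    rcases max_cases ‖y.1‖ ‖y.2‖ with h | h <;> rw [h.1]
    · simp
    · nlinarith [sq_nonneg y.1]
  · rintro (_ | i)
    · exact hεc
    · exact contDiff_const
  · rintro (_ | i) z
    · rw [show ebz n none = ((1:ℝ), (0:E)) from rfl, ← Prod.mk.eta (p := z),
        dd_line (hεc.differentiable (by norm_num))]
      simp [epz]
    · exact dd_const _ _
  · rintro (_ | i) h z
    · exact absurd rfl h
    · rfl
  · rintro (_ | i) z s
    · simp [epz, ebz]
    · rfl
  · intro z
    rw [← hPDE z, Fintype.sum_option]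
    simp [epz, ebz]
  · rw [Fintype.sum_option]
    simp only [Option.elim, epz, one_mul]
    rw [EuclideanSpace.real_norm_sq_eq] at hpos
    linarith
  · intro z h1 h2
    rw [hsum, hlin] at h2
    exact hz z h1 h2

/-- the open vanishing set -/
def zset (u : Z → ℝ) : Set Z := interior {z | u z = 0}

lemma zset_zero {u : Z → ℝ} {z : Z} (h : z ∈ zset u) : u z = 0 := by
  have : z ∈ {z | u z = 0} := interior_subset h
  exact this

lemma amgm_aux {q A : ℝ} (hq : 0 < q) : A ≤ (q^2 + A^2) / (2 * q) := by
  rw [le_div_iff₀ (by positivity)]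
  nlinarith [sq_nonneg (A - q)]

lemma step_uc {c : E → ℝ} (hc : ContDiff ℝ 1 c) (hcpos : ∀ x, 0 < c x) {u : Z → ℝ} (hu : ContDiff ℝ 2 u)
    (hPDE : ∀ z : Z, - ((c z.2)^2)⁻¹ * dd ((1:ℝ), (0:E)) (dd ((1:ℝ), (0:E)) u) z
      + ∑ i, dd ((0:ℝ), (EuclideanSpace.single i 1 : E)) (dd ((0:ℝ), (EuclideanSpace.single i 1 : E)) u) z = 0)
    {L r T t : ℝ} {x y : E} (hL : 0 < L) (hLc : ∀ x', ‖x' - y‖ < r → 1 < L * c x')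
    (hT : ∀ s, |s| ≤ T → (s, y) ∈ zset u) (hxr : ‖x - y‖ < r) (ht : |t| + L * ‖x - y‖ < T) :
    (t, x) ∈ zset u := by
  by_contra hq
  obtain ⟨s, hs1, hs2⟩ : ∃ s, L * ‖x - y‖ < s ∧ s < min (T - |t|) (L * r) :=
    exists_between (lt_min (by linarith) (by gcongr))
  have hs3 : s < T - |t| := hs2.trans_le (min_le_left _ _)
  have hs4 : s < L * r := hs2.trans_le (min_le_right _ _)
  set δ := (s - L * ‖x - y‖) / 2 with hδ
  have hδ0 : 0 < δ := by rw [hδ]; linarith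
  set Θ : Z → ℝ := fun z => √((z.1 - t)^2 + δ^2) + L * ‖z.2 - y‖ with hΘ
  have hΘc : Continuous Θ := by rw [hΘ]; fun_prop
  have hΘq : Θ (t, x) < s := by
    simp only [hΘ, sub_self]
    rw [show (0:ℝ)^2 + δ^2 = δ^2 by ring, Real.sqrt_sq hδ0.le]
    linarith
  have hb1 : ∀ z, Θ z ≤ Θ (t, x) → |z.1 - t| < s ∧ L * ‖z.2 - y‖ < s := by
    intro z hz
    have h1 : |z.1 - t| ≤ √((z.1 - t)^2 + δ^2) := Real.abs_le_sqrt (by nlinarith)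
    have h2 : 0 ≤ L * ‖z.2 - y‖ := by positivity
    have h3 : 0 ≤ |z.1 - t| := abs_nonneg _
    have h4 : Θ z = √((z.1 - t)^2 + δ^2) + L * ‖z.2 - y‖ := rfl
    constructor <;> linarith
  set S : Set Z := (zset u)ᶜ ∩ {z | Θ z ≤ Θ (t, x)} with hS
  have hSc : IsCompact S := by
    refine ((isCompact_closedBall t s).prod (isCompact_closedBall y (s / L))).of_isClosed_subset
      (isOpen_interior.isClosed_compl.inter (isClosed_le hΘc continuous_const)) ?_
    rintro z ⟨-, hz⟩
    obtain ⟨h1, h2⟩ := hb1 z hz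
    refine ⟨?_, ?_⟩
    · rw [Metric.mem_closedBall, Real.dist_eq]; exact h1.le
    · rw [Metric.mem_closedBall, dist_eq_norm, le_div_iff₀ hL]; linarith
  obtain ⟨p1, hp1S, hmin⟩ := hSc.exists_isMinOn ⟨(t, x), hq, le_refl (Θ (t, x))⟩ hΘc.continuousOn
  obtain ⟨h1, h2⟩ := hb1 p1 hp1S.2
  have hne : p1.2 - y ≠ 0 := by
    intro h0
    apply hp1S.1
    have : p1 = (p1.1, y) := by rw [← sub_eq_zero.1 h0]
    rw [this]
    apply hT
    have : |p1.1| ≤ |p1.1 - t| + |t| := by simpa using abs_add_le (p1.1 - t) t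
    linarith
  have hd0 : 0 < ‖p1.2 - y‖ := norm_pos_iff.2 hne
  have hlt : ∀ z, Θ z < Θ p1 → u z = 0 := by
    intro z hz
    by_contra hcon
    have hzS : z ∈ S := ⟨fun h => hcon (zset_zero h), hz.le.trans hp1S.2⟩
    exact absurd (hmin hzS) (not_le.2 hz)
  have hr : ‖p1.2 - y‖ < r := lt_of_mul_lt_mul_left (h2.trans hs4) hL.le
  have hcp := hcpos p1.2
  have hLcp := hLc p1.2 hr
  set q := √((p1.1 - t)^2 + δ^2) with hqd
  have hq0 : 0 < q := Real.sqrt_pos.2 (by positivity)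
  have hqsq : q^2 = (p1.1 - t)^2 + δ^2 := Real.sq_sqrt (by positivity)
  set d := ‖p1.2 - y‖ with hd
  have hev := wave_uc_quad hc hcpos hu hPDE (v := - ((p1.1 - t) / q)) (ω := - ((L / d) • (p1.2 - y))) (p0 := p1)
    (N := 1 / (2 * q) + L / (2 * d)) (r0 := 1) (by positivity) one_pos ?_ ?_
  · apply hp1S.1
    exact mem_interior_iff_mem_nhds.2 hev
  · rw [norm_neg, norm_smul, ← hd, Real.norm_of_nonneg (by positivity), div_mul_cancel₀ _ hd0.ne', neg_sq, div_pow]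
    have h3 : (p1.1 - t)^2 / q^2 ≤ 1 := by
      rw [div_le_one (by positivity), hqsq]; nlinarith
    have h4 : ((c p1.2)^2)⁻¹ * ((p1.1 - t)^2 / q^2) ≤ ((c p1.2)^2)⁻¹ * 1 := by gcongr
    refine h4.trans_lt ?_
    rw [mul_one, inv_lt_iff_one_lt_mul₀ (by positivity)]
    nlinarith
  · intro z _ hz
    apply hlt
    set a := z.1 - p1.1 with ha
    set b := z.2 - p1.2 with hb
    have e1 : z.1 - t = (p1.1 - t) + a := by rw [ha]; ring
    have e2 : z.2 - y = (p1.2 - y) + b := by rw [hb]; abel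
    have hΘz : Θ z = √((z.1 - t)^2 + δ^2) + L * ‖z.2 - y‖ := rfl
    have hΘp : Θ p1 = q + L * d := rfl
    rw [hΘz, hΘp, e1, e2]
    have i1 : √(((p1.1 - t) + a)^2 + δ^2) ≤ q + (p1.1 - t) / q * a + 1 / (2 * q) * a^2 := by
      have hn := Real.sq_sqrt (show 0 ≤ ((p1.1 - t) + a)^2 + δ^2 by positivity)
      have : q + (p1.1 - t) / q * a + 1 / (2 * q) * a^2 = (q^2 + (((p1.1 - t) + a)^2 + δ^2)) / (2 * q) := by
        field_simp; rw [hqsq]; ring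
      rw [this]
      nth_rewrite 2 [← hn]
      exact amgm_aux hq0
    have i2 : ‖(p1.2 - y) + b‖ ≤ d + inner ℝ (p1.2 - y) b / d + 1 / (2 * d) * ‖b‖^2 := by
      have hn := norm_add_sq_real (p1.2 - y) b
      rw [← hd] at hn
      have : d + inner ℝ (p1.2 - y) b / d + 1 / (2 * d) * ‖b‖^2 = (d^2 + ‖(p1.2 - y) + b‖^2) / (2 * d) := by
        rw [hn]; field_simp; ring
      rw [this]
      exact amgm_aux hd0
    have i3 : L * ‖(p1.2 - y) + b‖ ≤ L * (d + inner ℝ (p1.2 - y) b / d + 1 / (2 * d) * ‖b‖^2) := by gcongr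
    rw [inner_neg_left, real_inner_smul_left] at hz
    have i4 : L * (d + inner ℝ (p1.2 - y) b / d + 1 / (2 * d) * ‖b‖^2) =
      L * d + L / d * inner ℝ (p1.2 - y) b + L / (2 * d) * ‖b‖^2 := by field_simp
    rw [i4] at i3
    have i5 : 0 ≤ 1 / (2 * q) * ‖b‖^2 := by positivity
    have i6 : 0 ≤ L / (2 * d) * a^2 := by positivity
    linarith
end Concrete

open MeasureTheory

section Chain
variable {n : ℕ}

local notation "E" => EuclideanSpace ℝ (Fin n)
local notation "Z" => ℝ × EuclideanSpace ℝ (Fin n)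

lemma speed_cont {c : E → ℝ} (hc : Continuous c) (hcpos : ∀ x, 0 < c x) {γ : ℝ → E} (hγ : ContDiff ℝ 1 γ) :
    Continuous fun s => ‖deriv γ s‖ / c (γ s) :=
  (hγ.continuous_deriv (by norm_num)).norm.div (hc.comp hγ.continuous) fun s => (hcpos _).ne'

lemma chain_uc {c : E → ℝ} (hc : ContDiff ℝ 1 c) (hcpos : ∀ x, 0 < c x) {u : Z → ℝ} (hu : ContDiff ℝ 2 u)
    (hPDE : ∀ z : Z, - ((c z.2)^2)⁻¹ * dd ((1:ℝ), (0:E)) (dd ((1:ℝ), (0:E)) u) z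
      + ∑ i, dd ((0:ℝ), (EuclideanSpace.single i 1 : E)) (dd ((0:ℝ), (EuclideanSpace.single i 1 : E)) u) z = 0)
    {T κ : ℝ} (hκ : 1 < κ) {γ : ℝ → E} (hγ : ContDiff ℝ 1 γ)
    (hT : ∀ s, |s| ≤ T → (s, γ 0) ∈ zset u) :
    ∀ a ∈ Set.Icc (0:ℝ) 1, ∀ t, |t| + κ * (∫ s in (0:ℝ)..a, ‖deriv γ s‖ / c (γ s)) < T → (t, γ a) ∈ zset u := by
  have hsp := speed_cont hc.continuous hcpos hγ
  have hloc : ∀ a0 : ℝ, ∃ V : Set ℝ, IsOpen V ∧ a0 ∈ V ∧ ∃ L r : ℝ, 0 < L ∧ 0 < r ∧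
      (∀ s ∈ V, ‖γ s - γ a0‖ < r / 2 ∧ L * c (γ s) < κ) ∧ ∀ x', ‖x' - γ a0‖ < 2 * r → 1 < L * c x' := by
    intro a0
    have hc0 := hcpos (γ a0)
    have hL : 0 < (1 + κ) / 2 / c (γ a0) := by positivity
    have hLc : (1 + κ) / 2 / c (γ a0) * c (γ a0) = (1 + κ) / 2 := by field_simp
    have ev : ∀ᶠ x' in nhds (γ a0), 1 < (1 + κ) / 2 / c (γ a0) * c x' :=
      continuousAt_const.eventually_lt (continuous_const.mul hc.continuous).continuousAt (by rw [hLc]; linarith)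
    obtain ⟨r, hr, hb⟩ := Metric.eventually_nhds_iff.1 ev
    refine ⟨{s | ‖γ s - γ a0‖ < (r / 2) / 2} ∩ {s | (1 + κ) / 2 / c (γ a0) * c (γ s) < κ}, ?_, ?_,
      _, r / 2, hL, by positivity, fun s hs => hs, ?_⟩
    · exact (isOpen_lt (hγ.continuous.sub continuous_const).norm continuous_const).inter
        (isOpen_lt (continuous_const.mul (hc.continuous.comp hγ.continuous)) continuous_const)
    · refine ⟨?_, ?_⟩
      · simp only [Set.mem_setOf_eq, sub_self, norm_zero]; positivity
      · simp only [Set.mem_setOf_eq]; rw [hLc]; linarith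
    · intro x' hx
      apply hb
      rw [dist_eq_norm]; linarith
  choose V hVo hV0 L r hL hr hVs hLc using hloc
  have step : ∀ a0 a b, a ≤ b → Set.Icc a b ⊆ V a0 →
      (∀ t, |t| + κ * (∫ s in (0:ℝ)..a, ‖deriv γ s‖ / c (γ s)) < T → (t, γ a) ∈ zset u) →
      (∀ t, |t| + κ * (∫ s in (0:ℝ)..b, ‖deriv γ s‖ / c (γ s)) < T → (t, γ b) ∈ zset u) := by
    intro a0 a b hab hsub ha t ht
    have i0 := intervalIntegral.integral_add_adjacent_intervals (hsp.intervalIntegrable (μ := volume) 0 a) (hsp.intervalIntegrable a b)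
    have hdc := hγ.continuous_deriv (n := 1) (by norm_num)
    have i1 : L a0 * ‖γ b - γ a‖ ≤ κ * ∫ s in a..b, ‖deriv γ s‖ / c (γ s) := by
      have j1 : γ b - γ a = ∫ s in a..b, deriv γ s :=
        (intervalIntegral.integral_deriv_eq_sub (fun s _ => (hγ.differentiable (by norm_num)) s)
          (hdc.intervalIntegrable a b)).symm
      rw [j1]
      have j2 := intervalIntegral.norm_integral_le_integral_norm (f := deriv γ) (μ := volume) hab
      have j3 : L a0 * (∫ s in a..b, ‖deriv γ s‖) ≤ κ * ∫ s in a..b, ‖deriv γ s‖ / c (γ s) := by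
        rw [← intervalIntegral.integral_const_mul, ← intervalIntegral.integral_const_mul]
        refine intervalIntegral.integral_mono_on hab ((continuous_const.mul hdc.norm).intervalIntegrable _ _)
          ((continuous_const.mul hsp).intervalIntegrable _ _) fun s hs => ?_
        have k1 := (hVs a0 s (hsub hs)).2
        have k2 := hcpos (γ s)
        rw [mul_div_assoc', le_div_iff₀ k2]
        nlinarith [norm_nonneg (deriv γ s)]
      exact (mul_le_mul_of_nonneg_left j2 (hL a0).le).trans j3
    have n1 := (hVs a0 a (hsub ⟨le_refl _, hab⟩)).1
    have n2 := (hVs a0 b (hsub ⟨hab, le_refl _⟩)).1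
    rw [← i0] at ht
    obtain ⟨T', h1, h2⟩ : ∃ T', |t| + L a0 * ‖γ b - γ a‖ < T' ∧ T' < T - κ * (∫ s in (0:ℝ)..a, ‖deriv γ s‖ / c (γ s)) :=
      exists_between (by linarith)
    refine step_uc hc hcpos hu hPDE (hL a0) (r := r a0) (T := T') (y := γ a) ?_ ?_ ?_ h1
    · intro x' hx
      apply hLc a0
      have : x' - γ a0 = (x' - γ a) + (γ a - γ a0) := by abel
      rw [this]
      refine (norm_add_le _ _).trans_lt ?_
      have := hr a0
      linarith
    · intro s hs
      apply ha; linarith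
    · have : γ b - γ a = (γ b - γ a0) - (γ a - γ a0) := by abel
      rw [this]
      refine (norm_sub_le _ _).trans_lt ?_
      linarith
  obtain ⟨τ, hτ0, hτm, ⟨m, hm⟩, hτc⟩ := exists_monotone_Icc_subset_open_cover_Icc (zero_le_one (α := ℝ))
    (c := fun a0 : ℝ => (Subtype.val ⁻¹' V a0 : Set (Set.Icc (0:ℝ) 1)))
    (fun i => (hVo i).preimage continuous_subtype_val)
    (fun a _ => Set.mem_iUnion.2 ⟨a.1, hV0 a.1⟩)
  have key : ∀ k, ∀ a ∈ Set.Icc (0:ℝ) (τ k), ∀ t,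
      |t| + κ * (∫ s in (0:ℝ)..a, ‖deriv γ s‖ / c (γ s)) < T → (t, γ a) ∈ zset u := by
    intro k
    induction k with
    | zero =>
      intro a ha t ht
      rw [hτ0] at ha
      have : a = 0 := le_antisymm ha.2 ha.1
      subst this
      simp at ht
      exact hT t ht.le
    | succ k ih =>
      intro a ha
      rcases le_total a (τ k) with h | h
      · exact ih a ⟨ha.1, h⟩
      · obtain ⟨i, hi⟩ := hτc k
        refine step i (τ k) a h ?_ (ih _ ⟨(τ k).2.1, le_refl _⟩)
        intro s hs
        have hs1 : s ∈ Set.Icc (0:ℝ) 1 := ⟨(τ k).2.1.trans hs.1, hs.2.trans (ha.2.trans (τ (k+1)).2.2)⟩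
        exact hi (a := ⟨s, hs1⟩) ⟨hs.1, hs.2.trans ha.2⟩
  intro a ha
  apply key m
  rw [hm m (le_refl _)]; exact ha

lemma pde_translate {c : E → ℝ} (hcpos : ∀ x, 0 < c x) {u : ℝ → E → ℝ}
    (hu : ContDiff ℝ 2 (fun p : Z => u p.1 p.2))
    (hPDE : ∀ (t : ℝ) (x : E), deriv (fun s => deriv (fun r => u r x) s) t - (c x) ^ 2 * euclLap n (u t) x = 0) (z : Z) :
    - ((c z.2)^2)⁻¹ * dd ((1:ℝ), (0:E)) (dd ((1:ℝ), (0:E)) (fun p : Z => u p.1 p.2)) z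
      + ∑ i, dd ((0:ℝ), (EuclideanSpace.single i 1 : E)) (dd ((0:ℝ), (EuclideanSpace.single i 1 : E)) (fun p : Z => u p.1 p.2)) z = 0 := by
  obtain ⟨t, x⟩ := z
  have hdx : ∀ (e : E) {h : Z → ℝ} (_ : Differentiable ℝ h) (t : ℝ) (x : E),
      dd ((0:ℝ), e) h (t, x) = fderiv ℝ (fun y => h (t, y)) x e := by
    intro e h hh t x
    have h1 : HasFDerivAt (fun y : E => (t, y)) (ContinuousLinearMap.inr ℝ ℝ E) x := hasFDerivAt_prodMk_right t x
    have h2 := (hh (t, x)).hasFDerivAt.comp x h1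
    have h3 : fderiv ℝ (fun y => h (t, y)) x = _ := h2.fderiv
    rw [h3]; simp [dd]
  have hd : Differentiable ℝ (fun p : Z => u p.1 p.2) := hu.differentiable (by norm_num)
  have hd1 : ∀ e, Differentiable ℝ (dd e (fun p : Z => u p.1 p.2)) := fun e => (contDiff1_dd hu).differentiable (by norm_num)
  have e1 : dd ((1:ℝ), (0:E)) (dd ((1:ℝ), (0:E)) (fun p : Z => u p.1 p.2)) (t, x) = deriv (fun s => deriv (fun r => u r x) s) t := by
    rw [dd_line (hd1 _)]
    simp_rw [dd_line hd]
  have e2 : ∑ i, dd ((0:ℝ), (EuclideanSpace.single i 1 : E)) (dd ((0:ℝ), (EuclideanSpace.single i 1 : E)) (fun p : Z => u p.1 p.2)) (t, x)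
      = euclLap n (u t) x := by
    unfold euclLap
    refine Finset.sum_congr rfl fun i _ => ?_
    rw [hdx _ (hd1 _)]
    simp_rw [hdx _ hd]
  rw [e1, e2]
  have := hPDE t x
  have hc := hcpos x
  have h3 : deriv (fun s => deriv (fun r => u r x) s) t = (c x)^2 * euclLap n (u t) x := by linarith
  rw [h3]
  simp only
  field_simp
  ring
end Chain

/-- Unique continuation for the wave equation (Tataru–John form): a solution of
`(∂_t² - c²Δ)u = 0` vanishing in a neighborhood of `[-T,T] × {x₀}` vanishes on the
double light cone `{|t| + dist(x₀,x) ≤ T}` of the metric `c⁻²dx²`. -/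
theorem unique_continuation_wave
    (n : ℕ) (c : EuclideanSpace ℝ (Fin n) → ℝ)
    (hc : ContDiff ℝ (⊤ : ℕ∞) c) (c₀ : ℝ) (hc₀ : 0 < c₀) (hcge : ∀ x, c₀ ≤ c x)
    (u : ℝ → EuclideanSpace ℝ (Fin n) → ℝ)
    (hu : ContDiff ℝ 2 (fun p : ℝ × EuclideanSpace ℝ (Fin n) => u p.1 p.2))
    (hPDE : ∀ (t : ℝ) (x : EuclideanSpace ℝ (Fin n)),
      deriv (fun s => deriv (fun r => u r x) s) t
        - (c x) ^ 2 * euclLap n (u t) x = 0)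
    (T : ℝ) (hT : 0 < T) (x₀ : EuclideanSpace ℝ (Fin n))
    (hvanish : ∃ U : Set (ℝ × EuclideanSpace ℝ (Fin n)), IsOpen U ∧
      (Set.Icc (-T) T ×ˢ ({x₀} : Set (EuclideanSpace ℝ (Fin n)))) ⊆ U ∧
      ∀ p ∈ U, u p.1 p.2 = 0) :
    ∀ (t : ℝ) (x : EuclideanSpace ℝ (Fin n)),
      |t| + soundDist n c x₀ x ≤ T → u t x = 0 := by
  have hcpos : ∀ x, 0 < c x := fun x => hc₀.trans_le (hcge x)
  have hc1 : ContDiff ℝ 1 c := hc.of_le (by exact_mod_cast le_top)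
  have hP := pde_translate hcpos hu hPDE
  set w : ℝ × EuclideanSpace ℝ (Fin n) → ℝ := fun p => u p.1 p.2 with hw
  have hseg : ∀ s, |s| ≤ T → (s, x₀) ∈ zset w := by
    obtain ⟨U, hU, hsub, h0⟩ := hvanish
    intro s hs
    exact mem_interior.2 ⟨U, fun p hp => h0 p hp, hU, hsub ⟨abs_le.1 hs, rfl⟩⟩
  have hchain : ∀ γ : ℝ → EuclideanSpace ℝ (Fin n), ContDiff ℝ 1 γ → γ 0 = x₀ → ∀ a ∈ Set.Icc (0:ℝ) 1, ∀ t,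
      |t| + (∫ s in (0:ℝ)..a, ‖deriv γ s‖ / c (γ s)) < T → u t (γ a) = 0 := by
    intro γ hγ h0 a ha t ht
    have hΛ : 0 ≤ ∫ s in (0:ℝ)..a, ‖deriv γ s‖ / c (γ s) :=
      intervalIntegral.integral_nonneg ha.1 fun s _ => div_nonneg (norm_nonneg _) (hcpos _).le
    set Λ := ∫ s in (0:ℝ)..a, ‖deriv γ s‖ / c (γ s) with hΛd
    have hgap : 0 < T - |t| - Λ := by linarith
    have hκ : 1 < 1 + (T - |t| - Λ) / (2 * (Λ + 1)) := by
      have : 0 < (T - |t| - Λ) / (2 * (Λ + 1)) := by positivity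
      linarith
    have h1 := chain_uc hc1 hcpos hu hP hκ hγ (T := T) (by rw [h0]; exact hseg) a ha t (by
      rw [← hΛd]
      have : (T - |t| - Λ) / (2 * (Λ + 1)) * Λ ≤ (T - |t| - Λ) / 2 := by
        rw [div_mul_eq_mul_div, div_le_div_iff₀ (by positivity) (by positivity)]
        nlinarith
      linarith)
    exact zset_zero h1
  have hlt : ∀ t x, |t| + soundDist n c x₀ x < T → u t x = 0 := by
    intro t x htx
    obtain ⟨Λ, ⟨γ, hγ, h0, h1, rfl⟩, hlt⟩ := exists_lt_of_csInf_lt (s := {L : ℝ | ∃ γ : ℝ → EuclideanSpace ℝ (Fin n), ContDiff ℝ 1 γ ∧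
      γ 0 = x₀ ∧ γ 1 = x ∧ L = ∫ t in (0:ℝ)..1, ‖deriv γ t‖ / c (γ t)}) (b := T - |t|)
      ⟨_, fun s => x₀ + s • (x - x₀), by fun_prop, by simp, by simp, rfl⟩ (by
        unfold soundDist at htx; linarith)
    have := hchain γ hγ h0 1 ⟨zero_le_one, le_refl _⟩ t (by linarith)
    rwa [h1] at this
  have hwc : Continuous w := hu.continuous
  intro t x htx
  rcases htx.lt_or_eq with h | h
  · exact hlt t x h
  by_cases ht : t = 0
  · subst ht
    rw [abs_zero, zero_add] at h
    by_contra hne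
    have ev : ∀ᶠ y in nhds x, u 0 y ≠ 0 := by
      have : Continuous fun y => u 0 y := hwc.comp (Continuous.prodMk_right 0)
      exact this.continuousAt.eventually_ne hne
    obtain ⟨δ, hδ, hball⟩ := Metric.eventually_nhds_iff.1 ev
    let ψ : ContDiffBump x := ⟨δ / 2, δ, by positivity, by linarith⟩
    have hψ1 : ContDiff ℝ 1 ψ := ψ.contDiff
    obtain ⟨B, hB⟩ : ∃ B, ∀ y, ‖fderiv ℝ ψ y‖ * c y ≤ B := by
      have h1 : Continuous fun y => ‖fderiv ℝ ψ y‖ * c y := (hψ1.continuous_fderiv (by norm_num)).norm.mul hc.continuous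
      have h2 : HasCompactSupport fun y => ‖fderiv ℝ ψ y‖ * c y := (ψ.hasCompactSupport.fderiv ℝ).norm.mul_right
      obtain ⟨B, hB⟩ := h2.exists_bound_of_continuous h1
      exact ⟨B, fun y => (le_abs_self _).trans (hB y)⟩
    have hB0 : 0 ≤ B := (mul_nonneg (norm_nonneg _) (hcpos x).le).trans (hB x)
    set η := min (T / 2) (1 / (4 * (B + 1))) with hη
    have hη0 : 0 < η := lt_min (by positivity) (by positivity)
    have hη1 : η ≤ T / 2 := min_le_left _ _
    have hη2 : B * (2 * η) < 1 := by
      have : η ≤ 1 / (4 * (B + 1)) := min_le_right _ _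
      rw [le_div_iff₀ (by positivity)] at this
      nlinarith
    obtain ⟨Λ, ⟨γ, hγ, h0, h1, rfl⟩, hΛlt⟩ := exists_lt_of_csInf_lt (s := {L : ℝ | ∃ γ : ℝ → EuclideanSpace ℝ (Fin n), ContDiff ℝ 1 γ ∧
      γ 0 = x₀ ∧ γ 1 = x ∧ L = ∫ t in (0:ℝ)..1, ‖deriv γ t‖ / c (γ t)}) (b := T + η)
      ⟨_, fun s => x₀ + s • (x - x₀), by fun_prop, by simp, by simp, rfl⟩ (by
        unfold soundDist at h; linarith)
    have hsp := speed_cont hc.continuous hcpos hγ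
    have hΛT : T ≤ ∫ t in (0:ℝ)..1, ‖deriv γ t‖ / c (γ t) := by
      rw [← h]
      unfold soundDist
      refine csInf_le ⟨0, ?_⟩ ⟨γ, hγ, h0, h1, rfl⟩
      rintro _ ⟨γ', _, _, _, rfl⟩
      exact intervalIntegral.integral_nonneg zero_le_one fun s _ => div_nonneg (norm_nonneg _) (hcpos _).le
    obtain ⟨a, ha, haΛ⟩ : ∃ a ∈ Set.Icc (0:ℝ) 1, ∫ t in (0:ℝ)..a, ‖deriv γ t‖ / c (γ t) = T - η := by
      have hcont : Continuous fun a => ∫ t in (0:ℝ)..a, ‖deriv γ t‖ / c (γ t) :=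
        intervalIntegral.continuous_primitive (fun a b => hsp.intervalIntegrable a b) 0
      have := intermediate_value_Icc (zero_le_one (α := ℝ)) hcont.continuousOn
      exact this ⟨by simp only [intervalIntegral.integral_same]; linarith, by linarith⟩
    have hu0 : u 0 (γ a) = 0 := hchain γ hγ h0 a ha 0 (by rw [haΛ, abs_zero]; linarith)
    have hψa : ψ (γ a) = 0 := by
      apply ψ.zero_of_le_dist
      by_contra hcon
      exact hball (not_le.1 hcon) hu0
    have hψx : ψ (γ 1) = 1 := by rw [h1]; exact ψ.one_of_mem_closedBall (Metric.mem_closedBall_self ψ.rIn_pos.le)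
    have i0 := intervalIntegral.integral_add_adjacent_intervals (hsp.intervalIntegrable (μ := volume) 0 a) (hsp.intervalIntegrable a 1)
    have hdc := hγ.continuous_deriv (n := 1) (by norm_num)
    have hder : ∀ s, HasDerivAt (fun s => ψ (γ s)) (fderiv ℝ ψ (γ s) (deriv γ s)) s := fun s =>
      ((hψ1.differentiable (by norm_num)) (γ s)).hasFDerivAt.comp_hasDerivAt s ((hγ.differentiable (by norm_num)) s).hasDerivAt
    have hdcont : Continuous fun s => fderiv ℝ ψ (γ s) (deriv γ s) :=
      ((hψ1.continuous_fderiv (by norm_num)).comp hγ.continuous).clm_apply hdc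
    have i1 := intervalIntegral.integral_eq_sub_of_hasDerivAt (a := a) (b := 1) (fun s _ => hder s) (hdcont.intervalIntegrable _ _)
    rw [hψa, hψx, sub_zero] at i1
    have i2 : ∫ s in a..1, fderiv ℝ ψ (γ s) (deriv γ s) ≤ ∫ s in a..1, B * (‖deriv γ s‖ / c (γ s)) := by
      refine intervalIntegral.integral_mono_on ha.2 (hdcont.intervalIntegrable _ _)
        ((continuous_const.mul hsp).intervalIntegrable _ _) fun s _ => ?_
      have k1 := (le_abs_self _).trans ((fderiv ℝ ψ (γ s)).le_opNorm (deriv γ s))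
      have k2 := hcpos (γ s)
      rw [mul_div_assoc', le_div_iff₀ k2]
      have k3 := hB (γ s)
      calc _ ≤ ‖fderiv ℝ ψ (γ s)‖ * ‖deriv γ s‖ * c (γ s) := by gcongr
        _ = (‖fderiv ℝ ψ (γ s)‖ * c (γ s)) * ‖deriv γ s‖ := by ring
        _ ≤ _ := by gcongr
    rw [intervalIntegral.integral_const_mul, i1] at i2
    have i3 : B * (∫ s in a..1, ‖deriv γ s‖ / c (γ s)) ≤ B * (2 * η) := by
      gcongr
      linarith
    linarith
  · have ht0 : 0 < |t| := abs_pos.2 ht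
    have hcl : (1:ℝ) ∈ closure (Set.Ioo (0:ℝ) 1) := by
      rw [closure_Ioo (by norm_num)]; exact ⟨zero_le_one, le_refl _⟩
    have hclosed : IsClosed {s : ℝ | u (s * t) x = 0} :=
      isClosed_eq (hwc.comp (Continuous.prodMk (continuous_id.mul continuous_const) continuous_const)) continuous_const
    have hsub : Set.Ioo (0:ℝ) 1 ⊆ {s : ℝ | u (s * t) x = 0} := by
      intro s hs
      apply hlt
      rw [abs_mul, abs_of_pos hs.1]
      nlinarith [hs.2]
    have h1 := closure_minimal hsub hclosed hcl
    simpa using h1
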